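/- Let {Z(x)}_{x∈ℝ^d} be a simple, strictly stationary, sample-continuous and jointly measurable max-stable random field, let δ > 0, and let F : (0,∞) → ℝ be Borel measurable with E[|F(Z(0))|^{2+δ}] < ∞ and σ² := ∫_{ℝ^d} Cov(F(Z(0)), F(Z(x))) λ(dx) > 0. Assume there exist K > 0 and b > d·max{2, (2+δ)/δ} such that for all nonzero h ∈ ℤ^d, θ([0,1]^d) + θ([h,h+1]) − θ([0,1]^d ∪ [h,h+1]) ≤ K‖h‖^{−b}, where θ is the areal extremal coefficient of Z. Then the random field X = {F(Z(x))}_{x∈ℝ^d} satisfies the CLT: ∫_{ℝ^d} |Cov(X(0), X(x))| λ(dx) < ∞, and for every Van Hove sequence (V_n) in ℝ^d, λ(V_n)^{−1/2} ∫_{V_n} (X(x) − E[X(x)]) λ(dx) converges in distribution to N(0, σ²) as n → ∞. -/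

import Mathlib

open MeasureTheory ProbabilityTheory Filter Topology
open scoped ENNReal NNReal

noncomputable section

/-- Covariance of two real random variables. -/
def cov {Ω : Type*} [MeasurableSpace Ω] (P : Measure Ω) (X Y : Ω → ℝ) : ℝ :=
  ∫ ω, X ω * Y ω ∂P - (∫ ω, X ω ∂P) * (∫ ω, Y ω ∂P)

/-- The lattice point `h ∈ ℤ^d` viewed as a point of Euclidean space `ℝ^d`. -/
def toE {d : ℕ} (h : Fin d → ℤ) : EuclideanSpace ℝ (Fin d) :=
  (EuclideanSpace.equiv (Fin d) ℝ).symm fun i => (h i : ℝ)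

/-- The unit cube `[h, h+1] ⊆ ℝ^d` based at a lattice point `h ∈ ℤ^d`. -/
def cube {d : ℕ} (h : Fin d → ℤ) : Set (EuclideanSpace ℝ (Fin d)) :=
  {x | ∀ i, (h i : ℝ) ≤ x i ∧ x i ≤ (h i : ℝ) + 1}

/-- A Van Hove sequence in `ℝ^d`: bounded measurable sets increasing to `ℝ^d`, with
volume tending to infinity, such that the volume of any `r`-neighbourhood of the
boundary is asymptotically negligible compared to the volume. -/
def IsVanHove {d : ℕ} (V : ℕ → Set (EuclideanSpace ℝ (Fin d))) : Prop :=
  (∀ n, Bornology.IsBounded (V n)) ∧ (∀ n, MeasurableSet (V n)) ∧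
  (∀ n, V n ⊆ V (n + 1)) ∧ (⋃ n, V n) = Set.univ ∧
  Tendsto (fun n => (volume (V n)).toReal) atTop atTop ∧
  (∀ r > 0,
    Tendsto
      (fun n => (volume {x | Metric.infDist x (frontier (V n)) ≤ r}).toReal
        / (volume (V n)).toReal) atTop (𝓝 0))

/-- Convergence in distribution of a sequence of real random variables to a limit law,
tested against bounded continuous functions. -/
def TendstoInDistribution {Ω : Type*} [MeasurableSpace Ω] (P : Measure Ω)
    (S : ℕ → Ω → ℝ) (μ : Measure ℝ) : Prop :=
  ∀ f : BoundedContinuousFunction ℝ ℝ,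
    Tendsto (fun n => ∫ ω, f (S n ω) ∂P) atTop (𝓝 (∫ x, f x ∂μ))

/-- The areal extremal coefficient `θ(S) = −log P(sup_{x∈S} Z(x) ≤ 1)` of a random
field `Z` on a set `S`. -/
def extremalCoeff {d : ℕ} {Ω : Type*} [MeasurableSpace Ω] (P : Measure Ω)
    (Z : EuclideanSpace ℝ (Fin d) → Ω → ℝ) (S : Set (EuclideanSpace ℝ (Fin d))) : ℝ :=
  - Real.log (P {ω | ∀ x ∈ S, Z x ω ≤ 1}).toReal

/-- A probability measure on `ℝ^ι` with strictly positive coordinates whose distribution function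
satisfies the functional equation of max-stable laws with unit Fréchet scaling. -/
structure IsMaxStableLaw {ι : Type*} (μ : Measure (ι → ℝ)) : Prop where
  pow_Iic : ∀ T : ℕ, 1 ≤ T → ∀ z : ι → ℝ, (∀ i, 0 < z i) →
    μ (Set.Iic ((T : ℝ) • z)) ^ T = μ (Set.Iic z)
  nonpos_null : ∀ i, μ {u | u i ≤ 0} = 0

namespace IsMaxStableLaw

variable {ι : Type*} {μ : Measure (ι → ℝ)}

lemma ae_pos [Countable ι] (h : IsMaxStableLaw μ) : ∀ᵐ u ∂μ, ∀ i, 0 < u i := by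
  rw [ae_all_iff]
  intro i
  rw [ae_iff]
  simpa using h.nonpos_null i

lemma smul_Iic [IsProbabilityMeasure μ] (h : IsMaxStableLaw μ) (k : ℕ) (z : ι → ℝ)
    (hz : ∀ i, 0 < z i) :
    μ {u | (k : ℝ) • u ≤ z} = μ (Set.Iic z) ^ k := by
  rcases Nat.eq_zero_or_pos k with rfl | hk
  · have : {u : ι → ℝ | ((0 : ℕ) : ℝ) • u ≤ z} = Set.univ := by
      ext u
      simp only [Nat.cast_zero, zero_smul, Set.mem_ofPred_eq, Set.mem_univ, iff_true]
      exact fun i => (hz i).le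
    rw [this, measure_univ, pow_zero]
  · have hk' : (0 : ℝ) < k := by exact_mod_cast hk
    have h1 : {u : ι → ℝ | (k : ℝ) • u ≤ z} = Set.Iic ((k : ℝ)⁻¹ • z) := by
      ext u
      simp only [Set.mem_ofPred_eq, Set.mem_Iic, Pi.le_def, Pi.smul_apply, smul_eq_mul]
      refine forall_congr' fun i => ?_
      rw [le_inv_mul_iff₀ hk']
    rw [h1, ← h.pow_Iic k hk ((k : ℝ)⁻¹ • z) fun i => by
      simpa using mul_pos (inv_pos.2 hk') (hz i), smul_smul, mul_inv_cancel₀ hk'.ne', one_smul]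

lemma measurable_sup_smul (k l : ℕ) :
    Measurable fun p : (ι → ℝ) × (ι → ℝ) => (k : ℝ) • p.1 ⊔ (l : ℝ) • p.2 :=
  measurable_pi_lambda _ fun i => Measurable.max (by fun_prop) (by fun_prop)

variable [Fintype ι] [IsProbabilityMeasure μ]

lemma map_sup_eq (h : IsMaxStableLaw μ) {k l : ℕ} (hkl : 0 < k + l) :
    (μ.prod μ).map (fun p => (k : ℝ) • p.1 ⊔ (l : ℝ) • p.2) =
      μ.map (fun u => ((k + l : ℕ) : ℝ) • u) := by
  classical
  have hm1 := measurable_sup_smul (ι := ι) k l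
  have hm2 : Measurable fun u : ι → ℝ => ((k + l : ℕ) : ℝ) • u := by fun_prop
  have := Measure.isProbabilityMeasure_map (μ := μ.prod μ) hm1.aemeasurable
  have := Measure.isProbabilityMeasure_map (μ := μ) hm2.aemeasurable
  refine ext_of_generate_finite
    (Set.pi Set.univ '' Set.pi Set.univ fun _ : ι => Set.range (Set.Iic : ℝ → Set ℝ)) ?_ ?_ ?_ ?_
  · rw [generateFrom_eq_pi]
    · intro i
      rw [BorelSpace.measurable_eq (α := ℝ), borel_eq_generateFrom_Iic]
    · intro i
      refine ⟨fun n => Set.Iic (n : ℝ), fun n => ⟨_, rfl⟩, ?_⟩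
      ext x
      simpa using exists_nat_ge x
  · refine IsPiSystem.pi fun i => ?_
    exact isPiSystem_Iic
  · rintro _ ⟨s, hs, rfl⟩
    simp only [Set.mem_pi, Set.mem_univ, Set.mem_range, forall_true_left] at hs
    choose z hz using hs
    have hset : Set.pi Set.univ s = Set.Iic z := by
      ext u
      simp [← hz, Pi.le_def]
    rw [hset, Measure.map_apply hm1 measurableSet_Iic, Measure.map_apply hm2 measurableSet_Iic]
    by_cases hpos : ∀ i, 0 < z i
    · have : (fun p : (ι → ℝ) × (ι → ℝ) => (k : ℝ) • p.1 ⊔ (l : ℝ) • p.2) ⁻¹' Set.Iic z =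
          {u | (k : ℝ) • u ≤ z} ×ˢ {u | (l : ℝ) • u ≤ z} := by
        ext p
        simp
      rw [this, Measure.prod_prod, h.smul_Iic k z hpos, h.smul_Iic l z hpos, ← pow_add,
        ← h.smul_Iic (k + l) z hpos]
      rfl
    · push Not at hpos
      obtain ⟨i, hi⟩ := hpos
      have hA : μ ((fun u : ι → ℝ => ((k + l : ℕ) : ℝ) • u) ⁻¹' Set.Iic z) = 0 := by
        refine measure_mono_null (fun u hu => ?_) (h.nonpos_null i)
        have h1 : ((k + l : ℕ) : ℝ) * u i ≤ z i := hu i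
        have h2 : (0 : ℝ) < ((k + l : ℕ) : ℝ) := by exact_mod_cast hkl
        have : u i ≤ 0 := by
          by_contra hc
          push Not at hc
          nlinarith [mul_pos h2 hc]
        exact this
      rw [hA]
      rcases Nat.eq_zero_or_pos k with hk | hk
      · have hl : (0 : ℝ) < l := by
          have : 0 < l := by omega
          exact_mod_cast this
        refine measure_mono_null (t := Set.univ ×ˢ {u : ι → ℝ | u i ≤ 0}) (fun p hp => ?_) (by
          rw [Measure.prod_prod, h.nonpos_null i, mul_zero])
        have h1 : (k : ℝ) * p.1 i ⊔ (l : ℝ) * p.2 i ≤ z i := hp i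
        have h2 := le_trans le_sup_right h1
        refine ⟨trivial, ?_⟩
        by_contra hc
        have hc' : 0 < p.2 i := by simpa using hc
        nlinarith [mul_pos hl hc']
      · have hl : (0 : ℝ) < k := by exact_mod_cast hk
        refine measure_mono_null (t := {u : ι → ℝ | u i ≤ 0} ×ˢ Set.univ) (fun p hp => ?_) (by
          rw [Measure.prod_prod, h.nonpos_null i, zero_mul])
        have h1 : (k : ℝ) * p.1 i ⊔ (l : ℝ) * p.2 i ≤ z i := hp i
        have h2 := le_trans le_sup_left h1
        refine ⟨?_, trivial⟩
        by_contra hc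
        have hc' : 0 < p.1 i := by simpa using hc
        nlinarith [mul_pos hl hc']
  · rw [measure_univ, measure_univ]

lemma lintegral_sup_eq (h : IsMaxStableLaw μ) {k l : ℕ} (hkl : 0 < k + l)
    {Φ : (ι → ℝ) → ℝ≥0∞} (hΦ : Measurable Φ) :
    ∫⁻ u, ∫⁻ v, Φ ((k : ℝ) • u ⊔ (l : ℝ) • v) ∂μ ∂μ = ∫⁻ u, Φ (((k + l : ℕ) : ℝ) • u) ∂μ := by
  have hm1 := measurable_sup_smul (ι := ι) k l
  have hm2 : Measurable fun u : ι → ℝ => ((k + l : ℕ) : ℝ) • u := by fun_prop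
  rw [← lintegral_map hΦ hm2, ← h.map_sup_eq hkl, lintegral_map hΦ hm1, lintegral_prod]
  exact (hΦ.comp hm1).aemeasurable

lemma integral_sup_eq (h : IsMaxStableLaw μ) {k l : ℕ} (hkl : 0 < k + l)
    {Φ : (ι → ℝ) → ℂ} (hΦ : Measurable Φ) {c : ℝ} (hc : ∀ u, ‖Φ u‖ ≤ c) :
    ∫ u, ∫ v, Φ ((k : ℝ) • u ⊔ (l : ℝ) • v) ∂μ ∂μ = ∫ u, Φ (((k + l : ℕ) : ℝ) • u) ∂μ := by
  have hm1 := measurable_sup_smul (ι := ι) k l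
  have hm2 : Measurable fun u : ι → ℝ => ((k + l : ℕ) : ℝ) • u := by fun_prop
  rw [← integral_map hm2.aemeasurable hΦ.aestronglyMeasurable, ← h.map_sup_eq hkl,
    integral_map hm1.aemeasurable hΦ.aestronglyMeasurable, integral_prod]
  exact Integrable.of_bound (hΦ.comp hm1).aestronglyMeasurable c (ae_of_all _ fun p => hc _)

end IsMaxStableLaw

/-- If `U` and `V` stay close to constants then their covariance is controlled by the product of
the deviations. -/
lemma enorm_integral_mul_sub_le {X : Type*} [MeasurableSpace X] {μ : Measure X}
    [IsProbabilityMeasure μ] {U V : X → ℂ} (hU : Integrable U μ) (hV : Integrable V μ)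
    (hUV : Integrable (fun x => U x * V x) μ) (U₀ V₀ : ℂ) {p q : X → ℝ≥0∞} {C₁ C₂ : ℝ≥0∞}
    (hp : Measurable p) (hq : Measurable q)
    (hUp : ∀ x, ‖U x - U₀‖ₑ ≤ C₁ * p x) (hVq : ∀ x, ‖V x - V₀‖ₑ ≤ C₂ * q x) :
    ‖∫ x, U x * V x ∂μ - (∫ x, U x ∂μ) * ∫ x, V x ∂μ‖ₑ ≤
      C₁ * C₂ * (∫⁻ x, p x * q x ∂μ + (∫⁻ x, p x ∂μ) * ∫⁻ x, q x ∂μ) := by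
  have key : ∫ x, U x * V x ∂μ - (∫ x, U x ∂μ) * ∫ x, V x ∂μ =
      ∫ x, (U x - U₀) * (V x - V₀) ∂μ - (∫ x, (U x - U₀) ∂μ) * ∫ x, (V x - V₀) ∂μ := by
    have e : ∀ x, (U x - U₀) * (V x - V₀) = U x * V x - U x * V₀ - U₀ * V x + U₀ * V₀ := by
      intro x; ring
    have i1 : Integrable (fun x => U x * V x - U x * V₀) μ := hUV.sub (hU.mul_const _)
    have i2 : Integrable (fun x => U x * V x - U x * V₀ - U₀ * V x) μ := i1.sub (hV.const_mul _)
    simp_rw [e]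
    rw [integral_sub hU (integrable_const _), integral_sub hV (integrable_const _),
      integral_add i2 (integrable_const _), integral_sub i1 (hV.const_mul _),
      integral_sub hUV (hU.mul_const _), integral_mul_const, integral_const_mul]
    simp
    ring
  rw [key]
  have hUp' : ∫⁻ x, ‖U x - U₀‖ₑ ∂μ ≤ C₁ * ∫⁻ x, p x ∂μ := by
    rw [← lintegral_const_mul _ hp]
    exact lintegral_mono hUp
  have hVq' : ∫⁻ x, ‖V x - V₀‖ₑ ∂μ ≤ C₂ * ∫⁻ x, q x ∂μ := by
    rw [← lintegral_const_mul _ hq]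
    exact lintegral_mono hVq
  calc _ ≤ ‖∫ x, (U x - U₀) * (V x - V₀) ∂μ‖ₑ +
        ‖(∫ x, (U x - U₀) ∂μ) * ∫ x, (V x - V₀) ∂μ‖ₑ := enorm_sub_le
    _ ≤ ∫⁻ x, ‖(U x - U₀) * (V x - V₀)‖ₑ ∂μ +
        (∫⁻ x, ‖U x - U₀‖ₑ ∂μ) * ∫⁻ x, ‖V x - V₀‖ₑ ∂μ := by
      rw [enorm_mul]
      gcongr <;> exact enorm_integral_le_lintegral_enorm _
    _ ≤ ∫⁻ x, C₁ * C₂ * (p x * q x) ∂μ + (C₁ * ∫⁻ x, p x ∂μ) * (C₂ * ∫⁻ x, q x ∂μ) := by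
      gcongr with x
      rw [enorm_mul]
      calc _ ≤ (C₁ * p x) * (C₂ * q x) := mul_le_mul' (hUp x) (hVq x)
        _ = _ := by ring
    _ = _ := by
      rw [lintegral_const_mul _ (show Measurable fun x => p x * q x from hp.mul hq)]
      ring

lemma lintegral_lintegral_mul_swap {X Y : Type*} [MeasurableSpace X] [MeasurableSpace Y]
    {μ : Measure X} {ν : Measure Y} [SFinite μ] [SFinite ν] {F G : Y → X → ℝ≥0∞}
    (hF : Measurable (Function.uncurry F)) (hG : Measurable (Function.uncurry G)) :
    ∫⁻ x, (∫⁻ u, F u x ∂ν) * (∫⁻ u, G u x ∂ν) ∂μ +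
        (∫⁻ x, ∫⁻ u, F u x ∂ν ∂μ) * (∫⁻ x, ∫⁻ u, G u x ∂ν ∂μ) =
      ∫⁻ u, ∫⁻ v, (∫⁻ x, F u x * G v x ∂μ + (∫⁻ x, F u x ∂μ) * ∫⁻ x, G v x ∂μ) ∂ν ∂ν := by
  have hF' : Measurable (Function.uncurry fun x u => F u x) := hF.comp measurable_swap
  have hG' : Measurable (Function.uncurry fun x u => G u x) := hG.comp measurable_swap
  have h1 : ∫⁻ x, (∫⁻ u, F u x ∂ν) * (∫⁻ u, G u x ∂ν) ∂μ =
      ∫⁻ u, ∫⁻ v, ∫⁻ x, F u x * G v x ∂μ ∂ν ∂ν := by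
    have e : ∀ x, (∫⁻ u, F u x ∂ν) * (∫⁻ u, G u x ∂ν) = ∫⁻ u, ∫⁻ v, F u x * G v x ∂ν ∂ν := by
      intro x
      have a1 : Measurable fun u => F u x := hF.comp (measurable_id.prodMk measurable_const)
      have a2 : Measurable fun u => G u x := hG.comp (measurable_id.prodMk measurable_const)
      rw [← lintegral_mul_const _ a1]
      refine lintegral_congr fun u => ?_
      rw [lintegral_const_mul _ a2]
    simp_rw [e]
    rw [lintegral_lintegral_swap]
    · refine lintegral_congr fun u => ?_
      rw [lintegral_lintegral_swap]
      have a1 : Measurable fun x => F u x := hF.comp (measurable_const.prodMk measurable_id)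
      exact ((a1.comp measurable_fst).mul hG').aemeasurable
    · refine Measurable.aemeasurable ?_
      refine Measurable.lintegral_prod_right' (f := fun p : (X × Y) × Y =>
        F p.1.2 p.1.1 * G p.2 p.1.1) ?_
      exact (hF'.comp measurable_fst).mul
        (hG'.comp ((measurable_fst.comp measurable_fst).prodMk measurable_snd))
  have h2 : (∫⁻ x, ∫⁻ u, F u x ∂ν ∂μ) * (∫⁻ x, ∫⁻ u, G u x ∂ν ∂μ) =
      ∫⁻ u, ∫⁻ v, (∫⁻ x, F u x ∂μ) * ∫⁻ x, G v x ∂μ ∂ν ∂ν := by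
    have m1 : Measurable fun u => ∫⁻ x, F u x ∂μ := hF.lintegral_prod_right'
    have m2 : Measurable fun u => ∫⁻ x, G u x ∂μ := hG.lintegral_prod_right'
    rw [lintegral_lintegral_swap hF'.aemeasurable, lintegral_lintegral_swap hG'.aemeasurable,
      ← lintegral_mul_const _ m1]
    refine lintegral_congr fun u => ?_
    rw [lintegral_const_mul _ m2]
  rw [h1, h2, ← lintegral_add_left]
  · refine lintegral_congr fun u => ?_
    rw [← lintegral_add_left]
    refine Measurable.lintegral_prod_right' (f := fun p : Y × X => F u p.2 * G p.1 p.2) ?_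
    exact (hF.comp (measurable_const.prodMk measurable_snd)).mul hG
  · refine Measurable.lintegral_prod_right'
      (f := fun p : Y × Y => ∫⁻ x, F p.1 x * G p.2 x ∂μ) ?_
    refine Measurable.lintegral_prod_right'
      (f := fun p : (Y × Y) × X => F p.1.1 p.2 * G p.1.2 p.2) ?_
    exact (hF.comp ((measurable_fst.comp measurable_fst).prodMk measurable_snd)).mul
      (hG.comp ((measurable_snd.comp measurable_fst).prodMk measurable_snd))

section hit

variable {ι : Type*}

/-- The indicator that `x` exceeds `w` somewhere on `I`. -/
def hit (I : Set ι) (w x : ι → ℝ) : ℝ≥0∞ :=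
  Set.indicator {x : ι → ℝ | ∃ i ∈ I, w i < x i} 1 x

/-- The reciprocal of the minimum of `w` over `I`. -/
def recipMin (I : Set ι) (w : ι → ℝ) : ℝ≥0∞ := ⨆ i ∈ I, (ENNReal.ofReal (w i))⁻¹

lemma recipMin_smul (I : Set ι) {n : ℕ} (hn : 0 < n) (w : ι → ℝ) :
    recipMin I ((n : ℝ) • w) = (n : ℝ≥0∞)⁻¹ * recipMin I w := by
  simp only [recipMin, ENNReal.mul_iSup]
  refine iSup_congr fun i => iSup_congr fun _ => ?_
  rw [Pi.smul_apply, smul_eq_mul, ENNReal.ofReal_mul (by positivity), ENNReal.ofReal_natCast,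
    ENNReal.mul_inv]
  · left; exact_mod_cast hn.ne'
  · left; simp

lemma hit_biUnion_le {α : Type*} (s : Finset α) (I : α → Set ι) (w x : ι → ℝ) :
    hit (⋃ a ∈ s, I a) w x ≤ ∑ a ∈ s, hit (I a) w x := by
  by_cases h : ∃ i ∈ ⋃ a ∈ s, I a, w i < x i
  · obtain ⟨i, hi, hlt⟩ := h
    simp only [Set.mem_iUnion] at hi
    obtain ⟨a, ha, hia⟩ := hi
    calc hit (⋃ a ∈ s, I a) w x ≤ 1 := Set.indicator_le_self' (by simp) x
      _ = hit (I a) w x := by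
        rw [hit, Set.indicator_of_mem (show x ∈ {x | ∃ i ∈ I a, w i < x i} from ⟨i, hia, hlt⟩)]
        rfl
      _ ≤ _ := Finset.single_le_sum (f := fun a => hit (I a) w x) (fun _ _ => zero_le) ha
  · rw [hit, Set.indicator_of_notMem (show x ∉ {x | ∃ i ∈ ⋃ a ∈ s, I a, w i < x i} from h)]
    exact zero_le

variable [Countable ι]

lemma measurable_hit (I : Set ι) : Measurable (Function.uncurry (hit I)) := by
  have hm : MeasurableSet {p : (ι → ℝ) × (ι → ℝ) | ∃ i ∈ I, p.1 i < p.2 i} := by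
    have : {p : (ι → ℝ) × (ι → ℝ) | ∃ i ∈ I, p.1 i < p.2 i} =
        ⋃ i ∈ I, {p : (ι → ℝ) × (ι → ℝ) | p.1 i < p.2 i} := by ext p; simp
    rw [this]
    exact MeasurableSet.biUnion I.to_countable fun i _ =>
      measurableSet_lt (by fun_prop) (by fun_prop)
  exact (measurable_one.indicator hm : Measurable (Set.indicator
    {p : (ι → ℝ) × (ι → ℝ) | ∃ i ∈ I, p.1 i < p.2 i} (1 : (ι → ℝ) × (ι → ℝ) → ℝ≥0∞)))

lemma measurable_recipMin (I : Set ι) : Measurable (recipMin I) := by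
  unfold recipMin
  exact Measurable.iSup fun i => Measurable.iSup fun _ => by fun_prop

lemma lintegral_hit (μ : Measure (ι → ℝ)) (I : Set ι) (w : ι → ℝ) :
    ∫⁻ x, hit I w x ∂μ = μ {x | ∃ i ∈ I, w i < x i} := by
  have hm : MeasurableSet {x : ι → ℝ | ∃ i ∈ I, w i < x i} := by
    have : {x : ι → ℝ | ∃ i ∈ I, w i < x i} = ⋃ i ∈ I, {x : ι → ℝ | w i < x i} := by ext p; simp
    rw [this]
    exact MeasurableSet.biUnion I.to_countable fun i _ =>
      measurableSet_lt (by fun_prop) (by fun_prop)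
  exact lintegral_indicator_one hm

lemma lintegral_hit_mul_hit (μ : Measure (ι → ℝ)) (I J : Set ι) (w w' : ι → ℝ) :
    ∫⁻ x, hit I w x * hit J w' x ∂μ =
      μ {x | (∃ i ∈ I, w i < x i) ∧ ∃ j ∈ J, w' j < x j} := by
  have hm : ∀ (I : Set ι) (w : ι → ℝ), MeasurableSet {x : ι → ℝ | ∃ i ∈ I, w i < x i} := by
    intro I w
    have : {x : ι → ℝ | ∃ i ∈ I, w i < x i} = ⋃ i ∈ I, {x : ι → ℝ | w i < x i} := by ext p; simp
    rw [this]
    exact MeasurableSet.biUnion I.to_countable fun i _ =>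
      measurableSet_lt (by fun_prop) (by fun_prop)
  rw [show {x : ι → ℝ | (∃ i ∈ I, w i < x i) ∧ ∃ j ∈ J, w' j < x j} =
    {x | ∃ i ∈ I, w i < x i} ∩ {x | ∃ j ∈ J, w' j < x j} from rfl,
    ← lintegral_indicator_one ((hm I w).inter (hm J w'))]
  refine lintegral_congr fun x => ?_
  rw [Set.inter_indicator_one]
  rfl

/-- A bound on joint exceedances at a constant level yields one at a variable level. -/
lemma lintegral_hit_le {μ : Measure (ι → ℝ)} {I J : Set ι} {κ β : ℝ≥0∞} (hκ : κ ≠ 0)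
    (hΨ : ∀ r : ℝ, 0 < r → μ {x | (∃ i ∈ I, r < x i) ∧ ∃ j ∈ J, r < x j} +
        μ {x | ∃ i ∈ I, r < x i} * μ {x | ∃ j ∈ J, r < x j} ≤
      κ * (ENNReal.ofReal r)⁻¹ + β * (ENNReal.ofReal r)⁻¹ ^ 2) (w w' : ι → ℝ) :
    ∫⁻ x, hit I w x * hit J w' x ∂μ + (∫⁻ x, hit I w x ∂μ) * ∫⁻ x, hit J w' x ∂μ ≤
      κ * (recipMin I w + recipMin J w') + β * (recipMin I w ^ 2 + recipMin J w' ^ 2) := by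
  rw [lintegral_hit_mul_hit, lintegral_hit, lintegral_hit]
  set r := max (recipMin I w) (recipMin J w') with hr
  by_cases htop : r = ∞
  · have : recipMin I w + recipMin J w' = ∞ := by
      rcases max_choice (recipMin I w) (recipMin J w') with h | h <;> rw [hr, h] at htop <;>
        simp [htop]
    rw [this, ENNReal.mul_top hκ]
    simp
  by_cases hzero : r = 0
  · have hI : recipMin I w = 0 := le_antisymm (hzero ▸ le_max_left _ _) zero_le
    have : ∀ i ∈ I, False := by
      intro i hi
      have h1 : (ENNReal.ofReal (w i))⁻¹ ≤ recipMin I w := le_iSup₂_of_le i hi le_rfl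
      rw [hI] at h1
      simp at h1
    have e1 : {x : ι → ℝ | (∃ i ∈ I, w i < x i) ∧ ∃ j ∈ J, w' j < x j} = ∅ := by
      ext x
      simp only [Set.mem_ofPred_eq, Set.mem_empty_iff_false, iff_false]
      rintro ⟨⟨i, hi, _⟩, _⟩
      exact this i hi
    have e2 : {x : ι → ℝ | ∃ i ∈ I, w i < x i} = ∅ := by
      ext x
      simp only [Set.mem_ofPred_eq, Set.mem_empty_iff_false, iff_false]
      rintro ⟨i, hi, _⟩
      exact this i hi
    rw [e1, e2]
    simp
  set m : ℝ := (r⁻¹).toReal with hm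
  have hrinv : r⁻¹ ≠ ∞ := by simpa using hzero
  have hofm : ENNReal.ofReal m = r⁻¹ := ENNReal.ofReal_toReal hrinv
  have hmpos : 0 < m := ENNReal.toReal_pos (by simpa using htop) hrinv
  have hlow : ∀ (I : Set ι) (w : ι → ℝ), recipMin I w ≤ r → ∀ i ∈ I, m ≤ w i := by
    intro I w hI i hi
    have h1 : (ENNReal.ofReal (w i))⁻¹ ≤ r := (le_iSup₂_of_le i hi le_rfl).trans hI
    have h2 : ENNReal.ofReal m ≤ ENNReal.ofReal (w i) := by
      rw [hofm]; exact ENNReal.inv_le_iff_inv_le.1 h1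
    by_contra hc
    push Not at hc
    exact absurd h2 (not_le.2 ((ENNReal.ofReal_lt_ofReal_iff hmpos).2 hc))
  have hI := hlow I w (le_max_left _ _)
  have hJ := hlow J w' (le_max_right _ _)
  have hsI : {x : ι → ℝ | ∃ i ∈ I, w i < x i} ⊆ {x | ∃ i ∈ I, m < x i} :=
    fun x ⟨i, hi, h⟩ => ⟨i, hi, (hI i hi).trans_lt h⟩
  have hsJ : {x : ι → ℝ | ∃ i ∈ J, w' i < x i} ⊆ {x | ∃ i ∈ J, m < x i} :=
    fun x ⟨i, hi, h⟩ => ⟨i, hi, (hJ i hi).trans_lt h⟩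
  calc _ ≤ μ {x | (∃ i ∈ I, m < x i) ∧ ∃ j ∈ J, m < x j} +
        μ {x | ∃ i ∈ I, m < x i} * μ {x | ∃ j ∈ J, m < x j} := by
        refine add_le_add (measure_mono fun x hx => ⟨hsI hx.1, hsJ hx.2⟩) ?_
        exact mul_le_mul' (measure_mono hsI) (measure_mono hsJ)
    _ ≤ κ * r + β * r ^ 2 := by
        have := hΨ m hmpos
        rwa [hofm, inv_inv] at this
    _ ≤ _ := by
        gcongr
        · exact max_le (le_add_right le_rfl) (le_add_left le_rfl)
        · rcases max_choice (recipMin I w) (recipMin J w') with h | h <;> rw [hr, h]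
          · exact le_add_right le_rfl
          · exact le_add_left le_rfl

end hit

namespace IsMaxStableLaw

variable {ι : Type*} {μ : Measure (ι → ℝ)} [IsProbabilityMeasure μ]

/-- The average of `f` over the maximum of its argument and `t` times a `μ`-distributed vector. -/
def smooth (μ : Measure (ι → ℝ)) (t : ℕ) (f : (ι → ℝ) → ℂ) (a : ι → ℝ) : ℂ :=
  ∫ u, f (a ⊔ (t : ℝ) • u) ∂μ

lemma measurable_sup_smul_right (t : ℕ) :
    Measurable fun p : (ι → ℝ) × (ι → ℝ) => p.1 ⊔ (t : ℝ) • p.2 :=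
  measurable_pi_lambda _ fun i => Measurable.max (by fun_prop) (by fun_prop)

lemma measurable_sup_pair :
    Measurable fun p : (ι → ℝ) × (ι → ℝ) => p.1 ⊔ p.2 :=
  measurable_pi_lambda _ fun i => Measurable.max (by fun_prop) (by fun_prop)

lemma measurable_smooth (t : ℕ) {f : (ι → ℝ) → ℂ} (hf : Measurable f) :
    Measurable (smooth μ t f) :=
  ((hf.comp (measurable_sup_smul_right t)).stronglyMeasurable.integral_prod_right').measurable

lemma norm_smooth_le (t : ℕ) {f : (ι → ℝ) → ℂ} {c : ℝ} (hc : ∀ u, ‖f u‖ ≤ c) (a : ι → ℝ) :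
    ‖smooth μ t f a‖ ≤ c := by
  have := norm_integral_le_of_norm_le_const (μ := μ) (C := c)
    (ae_of_all _ fun u => hc (a ⊔ (t : ℝ) • u))
  simpa [smooth] using this

variable [Fintype ι]

lemma enorm_smooth_sub_le (t : ℕ) {f : (ι → ℝ) → ℂ} (hf : Measurable f) {c : ℝ}
    (hc : ∀ u, ‖f u‖ ≤ c) {I : Set ι} (hI : DependsOn f I) (a x : ι → ℝ) :
    ‖smooth μ t f (a ⊔ x) - smooth μ t f a‖ₑ ≤
      ENNReal.ofReal (2 * c) * ∫⁻ u, hit I (a ⊔ (t : ℝ) • u) x ∂μ := by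
  have hm : ∀ b : ι → ℝ, Measurable fun u : ι → ℝ => b ⊔ (t : ℝ) • u := fun b =>
    (measurable_sup_smul_right t).comp (measurable_const.prodMk measurable_id)
  have hi : ∀ b, Integrable (fun u => f (b ⊔ (t : ℝ) • u)) μ := fun b =>
    Integrable.of_bound (hf.comp (hm b)).aestronglyMeasurable c (ae_of_all _ fun _ => hc _)
  have hh : Measurable fun u => hit I (a ⊔ (t : ℝ) • u) x :=
    (measurable_hit I).comp ((hm a).prodMk measurable_const)
  rw [smooth, smooth, ← integral_sub (hi _) (hi _), ← lintegral_const_mul _ hh]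
  refine (enorm_integral_le_lintegral_enorm _).trans (lintegral_mono fun u => ?_)
  by_cases h : ∃ i ∈ I, (a ⊔ (t : ℝ) • u) i < x i
  · have h1 : hit I (a ⊔ (t : ℝ) • u) x = 1 := by
      rw [hit, Set.indicator_of_mem (show x ∈ {x | ∃ i ∈ I, (a ⊔ (t : ℝ) • u) i < x i} from h)]
      rfl
    rw [h1, mul_one, ← ofReal_norm]
    refine ENNReal.ofReal_le_ofReal ((norm_sub_le _ _).trans ?_)
    linarith [hc (a ⊔ x ⊔ (t : ℝ) • u), hc (a ⊔ (t : ℝ) • u)]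
  · have : f (a ⊔ x ⊔ (t : ℝ) • u) = f (a ⊔ (t : ℝ) • u) := by
      refine hI fun i hi => ?_
      have h2 : ¬ (a ⊔ (t : ℝ) • u) i < x i := fun hlt => h ⟨i, hi, hlt⟩
      rw [sup_right_comm]
      have h3 := not_lt.1 h2
      simpa using h3
    rw [this, sub_self]
    simp

lemma smooth_succ (h : IsMaxStableLaw μ) (t : ℕ) {f : (ι → ℝ) → ℂ} (hf : Measurable f) {c : ℝ}
    (hc : ∀ u, ‖f u‖ ≤ c) (a : ι → ℝ) :
    smooth μ (t + 1) f a = ∫ x, smooth μ t f (a ⊔ x) ∂μ := by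
  have hm : Measurable fun u : ι → ℝ => a ⊔ u :=
    measurable_sup_pair.comp (measurable_const.prodMk measurable_id)
  have := h.integral_sup_eq (k := 1) (l := t) (by omega) (hf.comp hm) (c := c) fun u => hc _
  simp only [smooth]
  rw [add_comm t 1]
  simp only [Function.comp, Nat.cast_one, one_smul] at this
  rw [← this]
  simp only [sup_assoc]

/-- The partially decoupled correlation of `f` and `g`. -/
def decoupled (μ : Measure (ι → ℝ)) (f g : (ι → ℝ) → ℂ) (s t : ℕ) : ℂ :=
  ∫ a, smooth μ t f ((s : ℝ) • a) * smooth μ t g ((s : ℝ) • a) ∂μ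

lemma enorm_decoupled_sub_le (h : IsMaxStableLaw μ) {f g : (ι → ℝ) → ℂ} (hf : Measurable f)
    (hg : Measurable g) {cf cg : ℝ} (hcf : ∀ u, ‖f u‖ ≤ cf) (hcg : ∀ u, ‖g u‖ ≤ cg)
    {I J : Set ι} (hI : DependsOn f I) (hJ : DependsOn g J) (s t : ℕ) :
    ‖decoupled μ f g (s + 1) t - decoupled μ f g s (t + 1)‖ₑ ≤
      ENNReal.ofReal (2 * cf) * ENNReal.ofReal (2 * cg) *
        ∫⁻ a, ∫⁻ u, ∫⁻ v, (∫⁻ x, hit I ((s : ℝ) • a ⊔ (t : ℝ) • u) x *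
            hit J ((s : ℝ) • a ⊔ (t : ℝ) • v) x ∂μ +
          (∫⁻ x, hit I ((s : ℝ) • a ⊔ (t : ℝ) • u) x ∂μ) *
            ∫⁻ x, hit J ((s : ℝ) • a ⊔ (t : ℝ) • v) x ∂μ) ∂μ ∂μ ∂μ := by
  have hSf := measurable_smooth (μ := μ) t hf
  have hSg := measurable_smooth (μ := μ) t hg
  have hsup : ∀ b : ι → ℝ, Measurable fun x : ι → ℝ => b ⊔ x := fun b =>
    measurable_sup_pair.comp (measurable_const.prodMk measurable_id)
  have bdd : ∀ b, ‖smooth μ t f b * smooth μ t g b‖ ≤ cf * cg := fun b => by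
    rw [norm_mul]
    exact mul_le_mul (norm_smooth_le t hcf b) (norm_smooth_le t hcg b) (norm_nonneg _)
      ((norm_nonneg _).trans (hcf b))
  have e1 : decoupled μ f g (s + 1) t =
      ∫ a, ∫ x, smooth μ t f ((s : ℝ) • a ⊔ x) * smooth μ t g ((s : ℝ) • a ⊔ x) ∂μ ∂μ := by
    have := h.integral_sup_eq (k := s) (l := 1) (by omega) (hSf.mul hSg) (c := cf * cg) bdd
    simp only [Nat.cast_one, one_smul] at this
    exact this.symm
  have e2 : decoupled μ f g s (t + 1) =
      ∫ a, (∫ x, smooth μ t f ((s : ℝ) • a ⊔ x) ∂μ) *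
        (∫ x, smooth μ t g ((s : ℝ) • a ⊔ x) ∂μ) ∂μ := by
    simp only [decoupled, h.smooth_succ t hf hcf, h.smooth_succ t hg hcg]
  have hms : Measurable fun p : (ι → ℝ) × (ι → ℝ) => (s : ℝ) • p.1 ⊔ p.2 :=
    measurable_sup_pair.comp ((show Measurable fun p : (ι → ℝ) × (ι → ℝ) => (s : ℝ) • p.1 by
      fun_prop).prodMk measurable_snd)
  have i1 : Integrable (fun a => ∫ x, smooth μ t f ((s : ℝ) • a ⊔ x) *
      smooth μ t g ((s : ℝ) • a ⊔ x) ∂μ) μ := by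
    refine Integrable.of_bound (StronglyMeasurable.integral_prod_right'
      (f := fun p : (ι → ℝ) × (ι → ℝ) => smooth μ t f ((s : ℝ) • p.1 ⊔ p.2) *
        smooth μ t g ((s : ℝ) • p.1 ⊔ p.2))
      ((hSf.comp hms).mul (hSg.comp hms)).stronglyMeasurable).aestronglyMeasurable (cf * cg)
      (ae_of_all _ fun a => ?_)
    simpa using norm_integral_le_of_norm_le_const (μ := μ) (C := cf * cg)
      (ae_of_all _ fun x => bdd ((s : ℝ) • a ⊔ x))
  have i2 : Integrable (fun a => (∫ x, smooth μ t f ((s : ℝ) • a ⊔ x) ∂μ) *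
      (∫ x, smooth μ t g ((s : ℝ) • a ⊔ x) ∂μ)) μ := by
    refine Integrable.of_bound (AEStronglyMeasurable.mul
      (StronglyMeasurable.integral_prod_right'
        (f := fun p : (ι → ℝ) × (ι → ℝ) => smooth μ t f ((s : ℝ) • p.1 ⊔ p.2))
        (hSf.comp hms).stronglyMeasurable).aestronglyMeasurable
      (StronglyMeasurable.integral_prod_right'
        (f := fun p : (ι → ℝ) × (ι → ℝ) => smooth μ t g ((s : ℝ) • p.1 ⊔ p.2))
        (hSg.comp hms).stronglyMeasurable).aestronglyMeasurable) (cf * cg)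
      (ae_of_all _ fun a => ?_)
    rw [norm_mul]
    refine mul_le_mul ?_ ?_ (norm_nonneg _) ((norm_nonneg _).trans (hcf 0))
    · simpa using norm_integral_le_of_norm_le_const (μ := μ) (C := cf)
        (ae_of_all _ fun x => norm_smooth_le (μ := μ) t hcf ((s : ℝ) • a ⊔ x))
    · simpa using norm_integral_le_of_norm_le_const (μ := μ) (C := cg)
        (ae_of_all _ fun x => norm_smooth_le (μ := μ) t hcg ((s : ℝ) • a ⊔ x))
  rw [e1, e2, ← integral_sub i1 i2]
  refine (enorm_integral_le_lintegral_enorm _).trans ?_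
  rw [← lintegral_const_mul' _ _ (ENNReal.mul_ne_top ENNReal.ofReal_ne_top ENNReal.ofReal_ne_top)]
  refine lintegral_mono fun a => ?_
  have hhit : ∀ I : Set ι, Measurable (Function.uncurry fun u x : ι → ℝ =>
      hit I ((s : ℝ) • a ⊔ (t : ℝ) • u) x) := fun I =>
    (measurable_hit I).comp (((measurable_sup_smul_right t).comp
      (measurable_const.prodMk measurable_fst)).prodMk measurable_snd)
  rw [← lintegral_lintegral_mul_swap (hhit I) (hhit J)]
  refine enorm_integral_mul_sub_le ?_ ?_ ?_ (smooth μ t f ((s : ℝ) • a))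
    (smooth μ t g ((s : ℝ) • a))
    ?_ ?_ (fun x => enorm_smooth_sub_le t hf hcf hI _ x)
    (fun x => enorm_smooth_sub_le t hg hcg hJ _ x)
  · exact Integrable.of_bound (hSf.comp (hsup _)).aestronglyMeasurable cf
      (ae_of_all _ fun x => norm_smooth_le t hcf _)
  · exact Integrable.of_bound (hSg.comp (hsup _)).aestronglyMeasurable cg
      (ae_of_all _ fun x => norm_smooth_le t hcg _)
  · exact Integrable.of_bound ((hSf.comp (hsup _)).mul (hSg.comp (hsup _))).aestronglyMeasurable
      (cf * cg) (ae_of_all _ fun x => bdd _)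
  · exact ((hhit I).comp measurable_swap).lintegral_prod_right'
  · exact ((hhit J).comp measurable_swap).lintegral_prod_right'

lemma lintegral_pair_le (h : IsMaxStableLaw μ) {I J : Set ι} {κ β D : ℝ≥0∞} (hκ : κ ≠ 0)
    (hΨ : ∀ r : ℝ, 0 < r → μ {x | (∃ i ∈ I, r < x i) ∧ ∃ j ∈ J, r < x j} +
        μ {x | ∃ i ∈ I, r < x i} * μ {x | ∃ j ∈ J, r < x j} ≤
      κ * (ENNReal.ofReal r)⁻¹ + β * (ENNReal.ofReal r)⁻¹ ^ 2)
    (hI1 : ∫⁻ u, recipMin I u ∂μ ≤ D) (hI2 : ∫⁻ u, recipMin I u ^ 2 ∂μ ≤ D)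
    (hJ1 : ∫⁻ u, recipMin J u ∂μ ≤ D) (hJ2 : ∫⁻ u, recipMin J u ^ 2 ∂μ ≤ D)
    {s t : ℕ} (hst : 0 < s + t) :
    ∫⁻ a, ∫⁻ u, ∫⁻ v, (∫⁻ x, hit I ((s : ℝ) • a ⊔ (t : ℝ) • u) x *
            hit J ((s : ℝ) • a ⊔ (t : ℝ) • v) x ∂μ +
          (∫⁻ x, hit I ((s : ℝ) • a ⊔ (t : ℝ) • u) x ∂μ) *
            ∫⁻ x, hit J ((s : ℝ) • a ⊔ (t : ℝ) • v) x ∂μ) ∂μ ∂μ ∂μ ≤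
      2 * D * κ * ((s + t : ℕ) : ℝ≥0∞)⁻¹ + 2 * D * β * ((s + t : ℕ) : ℝ≥0∞)⁻¹ ^ 2 := by
  set N : ℝ≥0∞ := ((s + t : ℕ) : ℝ≥0∞)⁻¹ with hN
  have hsup : ∀ b : ι → ℝ, Measurable fun x : ι → ℝ => b ⊔ (t : ℝ) • x := fun b =>
    (measurable_sup_smul_right t).comp (measurable_const.prodMk measurable_id)
  have mI := measurable_recipMin I
  have mJ := measurable_recipMin J
  have hm2 : Measurable fun p : (ι → ℝ) × (ι → ℝ) => (s : ℝ) • p.1 ⊔ (t : ℝ) • p.2 :=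
    measurable_sup_smul s t
  let Φ : Set ι → (ι → ℝ) → ℝ≥0∞ := fun I w => κ * recipMin I w + β * recipMin I w ^ 2
  have mΦ : ∀ I, Measurable (Φ I) := fun I =>
    ((measurable_recipMin I).const_mul κ).add (((measurable_recipMin I).pow_const 2).const_mul β)
  have hΦ : ∀ I : Set ι, ∫⁻ u, recipMin I u ∂μ ≤ D → ∫⁻ u, recipMin I u ^ 2 ∂μ ≤ D →
      ∫⁻ a, ∫⁻ u, Φ I ((s : ℝ) • a ⊔ (t : ℝ) • u) ∂μ ∂μ ≤ D * κ * N + D * β * N ^ 2 := by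
    intro I h1 h2
    have m := measurable_recipMin I
    rw [h.lintegral_sup_eq hst (mΦ I)]
    simp only [Φ, recipMin_smul I hst, mul_pow]
    rw [lintegral_add_left (by fun_prop), lintegral_const_mul _ (by fun_prop),
      lintegral_const_mul _ (by fun_prop), lintegral_const_mul _ (by fun_prop),
      lintegral_const_mul _ (by fun_prop)]
    calc _ ≤ κ * (N * D) + β * (N ^ 2 * D) := by gcongr
      _ = _ := by ring
  calc _ ≤ ∫⁻ a, ∫⁻ u, ∫⁻ v, (Φ I ((s : ℝ) • a ⊔ (t : ℝ) • u) +
          Φ J ((s : ℝ) • a ⊔ (t : ℝ) • v)) ∂μ ∂μ ∂μ := by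
        refine lintegral_mono fun a => lintegral_mono fun u => lintegral_mono fun v => ?_
        refine (lintegral_hit_le hκ hΨ _ _).trans (le_of_eq ?_)
        simp only [Φ]
        ring
    _ = ∫⁻ a, ∫⁻ u, Φ I ((s : ℝ) • a ⊔ (t : ℝ) • u) ∂μ ∂μ +
          ∫⁻ a, ∫⁻ v, Φ J ((s : ℝ) • a ⊔ (t : ℝ) • v) ∂μ ∂μ := by
        rw [← lintegral_add_left (show Measurable fun a => ∫⁻ u, Φ I ((s : ℝ) • a ⊔ (t : ℝ) • u) ∂μ
          from ((mΦ I).comp hm2).lintegral_prod_right')]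
        refine lintegral_congr fun a => ?_
        have e : ∀ u, ∫⁻ v, (Φ I ((s : ℝ) • a ⊔ (t : ℝ) • u) +
          Φ J ((s : ℝ) • a ⊔ (t : ℝ) • v)) ∂μ = Φ I ((s : ℝ) • a ⊔ (t : ℝ) • u) +
            ∫⁻ v, Φ J ((s : ℝ) • a ⊔ (t : ℝ) • v) ∂μ := by
          intro u
          rw [lintegral_add_left measurable_const, lintegral_const, measure_univ, mul_one]
        simp_rw [e]
        rw [lintegral_add_right _ measurable_const, lintegral_const, measure_univ, mul_one]
    _ ≤ (D * κ * N + D * β * N ^ 2) + (D * κ * N + D * β * N ^ 2) :=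
        add_le_add (hΦ I hI1 hI2) (hΦ J hJ1 hJ2)
    _ = _ := by ring

end IsMaxStableLaw

lemma lintegral_sum_sum {X α γ : Type*} [MeasurableSpace X] {μ : Measure X} (s : Finset α)
    (s' : Finset γ) {F : α → γ → X → ℝ≥0∞} (hF : ∀ a b, Measurable (F a b)) :
    ∫⁻ x, ∑ a ∈ s, ∑ b ∈ s', F a b x ∂μ = ∑ a ∈ s, ∑ b ∈ s', ∫⁻ x, F a b x ∂μ := by
  rw [lintegral_finsetSum _ fun a _ => Finset.measurable_fun_sum _ fun b _ => hF a b]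
  exact Finset.sum_congr rfl fun a _ => lintegral_finsetSum _ fun b _ => hF a b

lemma lintegral_triple_sum_sum {X α γ : Type*} [MeasurableSpace X] {μ : Measure X} [SFinite μ]
    (s : Finset α) (s' : Finset γ) {F : α → γ → (X × X) × X → ℝ≥0∞}
    (hF : ∀ a b, Measurable (F a b)) :
    ∫⁻ x, ∫⁻ u, ∫⁻ v, ∑ a ∈ s, ∑ b ∈ s', F a b ((x, u), v) ∂μ ∂μ ∂μ =
      ∑ a ∈ s, ∑ b ∈ s', ∫⁻ x, ∫⁻ u, ∫⁻ v, F a b ((x, u), v) ∂μ ∂μ ∂μ := by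
  have m2 : ∀ a b, Measurable fun p : X × X => ∫⁻ v, F a b (p, v) ∂μ := fun a b =>
    (hF a b).lintegral_prod_right'
  rw [← lintegral_sum_sum s s' fun a b => (m2 a b).lintegral_prod_right']
  refine lintegral_congr fun x => ?_
  rw [← lintegral_sum_sum s s' (F := fun a b u => ∫⁻ v, F a b ((x, u), v) ∂μ) fun a b =>
    (m2 a b).comp measurable_prodMk_left]
  exact lintegral_congr fun u => lintegral_sum_sum s s' fun a b =>
    (hF a b).comp measurable_prodMk_left

namespace IsMaxStableLaw

variable {ι : Type*} [Fintype ι] {μ : Measure (ι → ℝ)} [IsProbabilityMeasure μ]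

lemma measurable_lintegral_hit_pair (I J : Set ι) :
    Measurable fun p : (ι → ℝ) × (ι → ℝ) => ∫⁻ x, hit I p.1 x * hit J p.2 x ∂μ +
      (∫⁻ x, hit I p.1 x ∂μ) * ∫⁻ x, hit J p.2 x ∂μ := by
  have h1 : ∀ (I : Set ι), Measurable fun q : ((ι → ℝ) × (ι → ℝ)) × (ι → ℝ) => hit I q.1.1 q.2 :=
    fun I => (measurable_hit I).comp
      ((measurable_fst.comp measurable_fst).prodMk measurable_snd)
  have h2 : ∀ (I : Set ι), Measurable fun q : ((ι → ℝ) × (ι → ℝ)) × (ι → ℝ) => hit I q.1.2 q.2 :=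
    fun I => (measurable_hit I).comp
      ((measurable_snd.comp measurable_fst).prodMk measurable_snd)
  exact (((h1 I).mul (h2 J)).lintegral_prod_right').add
    ((h1 I).lintegral_prod_right'.mul (h2 J).lintegral_prod_right')

lemma lintegral_hit_biUnion_le {μ : Measure (ι → ℝ)} {α γ : Type*} (s : Finset α) (s' : Finset γ)
    (I : α → Set ι)
    (J : γ → Set ι) (w w' : ι → ℝ) :
    ∫⁻ x, hit (⋃ a ∈ s, I a) w x * hit (⋃ b ∈ s', J b) w' x ∂μ +
      (∫⁻ x, hit (⋃ a ∈ s, I a) w x ∂μ) * ∫⁻ x, hit (⋃ b ∈ s', J b) w' x ∂μ ≤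
    ∑ a ∈ s, ∑ b ∈ s', (∫⁻ x, hit (I a) w x * hit (J b) w' x ∂μ +
      (∫⁻ x, hit (I a) w x ∂μ) * ∫⁻ x, hit (J b) w' x ∂μ) := by
  have m : ∀ (I : Set ι) (w : ι → ℝ), Measurable (hit I w) := fun I w =>
    (measurable_hit I).comp (measurable_const.prodMk measurable_id)
  simp_rw [Finset.sum_add_distrib]
  refine add_le_add ?_ ?_
  · refine (lintegral_mono fun x => mul_le_mul' (hit_biUnion_le s I w x)
      (hit_biUnion_le s' J w' x)).trans (le_of_eq ?_)
    simp_rw [Finset.sum_mul_sum]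
    exact lintegral_sum_sum s s' fun a b => (m (I a) w).mul (m (J b) w')
  · rw [← Finset.sum_mul_sum]
    refine mul_le_mul' ?_ ?_
    · rw [← lintegral_finsetSum _ fun a _ => m _ _]
      exact lintegral_mono fun x => hit_biUnion_le s I w x
    · rw [← lintegral_finsetSum _ fun a _ => m _ _]
      exact lintegral_mono fun x => hit_biUnion_le s' J w' x

variable {α γ : Type*} {s : Finset α} {s' : Finset γ} {I : α → Set ι} {J : γ → Set ι}
  {κ β : α → γ → ℝ≥0∞} {D : ℝ≥0∞}

lemma enorm_decoupled_sub_le_sum (h : IsMaxStableLaw μ) {f g : (ι → ℝ) → ℂ} (hf : Measurable f)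
    (hg : Measurable g) {cf cg : ℝ} (hcf : ∀ u, ‖f u‖ ≤ cf) (hcg : ∀ u, ‖g u‖ ≤ cg)
    (hfI : DependsOn f (⋃ a ∈ s, I a)) (hgJ : DependsOn g (⋃ b ∈ s', J b))
    (hκ : ∀ a ∈ s, ∀ b ∈ s', κ a b ≠ 0)
    (hΨ : ∀ a ∈ s, ∀ b ∈ s', ∀ r : ℝ, 0 < r →
      μ {x | (∃ i ∈ I a, r < x i) ∧ ∃ j ∈ J b, r < x j} +
        μ {x | ∃ i ∈ I a, r < x i} * μ {x | ∃ j ∈ J b, r < x j} ≤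
      κ a b * (ENNReal.ofReal r)⁻¹ + β a b * (ENNReal.ofReal r)⁻¹ ^ 2)
    (hI : ∀ a ∈ s, ∫⁻ u, recipMin (I a) u ∂μ ≤ D ∧ ∫⁻ u, recipMin (I a) u ^ 2 ∂μ ≤ D)
    (hJ : ∀ b ∈ s', ∫⁻ u, recipMin (J b) u ∂μ ≤ D ∧ ∫⁻ u, recipMin (J b) u ^ 2 ∂μ ≤ D)
    {k t : ℕ} (hkt : 0 < k + t) :
    ‖decoupled μ f g (k + 1) t - decoupled μ f g k (t + 1)‖ₑ ≤
      ENNReal.ofReal (2 * cf) * ENNReal.ofReal (2 * cg) * ∑ a ∈ s, ∑ b ∈ s',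
        (2 * D * κ a b * ((k + t : ℕ) : ℝ≥0∞)⁻¹ + 2 * D * β a b * ((k + t : ℕ) : ℝ≥0∞)⁻¹ ^ 2) := by
  refine (h.enorm_decoupled_sub_le hf hg hcf hcg hfI hgJ k t).trans ?_
  gcongr
  let Ψ : α → γ → (ι → ℝ) → (ι → ℝ) → ℝ≥0∞ := fun a b w w' =>
    ∫⁻ x, hit (I a) w x * hit (J b) w' x ∂μ +
      (∫⁻ x, hit (I a) w x ∂μ) * ∫⁻ x, hit (J b) w' x ∂μ
  have mw : Measurable fun p : ((ι → ℝ) × (ι → ℝ)) × (ι → ℝ) =>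
      ((k : ℝ) • p.1.1 ⊔ (t : ℝ) • p.1.2, (k : ℝ) • p.1.1 ⊔ (t : ℝ) • p.2) :=
    ((measurable_sup_smul k t).comp measurable_fst).prodMk ((measurable_sup_smul k t).comp
      ((measurable_fst.comp measurable_fst).prodMk measurable_snd))
  have m1 : ∀ a b, Measurable fun p : ((ι → ℝ) × (ι → ℝ)) × (ι → ℝ) =>
      Ψ a b ((k : ℝ) • p.1.1 ⊔ (t : ℝ) • p.1.2) ((k : ℝ) • p.1.1 ⊔ (t : ℝ) • p.2) := fun a b =>
    (measurable_lintegral_hit_pair (I a) (J b)).comp mw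
  calc _ ≤ ∫⁻ x, ∫⁻ u, ∫⁻ v, ∑ a ∈ s, ∑ b ∈ s',
        Ψ a b ((k : ℝ) • x ⊔ (t : ℝ) • u) ((k : ℝ) • x ⊔ (t : ℝ) • v) ∂μ ∂μ ∂μ :=
        lintegral_mono fun x => lintegral_mono fun u => lintegral_mono fun v =>
          lintegral_hit_biUnion_le s s' I J _ _
    _ = ∑ a ∈ s, ∑ b ∈ s', ∫⁻ x, ∫⁻ u, ∫⁻ v,
        Ψ a b ((k : ℝ) • x ⊔ (t : ℝ) • u) ((k : ℝ) • x ⊔ (t : ℝ) • v) ∂μ ∂μ ∂μ :=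
        lintegral_triple_sum_sum s s' m1
    _ ≤ _ := Finset.sum_le_sum fun a ha => Finset.sum_le_sum fun b hb =>
        h.lintegral_pair_le (hκ a ha b hb) (hΨ a ha b hb) (hI a ha).1 (hI a ha).2 (hJ b hb).1
          (hJ b hb).2 hkt

lemma decoupled_succ_zero (h : IsMaxStableLaw μ) (f g : (ι → ℝ) → ℂ) (n : ℕ) :
    decoupled μ f g n 0 = ∫ a, f ((n : ℝ) • a) * g ((n : ℝ) • a) ∂μ := by
  refine integral_congr_ae ?_
  filter_upwards [h.ae_pos] with a ha
  have : (n : ℝ) • a ⊔ 0 = (n : ℝ) • a := sup_eq_left.2 fun i => by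
    have := (ha i).le
    simp only [Pi.zero_apply, Pi.smul_apply, smul_eq_mul]
    positivity
  simp [smooth, this]

lemma decoupled_zero_succ (h : IsMaxStableLaw μ) (f g : (ι → ℝ) → ℂ) (n : ℕ) :
    decoupled μ f g 0 n = (∫ a, f ((n : ℝ) • a) ∂μ) * ∫ a, g ((n : ℝ) • a) ∂μ := by
  have e : ∀ f : (ι → ℝ) → ℂ, smooth μ n f 0 = ∫ a, f ((n : ℝ) • a) ∂μ := by
    intro f
    refine integral_congr_ae ?_
    filter_upwards [h.ae_pos] with a ha
    have : 0 ⊔ (n : ℝ) • a = (n : ℝ) • a := sup_eq_right.2 fun i => by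
      have := (ha i).le
      simp only [Pi.zero_apply, Pi.smul_apply, smul_eq_mul]
      positivity
    simp only [this]
  simp [decoupled, e]

/-- Covariance bound for max-stable laws: the correlation of bounded functions of two groups of
coordinates is controlled by the first-order joint exceedance rates of the groups. -/
theorem enorm_integral_mul_sub_le_sum (h : IsMaxStableLaw μ) {f g : (ι → ℝ) → ℂ}
    (hf : Measurable f) (hg : Measurable g) {cf cg : ℝ} (hcf : ∀ u, ‖f u‖ ≤ cf)
    (hcg : ∀ u, ‖g u‖ ≤ cg)
    (hfI : DependsOn f (⋃ a ∈ s, I a)) (hgJ : DependsOn g (⋃ b ∈ s', J b))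
    (hκ : ∀ a ∈ s, ∀ b ∈ s', κ a b ≠ 0) (hβ : ∀ a ∈ s, ∀ b ∈ s', β a b ≠ ∞) (hD : D ≠ ∞)
    (hΨ : ∀ a ∈ s, ∀ b ∈ s', ∀ r : ℝ, 0 < r →
      μ {x | (∃ i ∈ I a, r < x i) ∧ ∃ j ∈ J b, r < x j} +
        μ {x | ∃ i ∈ I a, r < x i} * μ {x | ∃ j ∈ J b, r < x j} ≤
      κ a b * (ENNReal.ofReal r)⁻¹ + β a b * (ENNReal.ofReal r)⁻¹ ^ 2)
    (hI : ∀ a ∈ s, ∫⁻ u, recipMin (I a) u ∂μ ≤ D ∧ ∫⁻ u, recipMin (I a) u ^ 2 ∂μ ≤ D)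
    (hJ : ∀ b ∈ s', ∫⁻ u, recipMin (J b) u ∂μ ≤ D ∧ ∫⁻ u, recipMin (J b) u ^ 2 ∂μ ≤ D) :
    ‖∫ x, f x * g x ∂μ - (∫ x, f x ∂μ) * ∫ x, g x ∂μ‖ₑ ≤
      ENNReal.ofReal (2 * cf) * ENNReal.ofReal (2 * cg) *
        (4 * D * ∑ a ∈ s, ∑ b ∈ s', κ a b) := by
  set C := ENNReal.ofReal (2 * cf) * ENNReal.ofReal (2 * cg) with hC
  have key : ∀ n : ℕ, 0 < n → ‖∫ x, f x * g x ∂μ - (∫ x, f x ∂μ) * ∫ x, g x ∂μ‖ₑ ≤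
      C * (4 * D * ∑ a ∈ s, ∑ b ∈ s', κ a b) +
        C * (4 * D * ∑ a ∈ s, ∑ b ∈ s', β a b) * (n : ℝ≥0∞)⁻¹ := by
    intro n hn
    have hn1 : ((n + 1 : ℕ) : ℝ) ≠ 0 := by positivity
    have msc : Measurable fun u : ι → ℝ => ((n + 1 : ℕ) : ℝ)⁻¹ • u := by fun_prop
    have dep : ∀ {f : (ι → ℝ) → ℂ} {S : Set ι}, DependsOn f S →
        DependsOn (fun u => f (((n + 1 : ℕ) : ℝ)⁻¹ • u)) S := fun hfS u v huv =>
      hfS fun i hi => by simp [huv i hi]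
    have step : ∀ t < n + 1, edist (decoupled μ (fun u => f (((n + 1 : ℕ) : ℝ)⁻¹ • u))
        (fun u => g (((n + 1 : ℕ) : ℝ)⁻¹ • u)) (n + 1 - t) t)
        (decoupled μ (fun u => f (((n + 1 : ℕ) : ℝ)⁻¹ • u))
        (fun u => g (((n + 1 : ℕ) : ℝ)⁻¹ • u)) (n + 1 - (t + 1)) (t + 1)) ≤
        C * ∑ a ∈ s, ∑ b ∈ s',
        (2 * D * κ a b * (n : ℝ≥0∞)⁻¹ + 2 * D * β a b * (n : ℝ≥0∞)⁻¹ ^ 2) := by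
      intro t ht
      obtain ⟨k, rfl⟩ : ∃ k, n = k + t := ⟨n - t, by omega⟩
      have := h.enorm_decoupled_sub_le_sum (hf.comp msc) (hg.comp msc) (fun u => hcf _)
        (fun u => hcg _) (dep hfI) (dep hgJ) hκ hΨ hI hJ hn
      rw [edist_eq_enorm_sub, show k + t + 1 - t = k + 1 by omega,
        show k + t + 1 - (t + 1) = k by omega]
      exact this
    have tel := edist_le_range_sum_edist (fun t => decoupled μ
      (fun u => f (((n + 1 : ℕ) : ℝ)⁻¹ • u))
        (fun u => g (((n + 1 : ℕ) : ℝ)⁻¹ • u)) (n + 1 - t) t) (n + 1)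
    have tel2 := tel.trans (Finset.sum_le_sum fun t ht => step t (Finset.mem_range.1 ht))
    rw [Finset.sum_const, Finset.card_range] at tel2
    simp only [tsub_zero, tsub_self] at tel2
    rw [h.decoupled_succ_zero, h.decoupled_zero_succ, edist_eq_enorm_sub] at tel2
    simp only [smul_smul, inv_mul_cancel₀ hn1, one_smul] at tel2
    refine tel2.trans ?_
    have hn0 : (n : ℝ≥0∞) ≠ 0 := by exact_mod_cast hn.ne'
    have hnt : (n : ℝ≥0∞) ≠ ∞ := ENNReal.natCast_ne_top n
    have hle : ((n + 1 : ℕ) : ℝ≥0∞) ≤ 2 * n := by exact_mod_cast (by omega : n + 1 ≤ 2 * n)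
    have hnn : (n : ℝ≥0∞) * (n : ℝ≥0∞)⁻¹ = 1 := ENNReal.mul_inv_cancel hn0 hnt
    calc (n + 1) • (C * ∑ a ∈ s, ∑ b ∈ s',
        (2 * D * κ a b * (n : ℝ≥0∞)⁻¹ + 2 * D * β a b * (n : ℝ≥0∞)⁻¹ ^ 2))
        = ((n + 1 : ℕ) : ℝ≥0∞) * (C * ∑ a ∈ s, ∑ b ∈ s',
        (2 * D * κ a b * (n : ℝ≥0∞)⁻¹ + 2 * D * β a b * (n : ℝ≥0∞)⁻¹ ^ 2)) := by
          rw [nsmul_eq_mul]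
      _ ≤ 2 * n * (C * ∑ a ∈ s, ∑ b ∈ s',
        (2 * D * κ a b * (n : ℝ≥0∞)⁻¹ + 2 * D * β a b * (n : ℝ≥0∞)⁻¹ ^ 2)) := by gcongr
      _ = C * (4 * D * ((∑ a ∈ s, ∑ b ∈ s', κ a b) * (n * (n : ℝ≥0∞)⁻¹))) +
          C * (4 * D * ((∑ a ∈ s, ∑ b ∈ s', β a b) * (n * (n : ℝ≥0∞)⁻¹))) * (n : ℝ≥0∞)⁻¹ := by
          simp only [Finset.sum_add_distrib, ← Finset.sum_mul, ← Finset.mul_sum]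
          ring
      _ = _ := by rw [hnn, mul_one, mul_one]
  have hB : C * (4 * D * ∑ a ∈ s, ∑ b ∈ s', β a b) ≠ ∞ := by
    refine ENNReal.mul_ne_top (ENNReal.mul_ne_top ENNReal.ofReal_ne_top ENNReal.ofReal_ne_top)
      (ENNReal.mul_ne_top (ENNReal.mul_ne_top (by simp) hD) ?_)
    exact ENNReal.sum_ne_top.2 fun a ha => ENNReal.sum_ne_top.2 fun b hb => hβ a ha b hb
  have lim : Tendsto (fun n : ℕ => C * (4 * D * ∑ a ∈ s, ∑ b ∈ s', κ a b) +
        C * (4 * D * ∑ a ∈ s, ∑ b ∈ s', β a b) * (n : ℝ≥0∞)⁻¹) atTop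
      (𝓝 (C * (4 * D * ∑ a ∈ s, ∑ b ∈ s', κ a b) + C * (4 * D * ∑ a ∈ s, ∑ b ∈ s', β a b) * 0)) :=
    tendsto_const_nhds.add (ENNReal.Tendsto.const_mul ENNReal.tendsto_inv_nat_nhds_zero (Or.inr hB))
  rw [mul_zero, add_zero] at lim
  exact ge_of_tendsto lim ((eventually_gt_atTop 0).mono key)

end IsMaxStableLaw

lemma ennreal_sq_le_tsum (y : ℝ≥0∞) :
    y ^ 2 ≤ ∑' T : ℕ, (2 * (T : ℝ≥0∞) + 1) * Set.indicator {z : ℝ≥0∞ | (T : ℝ≥0∞) < z} 1 y := by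
  have key : ∀ M : ℕ, (∀ T < M, (T : ℝ≥0∞) < y) →
      (M : ℝ≥0∞) ^ 2 ≤
        ∑' T : ℕ, (2 * (T : ℝ≥0∞) + 1) * Set.indicator {z : ℝ≥0∞ | (T : ℝ≥0∞) < z} 1 y := by
    intro M hM
    refine le_trans (le_of_eq ?_) (ENNReal.sum_le_tsum (Finset.range M))
    have e : ∀ T ∈ Finset.range M, (2 * (T : ℝ≥0∞) + 1) *
        Set.indicator {z : ℝ≥0∞ | (T : ℝ≥0∞) < z} 1 y = ((2 * T + 1 : ℕ) : ℝ≥0∞) := by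
      intro T hT
      rw [Set.indicator_of_mem (show y ∈ {z : ℝ≥0∞ | (T : ℝ≥0∞) < z} from
        hM T (Finset.mem_range.1 hT))]
      simp
    rw [Finset.sum_congr rfl e, ← Nat.cast_sum]
    have : ∑ T ∈ Finset.range M, (2 * T + 1) = M ^ 2 := by
      clear hM e
      induction M with
      | zero => simp
      | succ n ih => rw [Finset.sum_range_succ, ih]; ring
    rw [this]
    push_cast
    rfl
  by_cases hy : y = ∞
  · subst hy
    refine le_of_eq_of_le (by simp) (ENNReal.iSup_natCast.symm.le.trans (iSup_le fun n => ?_))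
    refine le_trans ?_ (key n fun T _ => ENNReal.natCast_lt_top T)
    exact_mod_cast Nat.le_self_pow two_ne_zero n
  · lift y to ℝ≥0 using hy
    calc (y : ℝ≥0∞) ^ 2 ≤ ((⌈y⌉₊ : ℕ) : ℝ≥0∞) ^ 2 := by
          gcongr
          exact_mod_cast Nat.le_ceil y
      _ ≤ _ := key _ fun T hT => by exact_mod_cast Nat.lt_ceil.1 hT

namespace IsMaxStableLaw

variable {ι : Type*} [Fintype ι] {μ : Measure (ι → ℝ)} [IsProbabilityMeasure μ]

lemma measurableSet_exists_lt (I : Set ι) (a : ℝ) :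
    MeasurableSet {u : ι → ℝ | ∃ i ∈ I, u i < a} := by
  have : {u : ι → ℝ | ∃ i ∈ I, u i < a} = ⋃ i ∈ I, {u : ι → ℝ | u i < a} := by ext p; simp
  rw [this]
  exact MeasurableSet.biUnion I.to_countable fun i _ =>
    measurableSet_lt (by fun_prop) (by fun_prop)

lemma measure_exists_natCast_mul_lt (h : IsMaxStableLaw μ) (I : Set ι) (a : ℝ) (k : ℕ) :
    μ {u | ∃ i ∈ I, (k : ℝ) * u i < a} ≤ μ {u | ∃ i ∈ I, u i < a} ^ k := by
  have hm := measurableSet_exists_lt I a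
  let Φ : (ι → ℝ) → ℝ≥0∞ := Set.indicator {u | ∃ i ∈ I, u i < a} 1
  have hΦ : Measurable Φ := measurable_one.indicator hm
  have e : ∀ k : ℕ, ∫⁻ u, Φ ((k : ℝ) • u) ∂μ = μ {u | ∃ i ∈ I, (k : ℝ) * u i < a} := by
    intro k
    have hk : Measurable fun u : ι → ℝ => (k : ℝ) • u := by fun_prop
    rw [← lintegral_map hΦ hk, lintegral_indicator_one hm, Measure.map_apply hk hm]
    rfl
  induction k with
  | zero => simpa using prob_le_one
  | succ k ih =>
    rw [← e, ← h.lintegral_sup_eq (k := k) (l := 1) (by omega) hΦ]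
    calc ∫⁻ u, ∫⁻ v, Φ ((k : ℝ) • u ⊔ ((1 : ℕ) : ℝ) • v) ∂μ ∂μ
        ≤ ∫⁻ u, ∫⁻ v, Φ ((k : ℝ) • u) * Φ v ∂μ ∂μ := by
          refine lintegral_mono fun u => lintegral_mono fun v => ?_
          by_cases hw : ∃ i ∈ I, ((k : ℝ) • u ⊔ ((1 : ℕ) : ℝ) • v) i < a
          · obtain ⟨i, hi, hlt⟩ := hw
            simp only [Pi.sup_apply, sup_lt_iff, Pi.smul_apply, Nat.cast_one, one_smul] at hlt
            have h1 : Φ ((k : ℝ) • u) = 1 := Set.indicator_of_mem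
              (show (k : ℝ) • u ∈ {u | ∃ i ∈ I, u i < a} from ⟨i, hi, hlt.1⟩) 1
            have h2 : Φ v = 1 := Set.indicator_of_mem
              (show v ∈ {u | ∃ i ∈ I, u i < a} from ⟨i, hi, hlt.2⟩) 1
            rw [h1, h2, mul_one]
            exact Set.indicator_le_self' (by simp) _
          · have : Φ ((k : ℝ) • u ⊔ ((1 : ℕ) : ℝ) • v) = 0 := Set.indicator_of_notMem hw 1
            rw [this]
            exact bot_le
      _ = (∫⁻ u, Φ ((k : ℝ) • u) ∂μ) * ∫⁻ v, Φ v ∂μ := by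
          simp_rw [lintegral_const_mul _ hΦ]
          exact lintegral_mul_const _ (hΦ.comp (by fun_prop))
      _ ≤ _ := by
          rw [e, lintegral_indicator_one hm, pow_succ]
          gcongr

/-- Second moment of the reciprocal minimum, given a finite cover of the index set by groups whose
minima are rarely small. -/
lemma lintegral_recipMin_sq_le (h : IsMaxStableLaw μ) {α : Type*} (t : Finset α) (J : α → Set ι)
    (I : Set ι) (hI : I ⊆ ⋃ a ∈ t, J a) {a : ℝ} (ha : 0 < a) {p : ℝ≥0∞}
    (hp : ∀ b ∈ t, μ {u | ∃ i ∈ J b, u i < a} ≤ p) :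
    ∫⁻ u, recipMin I u ^ 2 ∂μ ≤
      (ENNReal.ofReal a)⁻¹ ^ 2 * (t.card * ∑' T : ℕ, (2 * (T : ℝ≥0∞) + 1) * p ^ T) := by
  have ha0 : ENNReal.ofReal a ≠ 0 := by simpa using ha
  have hat : ENNReal.ofReal a ≠ ∞ := ENNReal.ofReal_ne_top
  have m := measurable_recipMin I
  have hset : ∀ T : ℕ, μ {u | (T : ℝ≥0∞) < ENNReal.ofReal a * recipMin I u} ≤ t.card * p ^ T := by
    intro T
    calc μ {u | (T : ℝ≥0∞) < ENNReal.ofReal a * recipMin I u}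
        ≤ μ (⋃ b ∈ t, {u | ∃ i ∈ J b, (T : ℝ) * u i < a}) := by
          refine measure_mono fun u hu => ?_
          simp only [Set.mem_ofPred_eq, recipMin, ENNReal.mul_iSup, lt_iSup_iff] at hu
          obtain ⟨i, hi, hlt⟩ := hu
          obtain ⟨b, hb, hib⟩ := Set.mem_iUnion₂.1 (hI hi)
          refine Set.mem_iUnion₂.2 ⟨b, hb, i, hib, ?_⟩
          rcases le_or_gt (u i) 0 with h0 | h0
          · exact (mul_nonpos_of_nonneg_of_nonpos (by positivity) h0).trans_lt ha
          · rw [← div_eq_mul_inv, ← ENNReal.ofReal_div_of_pos h0, ← ENNReal.ofReal_natCast,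
              ENNReal.ofReal_lt_ofReal_iff (by positivity), lt_div_iff₀ h0] at hlt
            exact hlt
      _ ≤ ∑ b ∈ t, μ {u | ∃ i ∈ J b, (T : ℝ) * u i < a} := measure_biUnion_finset_le _ _
      _ ≤ ∑ b ∈ t, p ^ T := Finset.sum_le_sum fun b hb =>
          (h.measure_exists_natCast_mul_lt _ _ _).trans (pow_le_pow_left' (hp b hb) T)
      _ = _ := by rw [Finset.sum_const, nsmul_eq_mul]
  have e : ∀ u, recipMin I u ^ 2 =
      (ENNReal.ofReal a)⁻¹ ^ 2 * (ENNReal.ofReal a * recipMin I u) ^ 2 := by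
    intro u
    rw [mul_pow, ← mul_assoc, ← mul_pow, ENNReal.inv_mul_cancel ha0 hat, one_pow, one_mul]
  simp_rw [e]
  rw [lintegral_const_mul _ (by fun_prop)]
  gcongr
  have ms : ∀ T : ℕ, MeasurableSet {u | (T : ℝ≥0∞) < ENNReal.ofReal a * recipMin I u} := fun T =>
    measurableSet_lt measurable_const (m.const_mul _)
  calc ∫⁻ u, (ENNReal.ofReal a * recipMin I u) ^ 2 ∂μ
      ≤ ∫⁻ u, ∑' T : ℕ, (2 * (T : ℝ≥0∞) + 1) *
          Set.indicator {u | (T : ℝ≥0∞) < ENNReal.ofReal a * recipMin I u} 1 u ∂μ :=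
        lintegral_mono fun u => ennreal_sq_le_tsum _
    _ = ∑' T : ℕ, (2 * (T : ℝ≥0∞) + 1) * μ {u | (T : ℝ≥0∞) < ENNReal.ofReal a * recipMin I u} := by
        rw [lintegral_tsum fun T => ((measurable_one.indicator (ms T)).const_mul _).aemeasurable]
        refine tsum_congr fun T => ?_
        rw [lintegral_const_mul _ (measurable_one.indicator (ms T)), lintegral_indicator_one (ms T)]
    _ ≤ ∑' T : ℕ, (2 * (T : ℝ≥0∞) + 1) * (t.card * p ^ T) := ENNReal.tsum_le_tsum fun T => by
        gcongr; exact hset T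
    _ = _ := by
        rw [← ENNReal.tsum_mul_left]
        exact tsum_congr fun T => by ring

end IsMaxStableLaw

lemma lintegral_recipMin_le {ι : Type*} [Countable ι] {μ : Measure (ι → ℝ)} [IsProbabilityMeasure μ]
    (I : Set ι) {D : ℝ≥0∞} (hD : ∫⁻ u, recipMin I u ^ 2 ∂μ ≤ D) :
    ∫⁻ u, recipMin I u ∂μ ≤ 1 + D := by
  calc ∫⁻ u, recipMin I u ∂μ ≤ ∫⁻ u, (1 + recipMin I u ^ 2) ∂μ := by
        refine lintegral_mono fun u => ?_
        rcases le_total (recipMin I u) 1 with h1 | h1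
        · exact h1.trans le_self_add
        · exact (le_self_pow₀ h1 two_ne_zero).trans le_add_self
    _ = 1 + ∫⁻ u, recipMin I u ^ 2 ∂μ := by
        rw [lintegral_add_left measurable_const, lintegral_const, measure_univ, mul_one]
    _ ≤ _ := by gcongr

/-- A simple, stationary, sample-continuous and jointly measurable max-stable field. -/
structure IsStationaryMaxStable {d : ℕ} {Ω : Type*} [MeasurableSpace Ω] (P : Measure Ω)
    (Z : EuclideanSpace ℝ (Fin d) → Ω → ℝ) : Prop where
  meas : Measurable fun p : EuclideanSpace ℝ (Fin d) × Ω => Z p.1 p.2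
  cont : ∀ᵐ ω ∂P, Continuous fun x => Z x ω
  frechet : ∀ x, ∀ z : ℝ, 0 < z → P {ω | Z x ω ≤ z} = ENNReal.ofReal (Real.exp (-1 / z))
  maxStable : ∀ T : ℕ, 1 ≤ T → ∀ (n : ℕ) (x : Fin n → EuclideanSpace ℝ (Fin d))
    (z : Fin n → ℝ), (∀ i, 0 < z i) →
    (P {ω | ∀ i, Z (x i) ω ≤ (T : ℝ) * z i}) ^ T = P {ω | ∀ i, Z (x i) ω ≤ z i}
  stat : ∀ (x₀ : EuclideanSpace ℝ (Fin d)) (n : ℕ) (x : Fin n → EuclideanSpace ℝ (Fin d)),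
    Measure.map (fun ω i => Z (x i + x₀) ω) P = Measure.map (fun ω i => Z (x i) ω) P

lemma isCompact_cube {d : ℕ} (h : Fin d → ℤ) : IsCompact (cube h) := by
  have : cube h = (EuclideanSpace.equiv (Fin d) ℝ).symm ''
      Set.Icc (fun i => (h i : ℝ)) (fun i => (h i : ℝ) + 1) := by
    ext x
    simp only [Set.mem_image, cube, Set.mem_ofPred_eq]
    constructor
    · exact fun hx => ⟨EuclideanSpace.equiv (Fin d) ℝ x, ⟨fun i => (hx i).1, fun i => (hx i).2⟩,
        by simp⟩
    · rintro ⟨y, ⟨hy1, hy2⟩, rfl⟩ i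
      exact ⟨hy1 i, hy2 i⟩
  rw [this]
  exact isCompact_Icc.image (EuclideanSpace.equiv (Fin d) ℝ).symm.continuous

@[simp] lemma toE_apply {d : ℕ} (h : Fin d → ℤ) (i : Fin d) : toE h i = h i := rfl

lemma sub_toE_mem_cube {d : ℕ} {a b : Fin d → ℤ} {x : EuclideanSpace ℝ (Fin d)} (hx : x ∈ cube b) :
    x - toE a ∈ cube (b - a) := by
  intro i
  have := hx i
  simp only [PiLp.sub_apply, toE_apply, Pi.sub_apply, Int.cast_sub]
  constructor <;> linarith

namespace IsStationaryMaxStable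

variable {d : ℕ} {Ω : Type*} [MeasurableSpace Ω] {P : Measure Ω}
  {Z : EuclideanSpace ℝ (Fin d) → Ω → ℝ}

lemma measurable_apply (h : IsStationaryMaxStable P Z) (x : EuclideanSpace ℝ (Fin d)) :
    Measurable (Z x) :=
  h.meas.comp measurable_prodMk_left

lemma measurable_family {ι : Type*} (h : IsStationaryMaxStable P Z)
    (x : ι → EuclideanSpace ℝ (Fin d)) : Measurable fun ω i => Z (x i) ω :=
  measurable_pi_lambda _ fun i => h.measurable_apply (x i)

lemma measure_nonpos (h : IsStationaryMaxStable P Z) (x : EuclideanSpace ℝ (Fin d)) :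
    P {ω | Z x ω ≤ 0} = 0 := by
  have h1 : ∀ n : ℕ, P {ω | Z x ω ≤ 0} ≤ ENNReal.ofReal (Real.exp (-((n : ℝ) + 1))) := by
    intro n
    have := h.frechet x ((n : ℝ) + 1)⁻¹ (by positivity)
    rw [div_inv_eq_mul, neg_one_mul] at this
    rw [← this]
    refine measure_mono fun ω hω => ?_
    have hω : Z x ω ≤ 0 := hω
    exact hω.trans (by positivity)
  have h2 : Tendsto (fun n : ℕ => ENNReal.ofReal (Real.exp (-((n : ℝ) + 1)))) atTop (𝓝 0) := by
    rw [← ENNReal.ofReal_zero]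
    refine ENNReal.tendsto_ofReal (Real.tendsto_exp_neg_atTop_nhds_zero.comp ?_)
    exact tendsto_atTop_add_const_right _ _ tendsto_natCast_atTop_atTop
  exact le_antisymm (ge_of_tendsto' h2 h1) bot_le

lemma map_shift {ι : Type*} [Fintype ι] (h : IsStationaryMaxStable P Z)
    (x₀ : EuclideanSpace ℝ (Fin d)) (x : ι → EuclideanSpace ℝ (Fin d)) :
    P.map (fun ω i => Z (x i + x₀) ω) = P.map (fun ω i => Z (x i) ω) := by
  let e := Fintype.equivFin ι
  have := h.stat x₀ _ (fun j => x (e.symm j))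
  have hm : Measurable fun (u : Fin (Fintype.card ι) → ℝ) (i : ι) => u (e i) :=
    measurable_pi_lambda _ fun i => measurable_pi_apply _
  have := congrArg (Measure.map fun (u : Fin (Fintype.card ι) → ℝ) (i : ι) => u (e i)) this
  rw [Measure.map_map hm (h.measurable_family _), Measure.map_map hm (h.measurable_family _)]
    at this
  simpa [Function.comp_def] using this

lemma isMaxStableLaw {ι : Type*} [Fintype ι] (h : IsStationaryMaxStable P Z)
    (x : ι → EuclideanSpace ℝ (Fin d)) : IsMaxStableLaw (P.map fun ω i => Z (x i) ω) where
  pow_Iic T hT z hz := by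
    let e := Fintype.equivFin ι
    rw [Measure.map_apply (h.measurable_family x) measurableSet_Iic,
      Measure.map_apply (h.measurable_family x) measurableSet_Iic]
    have := h.maxStable T hT _ (fun j => x (e.symm j)) (fun j => z (e.symm j)) fun j => hz _
    have e1 : ∀ w : ι → ℝ, (fun ω i => Z (x i) ω) ⁻¹' Set.Iic w =
        {ω | ∀ j, Z (x (e.symm j)) ω ≤ w (e.symm j)} := by
      intro w
      ext ω
      simp only [Set.mem_preimage, Set.mem_Iic, Pi.le_def, Set.mem_ofPred_eq]
      exact e.symm.forall_congr_left.trans (by simp) |>.symm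
    rw [e1, e1]
    exact this
  nonpos_null i := by
    rw [Measure.map_apply (h.measurable_family x)
      (measurableSet_le (measurable_pi_apply i) measurable_const)]
    exact h.measure_nonpos (x i)

lemma exists_small_ball [IsProbabilityMeasure P] (h : IsStationaryMaxStable P Z) :
    ∃ r : ℝ, 0 < r ∧ 2⁻¹ < P {ω | ∀ x ∈ Metric.ball (0 : EuclideanSpace ℝ (Fin d)) r,
      r ≤ Z x ω} := by
  let A : ℕ → Set Ω := fun n => {ω | ∀ x ∈ Metric.ball (0 : EuclideanSpace ℝ (Fin d))
    (1 / ((n : ℝ) + 1)), 1 / ((n : ℝ) + 1) ≤ Z x ω}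
  have hA : Monotone A := by
    intro m n hmn ω hω x hx
    have : 1 / ((n : ℝ) + 1) ≤ 1 / ((m : ℝ) + 1) := Nat.one_div_le_one_div hmn
    exact this.trans (hω x (Metric.ball_subset_ball this hx))
  have hlim := tendsto_measure_iUnion_atTop (μ := P) hA
  have hU : P (⋃ n, A n) = 1 := by
    have h0 : ∀ᵐ ω ∂P, 0 < Z 0 ω := by
      rw [ae_iff]
      simpa using h.measure_nonpos 0
    rw [← measure_univ (μ := P)]
    refine measure_congr ?_
    filter_upwards [h.cont, h0] with ω hc hp
    refine eq_true (?_ : ω ∈ ⋃ n, A n) |>.trans (eq_true (Set.mem_univ ω)).symm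
    have hev : ∀ᶠ x in 𝓝 (0 : EuclideanSpace ℝ (Fin d)), Z 0 ω / 2 < Z x ω :=
      hc.continuousAt.eventually (lt_mem_nhds (half_lt_self hp))
    obtain ⟨ε, hε, hball⟩ := Metric.eventually_nhds_iff_ball.1 hev
    obtain ⟨n, hn⟩ := exists_nat_one_div_lt (lt_min hε (half_pos hp))
    refine Set.mem_iUnion.2 ⟨n, fun x hx => ?_⟩
    have h1 := hball x (Metric.ball_subset_ball (hn.le.trans (min_le_left _ _)) hx)
    exact (hn.le.trans (min_le_right _ _)).trans h1.le
  rw [hU] at hlim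
  have h2 : (2⁻¹ : ℝ≥0∞) < 1 := by simp
  obtain ⟨n, hn⟩ := (hlim.eventually (lt_mem_nhds h2)).exists
  exact ⟨1 / ((n : ℝ) + 1), by positivity, hn⟩

lemma exists_lintegral_recipMin_le [IsProbabilityMeasure P] (h : IsStationaryMaxStable P Z) :
    ∃ D : ℝ≥0∞, D ≠ ∞ ∧ ∀ {ι : Type} [Fintype ι] (x : ι → EuclideanSpace ℝ (Fin d))
      (a : Fin d → ℤ) (I : Set ι), (∀ i ∈ I, x i ∈ cube a) →
      ∫⁻ u, recipMin I u ∂(P.map fun ω i => Z (x i) ω) ≤ D ∧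
      ∫⁻ u, recipMin I u ^ 2 ∂(P.map fun ω i => Z (x i) ω) ≤ D := by
  obtain ⟨r, hr, hball⟩ := h.exists_small_ball
  obtain ⟨t, -, htf, hcov⟩ := (isCompact_cube (0 : Fin d → ℤ)).finite_cover_balls hr
  set D₀ : ℝ≥0∞ := (ENNReal.ofReal r)⁻¹ ^ 2 *
    (htf.toFinset.card * ∑' T : ℕ, (2 * (T : ℝ≥0∞) + 1) * 2⁻¹ ^ T) with hD₀
  have hD₀t : D₀ ≠ ∞ := by
    refine ENNReal.mul_ne_top (ENNReal.pow_ne_top (by simpa using hr))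
      (ENNReal.mul_ne_top (by simp) ?_)
    have hs : Summable fun T : ℕ => (2 * (T : ℝ≥0) + 1) * 2⁻¹ ^ T := by
      rw [← NNReal.summable_coe]
      push_cast
      have h1 := summable_pow_mul_geometric_of_norm_lt_one 1 (r := (2⁻¹ : ℝ)) (by norm_num)
      have h2 := summable_geometric_of_lt_one (r := (2⁻¹ : ℝ)) (by norm_num) (by norm_num)
      refine ((h1.mul_left 2).add h2).congr fun T => ?_
      ring
    have := ENNReal.tsum_coe_ne_top_iff_summable.2 hs
    convert this using 3 with T
    rw [ENNReal.coe_mul, ENNReal.coe_pow, ENNReal.coe_inv two_ne_zero]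
    push_cast
    rfl
  refine ⟨1 + D₀, by simp [hD₀t], fun {ι} _ x a I hI => ?_⟩
  have := Measure.isProbabilityMeasure_map (μ := P) (h.measurable_family x).aemeasurable
  have key : ∫⁻ u, recipMin I u ^ 2 ∂(P.map fun ω i => Z (x i) ω) ≤ D₀ := by
    refine (h.isMaxStableLaw x).lintegral_recipMin_sq_le htf.toFinset
      (fun c => {i | x i - toE a ∈ Metric.ball c r}) I ?_ hr fun c _ => ?_
    · intro i hi
      have := hcov (by simpa using sub_toE_mem_cube (a := a) (hI i hi))
      obtain ⟨c, hc, hic⟩ := Set.mem_iUnion₂.1 this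
      exact Set.mem_iUnion₂.2 ⟨c, htf.mem_toFinset.2 hc, hic⟩
    · have hms := IsMaxStableLaw.measurableSet_exists_lt {i | x i - toE a ∈ Metric.ball c r} r
      have hsh := h.map_shift (toE a + c) (fun i => x i - (toE a + c))
      simp only [sub_add_cancel] at hsh
      rw [hsh, Measure.map_apply (h.measurable_family _) hms,
        ← compl_compl ((fun ω i => Z (x i - (toE a + c)) ω) ⁻¹' _),
        prob_compl_eq_one_sub ((h.measurable_family _) hms).compl]
      have : (2⁻¹ : ℝ≥0∞) ≤ P (((fun ω i => Z (x i - (toE a + c)) ω) ⁻¹'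
          {u | ∃ i ∈ {i | x i - toE a ∈ Metric.ball c r}, u i < r})ᶜ) := by
        refine hball.le.trans (measure_mono fun ω hω => ?_)
        simp only [Set.mem_compl_iff, Set.mem_preimage, Set.mem_ofPred_eq, not_exists, not_and,
          not_lt]
        intro i hi
        refine hω _ ?_
        rw [mem_ball_iff_norm] at hi
        rw [mem_ball_zero_iff, ← sub_sub]
        exact hi
      refine (tsub_le_tsub_left this 1).trans (le_of_eq ?_)
      exact ENNReal.one_sub_inv_two
  exact ⟨lintegral_recipMin_le I key, key.trans le_add_self⟩

end IsStationaryMaxStable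

lemma one_sub_exp_sub_exp_add_exp_le {a b c κ s : ℝ} (ha : 0 ≤ a) (hb : 0 ≤ b)
    (hc : 0 ≤ c) (hκ : 0 ≤ κ) (habc : a + b - c ≤ κ) (hs : 0 ≤ s) :
    1 - Real.exp (-(a * s)) - Real.exp (-(b * s)) + Real.exp (-(c * s)) ≤
      κ * s + a * b * s ^ 2 := by
  have h1 : (1 - Real.exp (-(a * s))) * (1 - Real.exp (-(b * s))) ≤ (a * s) * (b * s) := by
    have e1 := Real.add_one_le_exp (-(a * s))
    have e2 := Real.add_one_le_exp (-(b * s))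
    have e3 : Real.exp (-(b * s)) ≤ 1 := Real.exp_le_one_iff.2 (by nlinarith [mul_nonneg hb hs])
    exact mul_le_mul (by linarith) (by linarith) (by linarith) (mul_nonneg ha hs)
  have h2 : Real.exp (-(c * s)) - Real.exp (-(a * s)) * Real.exp (-(b * s)) ≤ κ * s := by
    rw [← Real.exp_add]
    have e0 := Real.add_one_le_exp (-(a * s) + -(b * s) - -(c * s))
    have e1 : Real.exp (-(c * s)) ≤ 1 := Real.exp_le_one_iff.2 (by nlinarith [mul_nonneg hc hs])
    have e2 : Real.exp (-(a * s) + -(b * s)) =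
        Real.exp (-(c * s)) * Real.exp (-(a * s) + -(b * s) - -(c * s)) := by
      rw [← Real.exp_add]; ring_nf
    have e3 := Real.exp_pos (-(c * s))
    have e4 : (a + b - c) * s ≤ κ * s := mul_le_mul_of_nonneg_right habc hs
    have e5 := mul_nonneg hκ hs
    rw [e2]
    nlinarith [mul_le_mul_of_nonneg_left e0 e3.le, mul_nonneg e3.le e5]
  nlinarith

namespace IsStationaryMaxStable

variable {d : ℕ} {Ω : Type*} [MeasurableSpace Ω] {P : Measure Ω}
  {Z : EuclideanSpace ℝ (Fin d) → Ω → ℝ}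

lemma exists_seq_ae_eq (h : IsStationaryMaxStable P Z) {S : Set (EuclideanSpace ℝ (Fin d))}
    (hS : S.Nonempty) : ∃ s : ℕ → EuclideanSpace ℝ (Fin d), (∀ n, s n ∈ S) ∧
      ∀ r : ℝ, {ω | ∀ x ∈ S, Z x ω ≤ r} =ᵐ[P] {ω | ∀ n, Z (s n) ω ≤ r} := by
  have : Nonempty S := hS.to_subtype
  refine ⟨fun n => TopologicalSpace.denseSeq S n, fun n => Subtype.coe_prop _, fun r => ?_⟩
  filter_upwards [h.cont] with ω hω
  refine propext ⟨fun hx n => hx _ (Subtype.coe_prop _), fun hn x hx => ?_⟩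
  have hcl : IsClosed {y : S | Z y ω ≤ r} :=
    isClosed_le (hω.comp continuous_subtype_val) continuous_const
  have hd := TopologicalSpace.denseRange_denseSeq S
  have hsub : Set.range (TopologicalSpace.denseSeq S) ⊆ {y : S | Z y ω ≤ r} := by
    rintro _ ⟨n, rfl⟩; exact hn n
  have := (hcl.closure_subset_iff.2 hsub) (hd ⟨x, hx⟩)
  exact this

lemma nullMeasurableSet_forall_le (h : IsStationaryMaxStable P Z)
    (S : Set (EuclideanSpace ℝ (Fin d))) (r : ℝ) :
    NullMeasurableSet {ω | ∀ x ∈ S, Z x ω ≤ r} P := by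
  rcases S.eq_empty_or_nonempty with rfl | hS
  · simp
  obtain ⟨s, -, hs⟩ := h.exists_seq_ae_eq hS
  refine NullMeasurableSet.congr (MeasurableSet.nullMeasurableSet ?_) (hs r).symm
  have : {ω | ∀ n, Z (s n) ω ≤ r} = ⋂ n, {ω | Z (s n) ω ≤ r} := by ext; simp
  rw [this]
  exact MeasurableSet.iInter fun n => measurableSet_le (h.measurable_apply _) measurable_const

lemma measure_forall_le_pow [IsProbabilityMeasure P] (h : IsStationaryMaxStable P Z)
    (S : Set (EuclideanSpace ℝ (Fin d))) {T : ℕ} (hT : 1 ≤ T) :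
    P {ω | ∀ x ∈ S, Z x ω ≤ T} ^ T = P {ω | ∀ x ∈ S, Z x ω ≤ 1} := by
  rcases S.eq_empty_or_nonempty with rfl | hS
  · simp
  obtain ⟨s, -, hs⟩ := h.exists_seq_ae_eq hS
  rw [measure_congr (hs T), measure_congr (hs 1)]
  have lim : ∀ r : ℝ, Tendsto (fun N : ℕ => P {ω | ∀ i : Fin N, Z (s i) ω ≤ r}) atTop
      (𝓝 (P {ω | ∀ n, Z (s n) ω ≤ r})) := by
    intro r
    have e : {ω | ∀ n, Z (s n) ω ≤ r} = ⋂ N : ℕ, {ω | ∀ i : Fin N, Z (s i) ω ≤ r} := by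
      ext ω
      simp only [Set.mem_ofPred_eq, Set.mem_iInter]
      exact ⟨fun hn N i => hn i, fun hN n => hN (n + 1) ⟨n, n.lt_succ_self⟩⟩
    rw [e]
    refine tendsto_measure_iInter_atTop (fun N => MeasurableSet.nullMeasurableSet ?_)
      (fun M N hMN ω hω i => hω ⟨i, i.2.trans_le hMN⟩) ⟨0, measure_ne_top _ _⟩
    have : {ω | ∀ i : Fin N, Z (s i) ω ≤ r} = ⋂ i : Fin N, {ω | Z (s i) ω ≤ r} := by ext; simp
    rw [this]
    exact MeasurableSet.iInter fun n => measurableSet_le (h.measurable_apply _) measurable_const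
  have h1 := ENNReal.Tendsto.pow (n := T) (lim T)
  have h2 : ∀ N : ℕ, P {ω | ∀ i : Fin N, Z (s i) ω ≤ (T : ℝ)} ^ T =
      P {ω | ∀ i : Fin N, Z (s i) ω ≤ 1} := by
    intro N
    have := h.maxStable T hT N (fun i => s i) (fun _ => 1) fun _ => one_pos
    simpa using this
  simp_rw [h2] at h1
  exact tendsto_nhds_unique h1 (lim 1)

lemma measureReal_forall_le [IsProbabilityMeasure P] (h : IsStationaryMaxStable P Z)
    {S : Set (EuclideanSpace ℝ (Fin d))} (hS : IsCompact S) {T : ℕ} (hT : 1 ≤ T) :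
    P.real {ω | ∀ x ∈ S, Z x ω ≤ T} = Real.exp (-(extremalCoeff P Z S * (T : ℝ)⁻¹)) := by
  have hpow : P.real {ω | ∀ x ∈ S, Z x ω ≤ T} ^ T = P.real {ω | ∀ x ∈ S, Z x ω ≤ 1} := by
    rw [measureReal_def, measureReal_def, ← ENNReal.toReal_pow, h.measure_forall_le_pow S hT]
  have hne : P {ω | ∀ x ∈ S, Z x ω ≤ 1} ≠ 0 := by
    intro h0
    have hz : ∀ n : ℕ, P {ω | ∀ x ∈ S, Z x ω ≤ ((n + 1 : ℕ) : ℝ)} = 0 := fun n =>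
      pow_eq_zero_iff (n.succ_ne_zero) |>.1 ((h.measure_forall_le_pow S (by omega)).trans h0)
    have hu := measure_iUnion_null hz
    have hfull : ∀ᵐ ω ∂P, ω ∈ ⋃ n : ℕ, {ω | ∀ x ∈ S, Z x ω ≤ ((n + 1 : ℕ) : ℝ)} := by
      filter_upwards [h.cont] with ω hω
      obtain ⟨M, hM⟩ := (hS.bddAbove_image hω.continuousOn)
      obtain ⟨n, hn⟩ := exists_nat_ge M
      refine Set.mem_iUnion.2 ⟨n, fun x hx => ?_⟩
      have := hM (Set.mem_image_of_mem _ hx)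
      push_cast
      linarith
    have hcon : (0 : ℝ≥0∞) = 1 := by
      rw [← hu, ← measure_univ (μ := P)]
      exact measure_congr (eventuallyEq_univ.2 hfull)
    exact zero_ne_one hcon
  have hpos : 0 < P.real {ω | ∀ x ∈ S, Z x ω ≤ 1} :=
    ENNReal.toReal_pos hne (measure_ne_top _ _)
  have hT0 : (T : ℝ) ≠ 0 := by positivity
  have e : Real.exp (-(extremalCoeff P Z S * (T : ℝ)⁻¹)) ^ T = P.real {ω | ∀ x ∈ S, Z x ω ≤ 1} := by
    rw [← Real.exp_nat_mul, extremalCoeff, ← measureReal_def]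
    rw [show (T : ℝ) * -(-Real.log (P.real {ω | ∀ x ∈ S, Z x ω ≤ 1}) * (T : ℝ)⁻¹) =
      Real.log (P.real {ω | ∀ x ∈ S, Z x ω ≤ 1}) by field_simp]
    exact Real.exp_log hpos
  exact (pow_left_inj₀ measureReal_nonneg (Real.exp_pos _).le (by omega)).1 (hpow.trans e.symm)

lemma extremalCoeff_nonneg [IsProbabilityMeasure P] (S : Set (EuclideanSpace ℝ (Fin d))) :
    0 ≤ extremalCoeff P Z S :=
  neg_nonneg.2 (Real.log_nonpos ENNReal.toReal_nonneg
    (ENNReal.toReal_le_of_le_ofReal zero_le_one (by simpa using prob_le_one)))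

lemma measureReal_exceed_le [IsProbabilityMeasure P] (h : IsStationaryMaxStable P Z)
    {S S' : Set (EuclideanSpace ℝ (Fin d))} (hS : IsCompact S) (hS' : IsCompact S') {κ : ℝ}
    (hκ0 : 0 ≤ κ)
    (hκ : extremalCoeff P Z S + extremalCoeff P Z S' - extremalCoeff P Z (S ∪ S') ≤ κ)
    {T : ℕ} (hT : 1 ≤ T) :
    P.real {ω | (∃ x ∈ S, (T : ℝ) < Z x ω) ∧ ∃ x ∈ S', (T : ℝ) < Z x ω} +
      P.real {ω | ∃ x ∈ S, (T : ℝ) < Z x ω} * P.real {ω | ∃ x ∈ S', (T : ℝ) < Z x ω} ≤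
    κ * (T : ℝ)⁻¹ + 2 * (extremalCoeff P Z S * extremalCoeff P Z S') * (T : ℝ)⁻¹ ^ 2 := by
  set A := {ω | ∀ x ∈ S, Z x ω ≤ T} with hA
  set B := {ω | ∀ x ∈ S', Z x ω ≤ T} with hB
  have nA : NullMeasurableSet A P := h.nullMeasurableSet_forall_le S T
  have nB : NullMeasurableSet B P := h.nullMeasurableSet_forall_le S' T
  have eA : {ω | ∃ x ∈ S, (T : ℝ) < Z x ω} = Aᶜ := by ext; simp [hA]
  have eB : {ω | ∃ x ∈ S', (T : ℝ) < Z x ω} = Bᶜ := by ext; simp [hB]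
  have eAB : {ω | (∃ x ∈ S, (T : ℝ) < Z x ω) ∧ ∃ x ∈ S', (T : ℝ) < Z x ω} = (A ∪ B)ᶜ := by
    rw [Set.compl_union, ← eA, ← eB]; rfl
  have eI : A ∩ B = {ω | ∀ x ∈ S ∪ S', Z x ω ≤ T} := by
    ext ω
    simp only [hA, hB, Set.mem_inter_iff, Set.mem_ofPred_eq, Set.mem_union, or_imp, forall_and]
  rw [eA, eB, eAB, probReal_compl_eq_one_sub₀ nA, probReal_compl_eq_one_sub₀ nB,
    probReal_compl_eq_one_sub₀ (nA.union nB)]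
  have hun := measureReal_union_add_inter₀ (μ := P) (s := A) nB
  rw [eI, h.measureReal_forall_le (hS.union hS') hT] at hun
  have pA := h.measureReal_forall_le hS hT
  have pB := h.measureReal_forall_le hS' hT
  rw [← hA] at pA
  rw [← hB] at pB
  have hs : (0 : ℝ) ≤ (T : ℝ)⁻¹ := by positivity
  have k1 := one_sub_exp_sub_exp_add_exp_le (extremalCoeff_nonneg (P := P) (Z := Z) S)
    (extremalCoeff_nonneg (P := P) (Z := Z) S') (extremalCoeff_nonneg (P := P) (Z := Z) (S ∪ S'))
    hκ0 hκ hs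
  have k2 : (1 - P.real A) * (1 - P.real B) ≤
      (extremalCoeff P Z S * (T : ℝ)⁻¹) * (extremalCoeff P Z S' * (T : ℝ)⁻¹) := by
    rw [pA, pB]
    have t1 := Real.add_one_le_exp (-(extremalCoeff P Z S * (T : ℝ)⁻¹))
    have t2 := Real.add_one_le_exp (-(extremalCoeff P Z S' * (T : ℝ)⁻¹))
    have n1 := mul_nonneg (extremalCoeff_nonneg (P := P) (Z := Z) S) hs
    have n2 := mul_nonneg (extremalCoeff_nonneg (P := P) (Z := Z) S') hs
    exact mul_le_mul (by linarith) (by linarith)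
      (by linarith [Real.exp_le_one_iff.2 (neg_nonpos.2 n2)]) n1
  rw [← pA, ← pB] at k1
  nlinarith

end IsStationaryMaxStable

/-- Polynomial mixing rate on the lattice. -/
def rate {d : ℕ} (b : ℝ) (h : Fin d → ℤ) : ℝ := (max 1 ‖h‖) ^ (-b)

lemma rate_pos {d : ℕ} (b : ℝ) (h : Fin d → ℤ) : 0 < rate b h :=
  Real.rpow_pos_of_pos (lt_max_of_lt_left one_pos) _

lemma norm_le_norm_toE {d : ℕ} (h : Fin d → ℤ) : ‖h‖ ≤ ‖toE h‖ := by
  refine (pi_norm_le_iff_of_nonneg (norm_nonneg _)).2 fun i => ?_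
  have := PiLp.norm_apply_le (toE h) i
  rwa [toE_apply] at this

lemma one_le_norm_of_ne_zero {d : ℕ} {h : Fin d → ℤ} (hh : h ≠ 0) : 1 ≤ ‖h‖ := by
  obtain ⟨i, hi⟩ := Function.ne_iff.1 hh
  refine le_trans ?_ (norm_le_pi_norm h i)
  rw [Int.norm_eq_abs]
  exact_mod_cast Int.one_le_abs hi

lemma norm_toE_rpow_le_rate {d : ℕ} {b : ℝ} (hb : 0 ≤ b) {h : Fin d → ℤ} (hh : h ≠ 0) :
    ‖toE h‖ ^ (-b) ≤ rate b h := by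
  have h1 := one_le_norm_of_ne_zero hh
  rw [rate, max_eq_right h1]
  exact Real.rpow_le_rpow_of_nonpos (by linarith) (norm_le_norm_toE h) (by linarith)

namespace IsStationaryMaxStable

variable {d : ℕ} {Ω : Type*} [MeasurableSpace Ω] {P : Measure Ω} [IsProbabilityMeasure P]
  {Z : EuclideanSpace ℝ (Fin d) → Ω → ℝ}

lemma measure_exceed_le (h : IsStationaryMaxStable P Z)
    {S S' : Set (EuclideanSpace ℝ (Fin d))} (hS : IsCompact S) (hS' : IsCompact S') {κ : ℝ}
    (hκ0 : 0 ≤ κ)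
    (hκ : extremalCoeff P Z S + extremalCoeff P Z S' - extremalCoeff P Z (S ∪ S') ≤ κ)
    {r : ℝ} (hr : 0 < r) :
    P {ω | (∃ x ∈ S, r < Z x ω) ∧ ∃ x ∈ S', r < Z x ω} +
      P {ω | ∃ x ∈ S, r < Z x ω} * P {ω | ∃ x ∈ S', r < Z x ω} ≤
    ENNReal.ofReal (2 * κ) * (ENNReal.ofReal r)⁻¹ +
      ENNReal.ofReal (2 + 8 * (extremalCoeff P Z S * extremalCoeff P Z S')) *
        (ENNReal.ofReal r)⁻¹ ^ 2 := by
  set θ := extremalCoeff P Z S * extremalCoeff P Z S' with hθ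
  have hθ0 : 0 ≤ θ := mul_nonneg (extremalCoeff_nonneg _) (extremalCoeff_nonneg _)
  have hrhs : ENNReal.ofReal (2 * κ) * (ENNReal.ofReal r)⁻¹ +
      ENNReal.ofReal (2 + 8 * θ) * (ENNReal.ofReal r)⁻¹ ^ 2 =
      ENNReal.ofReal (2 * κ * r⁻¹ + (2 + 8 * θ) * r⁻¹ ^ 2) := by
    rw [ENNReal.ofReal_add (p := 2 * κ * r⁻¹) (by positivity) (by positivity),
      ENNReal.ofReal_mul (q := r⁻¹) (by positivity),
      ENNReal.ofReal_mul (q := r⁻¹ ^ 2) (by positivity), ENNReal.ofReal_pow (by positivity),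
      ENNReal.ofReal_inv_of_pos hr]
  rw [hrhs]
  rcases lt_or_ge r 1 with h1 | h1
  · calc _ ≤ (1 : ℝ≥0∞) + 1 * 1 := by gcongr <;> exact prob_le_one
      _ = ENNReal.ofReal 2 := by norm_num
      _ ≤ _ := by
        refine ENNReal.ofReal_le_ofReal ?_
        have : 1 ≤ r⁻¹ := (one_le_inv₀ hr).2 h1.le
        have h2 : 1 ≤ r⁻¹ ^ 2 := one_le_pow₀ this
        have h3 : 0 ≤ 2 * κ * r⁻¹ := by positivity
        nlinarith
  · have hT : 1 ≤ ⌊r⌋₊ := (Nat.one_le_floor_iff _).2 h1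
    have hTr : (⌊r⌋₊ : ℝ) ≤ r := Nat.floor_le hr.le
    have hr2 : r / 2 ≤ (⌊r⌋₊ : ℝ) := by
      have := Nat.lt_floor_add_one r
      have : (1 : ℝ) ≤ ⌊r⌋₊ := by exact_mod_cast hT
      linarith
    have hinv : (⌊r⌋₊ : ℝ)⁻¹ ≤ 2 * r⁻¹ := by
      rw [show 2 * r⁻¹ = (r / 2)⁻¹ by field_simp]
      exact inv_anti₀ (by positivity) hr2
    have hinv0 : (0 : ℝ) ≤ (⌊r⌋₊ : ℝ)⁻¹ := by positivity
    have main := h.measureReal_exceed_le hS hS' hκ0 hκ hT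
    have sub : ∀ S : Set (EuclideanSpace ℝ (Fin d)), {ω | ∃ x ∈ S, r < Z x ω} ⊆
        {ω | ∃ x ∈ S, (⌊r⌋₊ : ℝ) < Z x ω} := fun S ω ⟨x, hx, hlt⟩ => ⟨x, hx, hTr.trans_lt hlt⟩
    calc _ ≤ P {ω | (∃ x ∈ S, (⌊r⌋₊ : ℝ) < Z x ω) ∧ ∃ x ∈ S', (⌊r⌋₊ : ℝ) < Z x ω} +
        P {ω | ∃ x ∈ S, (⌊r⌋₊ : ℝ) < Z x ω} * P {ω | ∃ x ∈ S', (⌊r⌋₊ : ℝ) < Z x ω} :=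
          add_le_add (measure_mono fun ω hω => ⟨sub S hω.1, sub S' hω.2⟩)
            (mul_le_mul' (measure_mono (sub S)) (measure_mono (sub S')))
      _ = ENNReal.ofReal (P.real {ω | (∃ x ∈ S, (⌊r⌋₊ : ℝ) < Z x ω) ∧
            ∃ x ∈ S', (⌊r⌋₊ : ℝ) < Z x ω} + P.real {ω | ∃ x ∈ S, (⌊r⌋₊ : ℝ) < Z x ω} *
            P.real {ω | ∃ x ∈ S', (⌊r⌋₊ : ℝ) < Z x ω}) := by
          rw [ENNReal.ofReal_add measureReal_nonneg (mul_nonneg measureReal_nonneg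
            measureReal_nonneg), ENNReal.ofReal_mul measureReal_nonneg, ofReal_measureReal,
            ofReal_measureReal, ofReal_measureReal]
      _ ≤ _ := by
          refine ENNReal.ofReal_le_ofReal (main.trans ?_)
          have h2 : (⌊r⌋₊ : ℝ)⁻¹ ^ 2 ≤ (2 * r⁻¹) ^ 2 := pow_le_pow_left₀ hinv0 hinv 2
          have h3 : 0 ≤ r⁻¹ ^ 2 := by positivity
          rw [← hθ]
          nlinarith [mul_le_mul_of_nonneg_left hinv hκ0, mul_le_mul_of_nonneg_left h2 hθ0]

/-- Mixing for the values of a max-stable field at finitely many points, grouped by unit cubes. -/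
theorem exists_mixing_points (h : IsStationaryMaxStable P Z) {K b : ℝ} (hK : 0 < K) (hb : 0 ≤ b)
    (hθ : ∀ h : Fin d → ℤ, h ≠ 0 →
      extremalCoeff P Z (cube (0 : Fin d → ℤ)) + extremalCoeff P Z (cube h)
        - extremalCoeff P Z (cube (0 : Fin d → ℤ) ∪ cube h) ≤ K * ‖toE h‖ ^ (-b)) :
    ∃ C : ℝ, 0 < C ∧ ∀ {ι : Type} [Fintype ι] (c : ι → Fin d → ℤ)
      (x : ι → EuclideanSpace ℝ (Fin d)), (∀ i, x i ∈ cube (c i)) →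
      ∀ A B : Finset (Fin d → ℤ), ∀ f g : (ι → ℝ) → ℂ, Measurable f → Measurable g →
      ∀ cf cg : ℝ, (∀ u, ‖f u‖ ≤ cf) → (∀ u, ‖g u‖ ≤ cg) →
      DependsOn f {i | c i ∈ A} → DependsOn g {i | c i ∈ B} →
      ‖∫ ω, f (fun i => Z (x i) ω) * g (fun i => Z (x i) ω) ∂P -
        (∫ ω, f (fun i => Z (x i) ω) ∂P) * ∫ ω, g (fun i => Z (x i) ω) ∂P‖ ≤
      C * cf * cg * ∑ k ∈ A, ∑ l ∈ B, rate b (l - k) := by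
  obtain ⟨D, hD, hDb⟩ := h.exists_lintegral_recipMin_le
  refine ⟨32 * D.toReal * K + 2, by positivity, ?_⟩
  intro ι _ c x hx A B f g hf hg cf cg hcf hcg hfA hgB
  have hcf0 : 0 ≤ cf := (norm_nonneg _).trans (hcf 0)
  have hcg0 : 0 ≤ cg := (norm_nonneg _).trans (hcg 0)
  have hm := h.measurable_family x
  have := Measure.isProbabilityMeasure_map (μ := P) hm.aemeasurable
  set μ := P.map fun ω i => Z (x i) ω with hμ
  have etr : ∀ F : (ι → ℝ) → ℂ, Measurable F →
      ∫ ω, F (fun i => Z (x i) ω) ∂P = ∫ u, F u ∂μ := fun F hF =>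
    (integral_map hm.aemeasurable hF.aestronglyMeasurable).symm
  rw [etr (fun u => f u * g u) (hf.mul hg), etr _ hf, etr _ hg]
  have hsum0 : 0 ≤ ∑ k ∈ A, ∑ l ∈ B, rate b (l - k) :=
    Finset.sum_nonneg fun k _ => Finset.sum_nonneg fun l _ => (rate_pos b _).le
  by_cases hAB : Disjoint A B
  · have hne : ∀ k ∈ A, ∀ l ∈ B, l - k ≠ 0 := fun k hk l hl h0 =>
      Finset.disjoint_left.1 hAB hk (by rwa [sub_eq_zero.1 h0] at hl)
    have base := (h.isMaxStableLaw x).enorm_integral_mul_sub_le_sum (s := A) (s' := B)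
      (I := fun k => {i | c i = k}) (J := fun k => {i | c i = k})
      (κ := fun k l => ENNReal.ofReal (2 * (K * rate b (l - k))))
      (β := fun k l => ENNReal.ofReal (2 + 8 * (extremalCoeff P Z (cube (0 : Fin d → ℤ)) *
        extremalCoeff P Z (cube (l - k))))) (D := D) hf hg hcf hcg
      (by convert hfA using 1; ext i; simp) (by convert hgB using 1; ext i; simp)
      (fun k _ l _ => by
        have := mul_pos hK (rate_pos b (l - k))
        simpa using this)
      (fun _ _ _ _ => ENNReal.ofReal_ne_top) hD
      (fun k hk l hl r hr => by
        have hexc := h.measure_exceed_le (isCompact_cube (0 : Fin d → ℤ)) (isCompact_cube (l - k))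
          (mul_pos hK (rate_pos b (l - k))).le ((hθ _ (hne k hk l hl)).trans
            (mul_le_mul_of_nonneg_left (norm_toE_rpow_le_rate hb (hne k hk l hl)) hK.le)) hr
        refine le_trans ?_ hexc
        have hsh := h.map_shift (toE k) (fun i => x i - toE k)
        simp only [sub_add_cancel] at hsh
        have ms : ∀ k : Fin d → ℤ, MeasurableSet {u : ι → ℝ | ∃ i ∈ {i | c i = k}, r < u i} := by
          intro k
          have : {u : ι → ℝ | ∃ i ∈ {i | c i = k}, r < u i} =
              ⋃ i ∈ {i | c i = k}, {u : ι → ℝ | r < u i} := by ext p; simp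
          rw [this]
          exact MeasurableSet.biUnion (Set.to_countable _) fun i _ =>
            measurableSet_lt (by fun_prop) (by fun_prop)
        have hm' := h.measurable_family fun i => x i - toE k
        have mem : ∀ l i, c i = l → x i - toE k ∈ cube (l - k) := fun l i hi =>
          sub_toE_mem_cube (hi ▸ hx i)
        rw [hsh, Measure.map_apply hm' (ms k), Measure.map_apply hm' (ms l),
          Measure.map_apply hm' (show MeasurableSet {u : ι → ℝ | (∃ i ∈ {i | c i = k}, r < u i) ∧
            ∃ j ∈ {i | c i = l}, r < u j} from (ms k).inter (ms l))]
        refine add_le_add (measure_mono ?_) (mul_le_mul' (measure_mono ?_) (measure_mono ?_))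
        · rintro ω ⟨⟨i, hi, hri⟩, j, hj, hrj⟩
          exact ⟨⟨_, by simpa using mem k i hi, hri⟩, _, mem l j hj, hrj⟩
        · rintro ω ⟨i, hi, hri⟩
          exact ⟨_, by simpa using mem k i hi, hri⟩
        · rintro ω ⟨i, hi, hri⟩
          exact ⟨_, mem l i hi, hri⟩)
      (fun k _ => hDb x k _ fun i hi => hi ▸ hx i) (fun k _ => hDb x k _ fun i hi => hi ▸ hx i)
    have e : ENNReal.ofReal (2 * cf) * ENNReal.ofReal (2 * cg) * (4 * D * ∑ k ∈ A, ∑ l ∈ B,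
        ENNReal.ofReal (2 * (K * rate b (l - k)))) = ENNReal.ofReal ((2 * cf) * (2 * cg) *
        (4 * D.toReal * ∑ k ∈ A, ∑ l ∈ B, 2 * (K * rate b (l - k)))) := by
      have r0 : ∀ k l : Fin d → ℤ, 0 ≤ 2 * (K * rate b (l - k)) := fun k l => by
        have := mul_pos hK (rate_pos b (l - k)); positivity
      have r1 : 0 ≤ ∑ k ∈ A, ∑ l ∈ B, 2 * (K * rate b (l - k)) :=
        Finset.sum_nonneg fun k _ => Finset.sum_nonneg fun l _ => r0 k l
      rw [ENNReal.ofReal_mul (p := 2 * cf * (2 * cg)) (by positivity),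
        ENNReal.ofReal_mul (p := 2 * cf) (q := 2 * cg) (by positivity),
        ENNReal.ofReal_mul (p := 4 * D.toReal) (by positivity),
        ENNReal.ofReal_mul (p := 4) (q := D.toReal) (by positivity), ENNReal.ofReal_toReal hD,
        ENNReal.ofReal_sum_of_nonneg fun k _ => Finset.sum_nonneg fun l _ => r0 k l]
      simp_rw [ENNReal.ofReal_sum_of_nonneg fun l _ => r0 _ l]
      norm_num
    rw [e, ← ofReal_norm] at base
    have r1 : 0 ≤ ∑ k ∈ A, ∑ l ∈ B, 2 * (K * rate b (l - k)) :=
      Finset.sum_nonneg fun k _ => Finset.sum_nonneg fun l _ => by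
        have := mul_pos hK (rate_pos b (l - k)); positivity
    refine ((ENNReal.ofReal_le_ofReal_iff (by positivity)).1 base).trans ?_
    simp_rw [← Finset.mul_sum]
    have : 0 ≤ cf * cg * ∑ k ∈ A, ∑ l ∈ B, rate b (l - k) := by positivity
    nlinarith
  · obtain ⟨k, hkA, hkB⟩ := Finset.not_disjoint_iff.1 hAB
    have h1 : 1 ≤ ∑ k ∈ A, ∑ l ∈ B, rate b (l - k) := by
      calc (1 : ℝ) = rate b (k - k) := by simp [rate]
        _ ≤ ∑ l ∈ B, rate b (l - k) :=
          Finset.single_le_sum (f := fun l => rate b (l - k)) (fun l _ => (rate_pos b _).le) hkB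
        _ ≤ _ := Finset.single_le_sum (f := fun k => ∑ l ∈ B, rate b (l - k))
          (fun k _ => Finset.sum_nonneg fun l _ => (rate_pos b _).le) hkA
    have n1 : ‖∫ u, f u * g u ∂μ‖ ≤ cf * cg := by
      simpa using norm_integral_le_of_norm_le_const (μ := μ) (C := cf * cg)
        (f := fun u => f u * g u) (ae_of_all _ fun u => by
          rw [norm_mul]
          exact mul_le_mul (hcf u) (hcg u) (norm_nonneg _) hcf0)
    have n2 : ‖∫ u, f u ∂μ‖ ≤ cf := by
      simpa using norm_integral_le_of_norm_le_const (μ := μ) (ae_of_all _ hcf)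
    have n3 : ‖∫ u, g u ∂μ‖ ≤ cg := by
      simpa using norm_integral_le_of_norm_le_const (μ := μ) (ae_of_all _ hcg)
    have n4 : ‖(∫ u, f u ∂μ) * ∫ u, g u ∂μ‖ ≤ cf * cg := by
      rw [norm_mul]
      exact mul_le_mul n2 n3 (norm_nonneg _) hcf0
    refine (norm_sub_le _ _).trans ?_
    have hD0 : 0 ≤ 32 * D.toReal * K := by positivity
    have p0 : 0 ≤ cf * cg := by positivity
    calc _ ≤ cf * cg + cf * cg := add_le_add n1 n4
      _ ≤ (32 * D.toReal * K + 2) * cf * cg * 1 := by nlinarith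
      _ ≤ _ := by gcongr

end IsStationaryMaxStable

/-- The half-open unit cube at the origin. -/
def unitCube (d : ℕ) : Set (EuclideanSpace ℝ (Fin d)) := {x | ∀ i, 0 ≤ x i ∧ x i < 1}

lemma unitCube_subset_cube (d : ℕ) : unitCube d ⊆ cube 0 :=
  fun x hx i => ⟨by simpa using (hx i).1, by simpa using (hx i).2.le⟩

lemma measurableSet_unitCube (d : ℕ) : MeasurableSet (unitCube d) := by
  have : unitCube d = ⋂ i, {x | 0 ≤ x i} ∩ {x | x i < 1} := by ext; simp [unitCube]
  rw [this]
  exact MeasurableSet.iInter fun i =>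
    (measurableSet_le measurable_const (by fun_prop)).inter
      (measurableSet_lt (by fun_prop) measurable_const)

lemma volume_unitCube (d : ℕ) : volume (unitCube d) = 1 := by
  have h := PiLp.volume_preserving_ofLp (Fin d)
  have hs : MeasurableSet (Set.univ.pi fun _ : Fin d => Set.Ico (0 : ℝ) 1) :=
    MeasurableSet.univ_pi fun _ => measurableSet_Ico
  have e := h.measure_preimage hs.nullMeasurableSet
  rw [Real.volume_pi_Ico] at e
  simp only [sub_zero, ENNReal.ofReal_one, Finset.prod_const_one] at e
  rw [← e]
  congr 1
  ext x
  simp [unitCube]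

/-- The integral of `G ∘ Z` over the unit cube at the lattice point `h`. -/
def cubeIntegral {d : ℕ} {Ω : Type*} (Z : EuclideanSpace ℝ (Fin d) → Ω → ℝ) (G : ℝ → ℝ)
    (h : Fin d → ℤ) (ω : Ω) : ℝ :=
  ∫ x in unitCube d, G (Z (toE h + x) ω)

/-- A bounded centred lattice field whose finite blocks are weakly dependent at rate `ρ`. -/
structure IsMixingField {d : ℕ} {Ω : Type*} [MeasurableSpace Ω] (P : Measure Ω)
    (Y : (Fin d → ℤ) → Ω → ℝ) (ρ : (Fin d → ℤ) → ℝ) (C B : ℝ) : Prop where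
  const_nonneg : 0 ≤ C
  bound_nonneg : 0 ≤ B
  rate_nonneg : ∀ h, 0 ≤ ρ h
  meas : ∀ h, Measurable (Y h)
  bound : ∀ h ω, |Y h ω| ≤ B
  mean : ∀ h, ∫ ω, Y h ω ∂P = 0
  mix : ∀ (S T : Finset (Fin d → ℤ)) (f g : ((Fin d → ℤ) → ℝ) → ℂ), Continuous f → Continuous g →
    ∀ cf cg : ℝ, (∀ u, (∀ h, |u h| ≤ B) → ‖f u‖ ≤ cf) → (∀ u, (∀ h, |u h| ≤ B) → ‖g u‖ ≤ cg) →
    DependsOn f (S : Set (Fin d → ℤ)) → DependsOn g (T : Set (Fin d → ℤ)) →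
    ‖∫ ω, f (fun h => Y h ω) * g (fun h => Y h ω) ∂P -
      (∫ ω, f (fun h => Y h ω) ∂P) * ∫ ω, g (fun h => Y h ω) ∂P‖ ≤
    C * cf * cg * ∑ k ∈ S, ∑ l ∈ T, ρ (l - k)

instance isProbabilityMeasure_unitCube (d : ℕ) :
    IsProbabilityMeasure (volume.restrict (unitCube d)) :=
  ⟨by rw [Measure.restrict_apply_univ, volume_unitCube]⟩

lemma abs_integral_unitCube_le {d : ℕ} {B : ℝ} {f : EuclideanSpace ℝ (Fin d) → ℝ}
    (hf : ∀ x, |f x| ≤ B) : |∫ x in unitCube d, f x| ≤ B := by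
  have := norm_integral_le_of_norm_le_const (μ := volume.restrict (unitCube d)) (C := B) (f := f)
    (ae_of_all _ hf)
  simpa using this

namespace IsStationaryMaxStable

variable {d : ℕ} {Ω : Type*} [MeasurableSpace Ω] {P : Measure Ω}
  {Z : EuclideanSpace ℝ (Fin d) → Ω → ℝ}

lemma measurable_cubeIntegral (h : IsStationaryMaxStable P Z) {G : ℝ → ℝ} (hG : Measurable G)
    (k : Fin d → ℤ) : Measurable (cubeIntegral Z G k) := by
  have hm : Measurable fun p : Ω × EuclideanSpace ℝ (Fin d) => G (Z (toE k + p.2) p.1) :=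
    hG.comp (h.meas.comp (show Measurable fun p : Ω × EuclideanSpace ℝ (Fin d) =>
      (toE k + p.2, p.1) by fun_prop))
  exact (hm.stronglyMeasurable.integral_prod_right (ν := volume.restrict (unitCube d))).measurable

lemma map_apply_eq (h : IsStationaryMaxStable P Z) (x : EuclideanSpace ℝ (Fin d)) :
    P.map (Z x) = P.map (Z 0) := by
  have := congrArg (Measure.map fun u : Unit → ℝ => u ()) (h.map_shift x fun _ : Unit => 0)
  rw [Measure.map_map (measurable_pi_apply _) (h.measurable_family _),
    Measure.map_map (measurable_pi_apply _) (h.measurable_family _)] at this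
  simpa [Function.comp_def] using this

lemma integral_comp_eq (h : IsStationaryMaxStable P Z) {G : ℝ → ℝ} (hG : Measurable G)
    (x : EuclideanSpace ℝ (Fin d)) : ∫ ω, G (Z x ω) ∂P = ∫ ω, G (Z 0 ω) ∂P := by
  rw [← integral_map (h.measurable_apply x).aemeasurable hG.aestronglyMeasurable,
    ← integral_map (h.measurable_apply 0).aemeasurable hG.aestronglyMeasurable, h.map_apply_eq]

/-- Integrals of a bounded continuous function of the field over unit cubes are weakly
dependent. -/
theorem isMixingField_cubeIntegral [IsProbabilityMeasure P] (h : IsStationaryMaxStable P Z)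
    {b C : ℝ}
    (hC : 0 ≤ C) (hmix : ∀ {ι : Type} [Fintype ι] (c : ι → Fin d → ℤ)
      (x : ι → EuclideanSpace ℝ (Fin d)), (∀ i, x i ∈ cube (c i)) →
      ∀ A B : Finset (Fin d → ℤ), ∀ f g : (ι → ℝ) → ℂ, Measurable f → Measurable g →
      ∀ cf cg : ℝ, (∀ u, ‖f u‖ ≤ cf) → (∀ u, ‖g u‖ ≤ cg) →
      DependsOn f {i | c i ∈ A} → DependsOn g {i | c i ∈ B} →
      ‖∫ ω, f (fun i => Z (x i) ω) * g (fun i => Z (x i) ω) ∂P -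
        (∫ ω, f (fun i => Z (x i) ω) ∂P) * ∫ ω, g (fun i => Z (x i) ω) ∂P‖ ≤
      C * cf * cg * ∑ k ∈ A, ∑ l ∈ B, rate b (l - k))
    {G : ℝ → ℝ} (hG : Continuous G) {M : ℝ} (hGM : ∀ z, |G z| ≤ M)
    (hG0 : ∫ ω, G (Z 0 ω) ∂P = 0) :
    IsMixingField P (cubeIntegral Z G) (rate b) C M where
  const_nonneg := hC
  bound_nonneg := (abs_nonneg _).trans (hGM 0)
  rate_nonneg k := (rate_pos b k).le
  meas := h.measurable_cubeIntegral hG.measurable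
  bound k ω := abs_integral_unitCube_le fun x => hGM _
  mean k := by
    have hm : Measurable fun p : Ω × EuclideanSpace ℝ (Fin d) => G (Z (toE k + p.2) p.1) :=
      hG.measurable.comp (h.meas.comp (show Measurable fun p : Ω × EuclideanSpace ℝ (Fin d) =>
        (toE k + p.2, p.1) by fun_prop))
    unfold cubeIntegral
    rw [integral_integral_swap (f := fun ω x => G (Z (toE k + x) ω))]
    · simp [h.integral_comp_eq hG.measurable, hG0]
    · exact Integrable.of_bound hm.aestronglyMeasurable M (ae_of_all _ fun p => hGM _)
  mix S T f g hf hg cf cg hcf hcg hfS hgT := by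
    classical
    have h0 : (0 : EuclideanSpace ℝ (Fin d)) ∈ cube (0 : Fin d → ℤ) := fun i => by simp
    let s : ℕ → SimpleFunc (EuclideanSpace ℝ (Fin d)) (EuclideanSpace ℝ (Fin d)) :=
      SimpleFunc.approxOn id measurable_id (cube 0) 0 h0
    have hs : ∀ n x, s n x ∈ cube (0 : Fin d → ℤ) := SimpleFunc.approxOn_mem measurable_id h0
    let Yn : ℕ → (Fin d → ℤ) → Ω → ℝ := fun n k ω =>
      ∫ x in unitCube d, G (Z (toE k + s n x) ω)
    have hlim : ∀ᵐ ω ∂P, ∀ k, Tendsto (fun n => Yn n k ω) atTop (𝓝 (cubeIntegral Z G k ω)) := by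
      filter_upwards [h.cont] with ω hω k
      refine tendsto_integral_of_dominated_convergence (fun _ => M) (fun n => ?_)
        (integrable_const _) (fun n => ae_of_all _ fun x => hGM _) ?_
      · have : Measurable fun x => G (Z (toE k + s n x) ω) :=
          hG.measurable.comp (hω.measurable.comp (measurable_const.add (s n).measurable))
        exact this.aestronglyMeasurable
      · refine (ae_restrict_iff' (measurableSet_unitCube d)).2 (ae_of_all _ fun x hx => ?_)
        have hsx : Tendsto (fun n => s n x) atTop (𝓝 x) :=
          SimpleFunc.tendsto_approxOn measurable_id h0
            (subset_closure (unitCube_subset_cube d hx))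
        exact ((hG.comp (hω.comp (continuous_const.add continuous_id))).tendsto x).comp hsx
    have hYm : ∀ n k, Measurable (Yn n k) := fun n k => by
      have hm : Measurable fun p : Ω × EuclideanSpace ℝ (Fin d) => G (Z (toE k + s n p.2) p.1) :=
        hG.measurable.comp (h.meas.comp
          ((measurable_const.add ((s n).measurable.comp measurable_snd)).prodMk measurable_fst))
      exact (hm.stronglyMeasurable.integral_prod_right
        (ν := volume.restrict (unitCube d))).measurable
    have hYb : ∀ n k ω, |Yn n k ω| ≤ M := fun n k ω => abs_integral_unitCube_le fun x => hGM _
    have hYnm : ∀ n, Measurable fun ω k => Yn n k ω := fun n => measurable_pi_lambda _ (hYm n)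
    have conv : ∀ (F : ((Fin d → ℤ) → ℝ) → ℂ), Continuous F → ∀ c : ℝ,
        (∀ u, (∀ h, |u h| ≤ M) → ‖F u‖ ≤ c) →
        Tendsto (fun n => ∫ ω, F (fun k => Yn n k ω) ∂P) atTop
          (𝓝 (∫ ω, F (fun k => cubeIntegral Z G k ω) ∂P)) := by
      intro F hF c hc
      refine tendsto_integral_of_dominated_convergence (fun _ => c) (fun n => ?_)
        (integrable_const _) (fun n => ae_of_all _ fun ω => hc _ fun k => hYb n k ω) ?_
      · exact (hF.measurable.comp (hYnm n)).aestronglyMeasurable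
      · filter_upwards [hlim] with ω hω
        exact (hF.tendsto _).comp (tendsto_pi_nhds.2 hω)
    have hM0 : 0 ≤ M := (abs_nonneg _).trans (hGM 0)
    have hcf0 : 0 ≤ cf := (norm_nonneg _).trans (hcf 0 fun _ => by simpa using hM0)
    refine le_of_tendsto ((conv (fun u => f u * g u) (hf.mul hg) (cf * cg) fun u hu => ?_).sub
      ((conv f hf cf hcf).mul (conv g hg cg hcg))).norm (Eventually.of_forall fun n => ?_)
    · rw [norm_mul]
      exact mul_le_mul (hcf u hu) (hcg u hu) (norm_nonneg _) hcf0
    let ι := ↥(S ∪ T) × ↥((s n).range)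
    let Φ : (ι → ℝ) → (Fin d → ℤ) → ℝ := fun u k =>
      if hk : k ∈ S ∪ T then
        ∫ x in unitCube d, G (u (⟨k, hk⟩, ⟨s n x, SimpleFunc.mem_range_self _ _⟩)) else 0
    have hΦb : ∀ u k, |Φ u k| ≤ M := by
      intro u k
      by_cases hk : k ∈ S ∪ T
      · simp only [Φ, hk, dif_pos]
        exact abs_integral_unitCube_le fun x => hGM _
      · simp only [Φ]
        rw [dif_neg hk, abs_zero]
        exact hM0
    have hidx : Measurable fun x => (⟨s n x, SimpleFunc.mem_range_self _ _⟩ : ↥((s n).range)) :=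
      (s n).measurable.subtype_mk
    have hΦm : Measurable Φ := by
      refine measurable_pi_lambda _ fun k => ?_
      by_cases hk : k ∈ S ∪ T
      · simp only [Φ, hk, dif_pos]
        have hm : Measurable fun p : (ι → ℝ) × EuclideanSpace ℝ (Fin d) =>
            G (p.1 (⟨k, hk⟩, ⟨s n p.2, SimpleFunc.mem_range_self _ _⟩)) := by
          refine hG.measurable.comp ?_
          have hev : Measurable fun q : (ι → ℝ) × ι => q.1 q.2 :=
            measurable_from_prod_countable_left fun i => measurable_pi_apply i
          exact hev.comp (measurable_fst.prodMk
            (measurable_const.prodMk (hidx.comp measurable_snd)))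
        exact (hm.stronglyMeasurable.integral_prod_right
          (ν := volume.restrict (unitCube d))).measurable
      · simp only [Φ, hk, dif_neg, not_false_eq_true]
        exact measurable_const
    have hΦd : ∀ (A : Finset (Fin d → ℤ)) (F : ((Fin d → ℤ) → ℝ) → ℂ),
        DependsOn F (A : Set (Fin d → ℤ)) →
        DependsOn (fun u => F (Φ u)) {i : ι | (i.1 : Fin d → ℤ) ∈ A} := by
      intro A F hF u v huv
      refine hF fun k hk => ?_
      simp only [Φ]
      split_ifs with hkS
      · congr 1
        ext x
        rw [huv _ (show (⟨k, hkS⟩, _) ∈ {i : ι | (i.1 : Fin d → ℤ) ∈ A} from hk)]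
      · rfl
    let p : ι → EuclideanSpace ℝ (Fin d) := fun i => toE (i.1 : Fin d → ℤ) + (i.2 : _)
    have hp : ∀ i, p i ∈ cube (i.1 : Fin d → ℤ) := by
      rintro ⟨k, y, hy⟩ i
      obtain ⟨x, rfl⟩ := SimpleFunc.mem_range.1 hy
      have := hs n x i
      simp only [Pi.zero_apply, Int.cast_zero, zero_add] at this
      simp only [p, PiLp.add_apply, toE_apply]
      constructor <;> linarith
    have hΦY : ∀ ω, ∀ k ∈ S ∪ T, Φ (fun i => Z (p i) ω) k = Yn n k ω := fun ω k hk => by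
      simp only [Φ, hk, dif_pos, p, Yn]
    have ef : ∀ ω, f (Φ fun i => Z (p i) ω) = f fun k => Yn n k ω := fun ω =>
      hfS fun k hk => hΦY ω k (Finset.mem_union_left _ hk)
    have eg : ∀ ω, g (Φ fun i => Z (p i) ω) = g fun k => Yn n k ω := fun ω =>
      hgT fun k hk => hΦY ω k (Finset.mem_union_right _ hk)
    have := hmix (fun i : ι => (i.1 : Fin d → ℤ)) p hp S T (fun u => f (Φ u)) (fun u => g (Φ u))
      (hf.measurable.comp hΦm) (hg.measurable.comp hΦm) cf cg (fun u => hcf _ (hΦb u))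
      (fun u => hcg _ (hΦb u)) (hΦd S f hfS) (hΦd T g hgT)
    simpa only [ef, eg] using this

end IsStationaryMaxStable

/-- The character `x ↦ e^{ix}` of the real line. -/
def expi (x : ℝ) : ℂ := Complex.exp (Complex.I * x)

lemma norm_expi (x : ℝ) : ‖expi x‖ = 1 := by
  rw [expi, mul_comm, Complex.norm_exp_ofReal_mul_I]

lemma expi_add (x y : ℝ) : expi (x + y) = expi x * expi y := by
  simp [expi, mul_add, Complex.exp_add]

@[simp] lemma expi_zero : expi 0 = 1 := by simp [expi]

@[fun_prop] lemma continuous_expi : Continuous expi := by unfold expi; fun_prop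

@[fun_prop] lemma measurable_expi : Measurable expi := continuous_expi.measurable

lemma norm_expi_sub_one_le (x : ℝ) : ‖expi x - 1‖ ≤ |x| :=
  Real.norm_exp_I_mul_ofReal_sub_one_le

lemma norm_expi_sub_one_sub_le (x : ℝ) : ‖expi x - 1 - Complex.I * x‖ ≤ 3 * x ^ 2 := by
  have hx : ‖Complex.I * (x : ℂ)‖ = |x| := by simp
  have h2 : |x| ^ 2 = x ^ 2 := sq_abs x
  rcases le_or_gt |x| 1 with h | h
  · have := Complex.norm_exp_sub_one_sub_id_le (x := Complex.I * x) (by rwa [hx])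
    rw [hx, h2] at this
    exact this.trans (by nlinarith [sq_nonneg x])
  · calc _ ≤ ‖expi x - 1‖ + ‖Complex.I * (x : ℂ)‖ := norm_sub_le _ _
      _ ≤ |x| + |x| := add_le_add (norm_expi_sub_one_le x) hx.le
      _ ≤ _ := by nlinarith

lemma card_filter_norm_sub_le {d : ℕ} (T : Finset (Fin d → ℤ)) (i : Fin d → ℤ) {r : ℝ}
    (hr : 0 ≤ r) : ((T.filter fun j => ‖j - i‖ ≤ r).card : ℝ) ≤ (2 * r + 1) ^ d := by
  have hsub : (T.filter fun j => ‖j - i‖ ≤ r) ⊆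
      Finset.Icc (fun a => i a - ⌊r⌋₊) (fun a => i a + ⌊r⌋₊) := by
    intro j hj
    have hj := (Finset.mem_filter.1 hj).2
    have key : ∀ a, |j a - i a| ≤ (⌊r⌋₊ : ℤ) := fun a => by
      have h1 := (norm_le_pi_norm (j - i) a).trans hj
      rw [Pi.sub_apply, Int.norm_eq_abs, ← Int.cast_abs, Int.abs_eq_natAbs, Int.cast_natCast] at h1
      rw [Int.abs_eq_natAbs]
      exact_mod_cast Nat.le_floor h1
    rw [Finset.mem_Icc, Pi.le_def, Pi.le_def]
    exact ⟨fun a => by have := abs_le.1 (key a); linarith,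
      fun a => by have := abs_le.1 (key a); linarith⟩
  have hc := Finset.card_le_card hsub
  rw [Pi.card_Icc] at hc
  simp only [Int.card_Icc] at hc
  have e : ∀ a, (i a + (⌊r⌋₊ : ℤ) + 1 - (i a - ⌊r⌋₊)).toNat = 2 * ⌊r⌋₊ + 1 := fun a => by omega
  simp only [e, Finset.prod_const, Finset.card_univ, Fintype.card_fin] at hc
  calc _ ≤ (((2 * ⌊r⌋₊ + 1) ^ d : ℕ) : ℝ) := by exact_mod_cast hc
    _ ≤ _ := by
      push_cast
      have := Nat.floor_le hr
      gcongr

/-- The weighted tail of a lattice rate. -/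
def rateTail {d : ℕ} (ρ : (Fin d → ℤ) → ℝ) (R : ℕ) : ℝ :=
  ∑' k : Fin d → ℤ, if (R : ℝ) < ‖k‖ then ρ k * (2 * ‖k‖ + 1) ^ d else 0

lemma rateTail_nonneg {d : ℕ} {ρ : (Fin d → ℤ) → ℝ} (h0 : ∀ k, 0 ≤ ρ k) (R : ℕ) :
    0 ≤ rateTail ρ R :=
  tsum_nonneg fun k => by
    have := h0 k
    split_ifs <;> positivity

lemma tendsto_rateTail {d : ℕ} {ρ : (Fin d → ℤ) → ℝ} (h0 : ∀ k, 0 ≤ ρ k)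
    (hs : Summable fun k => ρ k * (2 * ‖k‖ + 1) ^ d) : Tendsto (rateTail ρ) atTop (𝓝 0) := by
  have := tendsto_tsum_of_dominated_convergence (𝓕 := atTop)
    (f := fun (R : ℕ) k => if (R : ℝ) < ‖k‖ then ρ k * (2 * ‖k‖ + 1) ^ d else 0)
    (g := fun _ => (0 : ℝ)) hs (fun k => ?_) (Eventually.of_forall fun R k => ?_)
  · rwa [tsum_zero] at this
  · refine tendsto_const_nhds.congr' ?_
    filter_upwards [eventually_ge_atTop ⌈‖k‖⌉₊] with R hR
    rw [if_neg (not_lt.2 (Nat.ceil_le.1 hR))]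
  · have := h0 k
    have hp : 0 ≤ ρ k * (2 * ‖k‖ + 1) ^ d := by positivity
    split_ifs
    · rw [Real.norm_of_nonneg hp]
    · simpa using hp

lemma sum_le_rateTail {d : ℕ} {ρ : (Fin d → ℤ) → ℝ} (h0 : ∀ k, 0 ≤ ρ k)
    (hs : Summable fun k => ρ k * (2 * ‖k‖ + 1) ^ d) {R : ℕ} (T : Finset (Fin d → ℤ))
    (i : Fin d → ℤ) (hT : ∀ j ∈ T, (R : ℝ) < ‖j - i‖) :
    ∑ k ∈ T, ρ (k - i) * (2 * ‖k - i‖ + 1) ^ d ≤ rateTail ρ R := by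
  classical
  have hp : ∀ k, 0 ≤ ρ k * (2 * ‖k‖ + 1) ^ d := fun k => by
    have := h0 k
    positivity
  have hs' : Summable fun k => if (R : ℝ) < ‖k‖ then ρ k * (2 * ‖k‖ + 1) ^ d else 0 :=
    hs.of_nonneg_of_le (fun k => by split_ifs; exacts [hp k, le_rfl])
      fun k => by split_ifs; exacts [le_rfl, hp k]
  calc _ = ∑ k ∈ T.image (· - i), (if (R : ℝ) < ‖k‖ then ρ k * (2 * ‖k‖ + 1) ^ d else 0) := by
        rw [Finset.sum_image fun x _ y _ hxy => sub_left_injective hxy]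
        exact Finset.sum_congr rfl fun k hk => by rw [if_pos (hT k hk)]
    _ ≤ _ := hs'.sum_le_tsum _ fun k _ => by split_ifs; exacts [hp k, le_rfl]

namespace IsMixingField

variable {d : ℕ} {Ω : Type*} [MeasurableSpace Ω] {P : Measure Ω}
  {Y : (Fin d → ℤ) → Ω → ℝ} {ρ : (Fin d → ℤ) → ℝ} {C B : ℝ}

lemma mix_real (hY : IsMixingField P Y ρ C B) (S T : Finset (Fin d → ℤ))
    {f g : ((Fin d → ℤ) → ℝ) → ℝ} (hf : Continuous f) (hg : Continuous g)
    {cf cg : ℝ} (hcf : ∀ u, (∀ h, |u h| ≤ B) → |f u| ≤ cf)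
    (hcg : ∀ u, (∀ h, |u h| ≤ B) → |g u| ≤ cg)
    (hfS : DependsOn f (S : Set (Fin d → ℤ))) (hgT : DependsOn g (T : Set (Fin d → ℤ))) :
    |∫ ω, f (fun h => Y h ω) * g (fun h => Y h ω) ∂P -
      (∫ ω, f (fun h => Y h ω) ∂P) * ∫ ω, g (fun h => Y h ω) ∂P| ≤
    C * cf * cg * ∑ k ∈ S, ∑ l ∈ T, ρ (l - k) := by
  have := hY.mix S T (fun u => (f u : ℂ)) (fun u => (g u : ℂ)) (by fun_prop) (by fun_prop) cf cg
    (fun u hu => by simpa using hcf u hu) (fun u hu => by simpa using hcg u hu)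
    (fun u v huv => congrArg _ (hfS huv)) (fun u v huv => congrArg _ (hgT huv))
  simp_rw [← Complex.ofReal_mul, integral_complex_ofReal] at this
  rw [← Complex.ofReal_mul, ← Complex.ofReal_sub, Complex.norm_real] at this
  exact this

lemma integrable_comp [IsFiniteMeasure P] (hY : IsMixingField P Y ρ C B) {f : ((Fin d → ℤ) → ℝ) → ℂ}
    (hf : Continuous f) {c : ℝ} (hc : ∀ u, (∀ h, |u h| ≤ B) → ‖f u‖ ≤ c) :
    Integrable (fun ω => f fun h => Y h ω) P :=
  Integrable.of_bound
    (hf.measurable.comp (measurable_pi_lambda _ hY.meas)).aestronglyMeasurable c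
    (ae_of_all _ fun ω => hc _ fun h => hY.bound h ω)

/-- A site is nearly uncorrelated with the character of a sum over remote sites. -/
lemma norm_integral_mul_expi_far_le [IsFiniteMeasure P] (hY : IsMixingField P Y ρ C B)
    (hs : Summable fun k => ρ k * (2 * ‖k‖ + 1) ^ d) (i : Fin d → ℤ) (t : ℝ) {R : ℕ}
    (T : Finset (Fin d → ℤ)) (hT : ∀ j ∈ T, (R : ℝ) < ‖j - i‖) :
    ‖∫ ω, (Y i ω : ℂ) * expi (t * ∑ j ∈ T, Y j ω) ∂P‖ ≤ C * B * (|t| * B) * rateTail ρ R := by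
  classical
  have hC := hY.const_nonneg
  have hB := hY.bound_nonneg
  have h0 := hY.rate_nonneg
  have hbound : ‖∫ ω, (Y i ω : ℂ) * expi (t * ∑ j ∈ T, Y j ω) ∂P‖ ≤
      C * B * (|t| * B) *
        ∑ k ∈ T, ρ (k - i) * ((T.filter fun j => ‖j - i‖ ≤ ‖k - i‖).card : ℝ) := by
    clear hT
    induction T using Finset.induction_on_min_value (fun j => ‖j - i‖) with
    | empty => simp [integral_complex_ofReal, hY.mean i]
    | insert j s hj hmin ih =>
      have hcy : Continuous fun u : (Fin d → ℤ) → ℝ => (u i : ℂ) := by fun_prop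
      have hg : Continuous fun u : (Fin d → ℤ) → ℝ =>
          (expi (t * u j) - 1) * expi (t * ∑ k ∈ s, u k) := by fun_prop
      have hgb : ∀ u : (Fin d → ℤ) → ℝ, (∀ h, |u h| ≤ B) →
          ‖(expi (t * u j) - 1) * expi (t * ∑ k ∈ s, u k)‖ ≤ |t| * B := fun u hu => by
        rw [norm_mul, norm_expi, mul_one]
        refine (norm_expi_sub_one_le _).trans ?_
        rw [abs_mul]
        exact mul_le_mul_of_nonneg_left (hu j) (abs_nonneg _)
      have hfb : ∀ u : (Fin d → ℤ) → ℝ, (∀ h, |u h| ≤ B) → ‖(u i : ℂ)‖ ≤ B := fun u hu => by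
        simpa using hu i
      have hstep := hY.mix {i} (insert j s) (fun u => (u i : ℂ))
        (fun u => (expi (t * u j) - 1) * expi (t * ∑ k ∈ s, u k)) hcy hg B (|t| * B) hfb hgb
        (fun u v huv => congrArg _ (huv i (by simp)))
        (fun u v huv => by
          have e : ∑ k ∈ s, u k = ∑ k ∈ s, v k :=
            Finset.sum_congr rfl fun k hk => huv k (by simp [hk])
          simp only [e, huv j (by simp)])
      rw [integral_complex_ofReal, hY.mean i, Complex.ofReal_zero, zero_mul, sub_zero,
        Finset.sum_singleton] at hstep
      have hdec : ∫ ω, (Y i ω : ℂ) * expi (t * ∑ j ∈ insert j s, Y j ω) ∂P =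
          ∫ ω, (Y i ω : ℂ) * expi (t * ∑ j ∈ s, Y j ω) ∂P +
          ∫ ω, (Y i ω : ℂ) * ((expi (t * Y j ω) - 1) * expi (t * ∑ k ∈ s, Y k ω)) ∂P := by
        rw [← integral_add]
        · refine integral_congr_ae (ae_of_all _ fun ω => ?_)
          dsimp only
          rw [Finset.sum_insert hj, mul_add, expi_add]
          ring
        · exact hY.integrable_comp (f := fun u => (u i : ℂ) * expi (t * ∑ j ∈ s, u j))
            (by fun_prop) (c := B) fun u hu => by simpa [norm_expi] using hu i
        · exact hY.integrable_comp (hcy.mul hg) (c := B * (|t| * B)) fun u hu => by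
            rw [Pi.mul_apply, norm_mul]
            exact mul_le_mul (hfb u hu) (hgb u hu) (norm_nonneg _) hB
      rw [hdec]
      refine (norm_add_le _ _).trans ((add_le_add ih hstep).trans ?_)
      rw [← mul_add]
      refine mul_le_mul_of_nonneg_left ?_ (by positivity)
      rw [Finset.sum_insert hj, Finset.sum_insert hj, add_left_comm, ← Finset.sum_add_distrib]
      refine add_le_add ?_ (Finset.sum_le_sum fun k hk => ?_)
      · refine le_mul_of_one_le_right (h0 _) ?_
        exact_mod_cast Finset.card_pos.2 ⟨j, by simp⟩
      · rw [Finset.filter_insert, if_pos (hmin k hk), Finset.card_insert_of_notMem (by simp [hj])]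
        push_cast
        linarith
  refine hbound.trans (mul_le_mul_of_nonneg_left ?_ (by positivity))
  refine (Finset.sum_le_sum fun k _ => ?_).trans (sum_le_rateTail h0 hs T i hT)
  exact mul_le_mul_of_nonneg_left (card_filter_norm_sub_le T i (norm_nonneg _)) (h0 _)

end IsMixingField

lemma integral_abs_le_sqrt {Ω : Type*} [MeasurableSpace Ω] {P : Measure Ω} [IsProbabilityMeasure P]
    {X : Ω → ℝ} (h1 : Integrable X P) (h2 : Integrable (fun ω => X ω ^ 2) P) :
    ∫ ω, |X ω| ∂P ≤ √(∫ ω, X ω ^ 2 ∂P) := by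
  set c := ∫ ω, |X ω| ∂P with hc
  have h : 0 ≤ ∫ ω, (X ω ^ 2 - 2 * c * |X ω| + c ^ 2) ∂P := integral_nonneg fun ω => by
    have : X ω ^ 2 - 2 * c * |X ω| + c ^ 2 = (|X ω| - c) ^ 2 := by rw [← sq_abs (X ω)]; ring
    rw [Pi.zero_apply, this]
    positivity
  have h3 : Integrable (fun ω => X ω ^ 2 - 2 * c * |X ω|) P := h2.sub (h1.abs.const_mul _)
  rw [integral_add h3 (integrable_const _),
    integral_sub h2 (h1.abs.const_mul _), integral_const_mul, ← hc] at h
  simp only [integral_const, probReal_univ, smul_eq_mul, one_mul] at h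
  exact Real.le_sqrt_of_sq_le (by nlinarith)

/-- The sites of `Γ` within distance `R` of `i`. -/
def near {d : ℕ} (Γ : Finset (Fin d → ℤ)) (R : ℕ) (i : Fin d → ℤ) : Finset (Fin d → ℤ) :=
  Γ.filter fun j => ‖j - i‖ ≤ R

lemma card_near_le {d : ℕ} (Γ : Finset (Fin d → ℤ)) (R : ℕ) (i : Fin d → ℤ) :
    ((near Γ R i).card : ℝ) ≤ (2 * R + 1) ^ d :=
  card_filter_norm_sub_le Γ i (Nat.cast_nonneg R)

lemma self_mem_near {d : ℕ} {Γ : Finset (Fin d → ℤ)} (R : ℕ) {i : Fin d → ℤ} (hi : i ∈ Γ) :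
    i ∈ near Γ R i := by
  simp [near, hi]

lemma sum_sum_near_le {d : ℕ} (Γ : Finset (Fin d → ℤ)) (R : ℕ) {a : (Fin d → ℤ) → ℝ}
    (ha : ∀ k, 0 ≤ a k) :
    ∑ i ∈ Γ, ∑ k ∈ near Γ R i, a k ≤ (2 * R + 1) ^ d * ∑ k ∈ Γ, a k := by
  have e : ∑ i ∈ Γ, ∑ k ∈ near Γ R i, a k = ∑ k ∈ Γ, ((near Γ R k).card : ℝ) * a k := by
    simp only [near, Finset.sum_filter]
    rw [Finset.sum_comm]
    refine Finset.sum_congr rfl fun k _ => ?_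
    rw [← Finset.sum_filter, Finset.sum_const, nsmul_eq_mul]
    simp_rw [norm_sub_rev k]
  rw [e, Finset.mul_sum]
  exact Finset.sum_le_sum fun k _ => mul_le_mul_of_nonneg_right (card_near_le Γ R k) (ha k)

lemma sum_sum_rate_le {d : ℕ} {ρ : (Fin d → ℤ) → ℝ} (h0 : ∀ k, 0 ≤ ρ k) (hs : Summable ρ)
    (Γ : Finset (Fin d → ℤ)) :
    ∑ k ∈ Γ, ∑ l ∈ Γ, ρ (l - k) ≤ Γ.card * ∑' k, ρ k := by
  classical
  rw [← nsmul_eq_mul, ← Finset.sum_const]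
  refine Finset.sum_le_sum fun k _ => ?_
  rw [← Finset.sum_image (f := ρ) (g := fun l => l - k) fun x _ y _ hxy => sub_left_injective hxy]
  exact hs.sum_le_tsum _ fun k _ => h0 k

/-- The local quadratic form approximating the square of a sum of the field. -/
def localSq {d : ℕ} {Ω : Type*} (Y : (Fin d → ℤ) → Ω → ℝ) (Γ : Finset (Fin d → ℤ))

    (R : ℕ) (ω : Ω) : ℝ :=
  ∑ i ∈ Γ, Y i ω * ∑ j ∈ near Γ R i, Y j ω

lemma localSq_sq {d : ℕ} {Ω : Type*} (Y : (Fin d → ℤ) → Ω → ℝ) (Γ : Finset (Fin d → ℤ))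
    (R : ℕ) (ω : Ω) :
    localSq Y Γ R ω ^ 2 = ∑ i ∈ Γ, ∑ j ∈ Γ, (Y i ω * ∑ k ∈ near Γ R i, Y k ω) *
      (Y j ω * ∑ k ∈ near Γ R j, Y k ω) := by
  rw [localSq, sq, Finset.sum_mul_sum]

namespace IsMixingField

variable {d : ℕ} {Ω : Type*} [MeasurableSpace Ω] {P : Measure Ω} [IsProbabilityMeasure P]
  {Y : (Fin d → ℤ) → Ω → ℝ} {ρ : (Fin d → ℤ) → ℝ} {C B : ℝ}

lemma abs_sum_le {u : (Fin d → ℤ) → ℝ} (hu : ∀ h, |u h| ≤ B) (T : Finset (Fin d → ℤ)) :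
    |∑ j ∈ T, u j| ≤ T.card * B := by
  refine (Finset.abs_sum_le_sum_abs _ _).trans ?_
  rw [← nsmul_eq_mul, ← Finset.sum_const]
  exact Finset.sum_le_sum fun j _ => hu j

lemma abs_sum_near_le (hB : 0 ≤ B) {u : (Fin d → ℤ) → ℝ} (hu : ∀ h, |u h| ≤ B)
    (Γ : Finset (Fin d → ℤ)) (R : ℕ) (i : Fin d → ℤ) :
    |∑ j ∈ near Γ R i, u j| ≤ (2 * R + 1) ^ d * B :=
  (abs_sum_le hu _).trans (mul_le_mul_of_nonneg_right (card_near_le Γ R i) hB)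

lemma integrable_real (hY : IsMixingField P Y ρ C B) {f : ((Fin d → ℤ) → ℝ) → ℝ}
    (hf : Continuous f) {c : ℝ} (hc : ∀ u, (∀ h, |u h| ≤ B) → |f u| ≤ c) :
    Integrable (fun ω => f fun h => Y h ω) P :=
  Integrable.of_bound
    (hf.measurable.comp (measurable_pi_lambda _ hY.meas)).aestronglyMeasurable c
    (ae_of_all _ fun ω => hc _ fun h => hY.bound h ω)

lemma integrable_mul_expi (hY : IsMixingField P Y ρ C B) {f : ((Fin d → ℤ) → ℝ) → ℝ}
    (hf : Continuous f) {c : ℝ} (hc : ∀ u, (∀ h, |u h| ≤ B) → |f u| ≤ c) (t : ℝ)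
    (T : Finset (Fin d → ℤ)) :
    Integrable (fun ω => (f fun h => Y h ω : ℂ) * expi (t * ∑ j ∈ T, Y j ω)) P :=
  hY.integrable_comp (f := fun u => (f u : ℂ) * expi (t * ∑ j ∈ T, u j)) (by fun_prop) (c := c)
    fun u hu => by simpa [norm_expi] using hc u hu

/-- One summand of the derivative of the characteristic function, localized. -/
lemma norm_integral_mul_expi_sub_le (hY : IsMixingField P Y ρ C B)
    (hs : Summable fun k => ρ k * (2 * ‖k‖ + 1) ^ d) (Γ : Finset (Fin d → ℤ)) (R : ℕ)
    (i : Fin d → ℤ) (t : ℝ) :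
    ‖∫ ω, (Y i ω : ℂ) * expi (t * ∑ j ∈ Γ, Y j ω) ∂P - Complex.I * t *
      ∫ ω, ((Y i ω * ∑ j ∈ near Γ R i, Y j ω : ℝ) : ℂ) * expi (t * ∑ j ∈ Γ, Y j ω) ∂P‖ ≤
    3 * B * t ^ 2 * ((2 * R + 1) ^ d * B) ^ 2 + C * B * (|t| * B) * rateTail ρ R := by
  have hB := hY.bound_nonneg
  let far := Γ.filter fun j => ¬ ‖j - i‖ ≤ R
  have hfar := hY.norm_integral_mul_expi_far_le hs i t (R := R) far fun j hj =>
    not_le.1 (Finset.mem_filter.1 hj).2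
  have hsplit : ∀ ω, ∑ j ∈ Γ, Y j ω = ∑ j ∈ near Γ R i, Y j ω + ∑ j ∈ far, Y j ω := fun ω =>
    (Finset.sum_filter_add_sum_filter_not _ _ _).symm
  have i1 := hY.integrable_mul_expi (f := fun u => u i) (by fun_prop) (fun u hu => hu i) t Γ
  have i2 := hY.integrable_mul_expi (f := fun u => u i * ∑ j ∈ near Γ R i, u j) (by fun_prop)
    (c := B * ((2 * R + 1) ^ d * B)) (fun u hu => by
      rw [abs_mul]
      exact mul_le_mul (hu i) (abs_sum_near_le hB hu Γ R i) (abs_nonneg _) hB) t Γ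
  have i3 := hY.integrable_mul_expi (f := fun u => u i) (by fun_prop) (fun u hu => hu i) t far
  dsimp only at i1 i2 i3
  have hdiff : ‖∫ ω, ((Y i ω : ℂ) * expi (t * ∑ j ∈ Γ, Y j ω) - Complex.I * t *
      (((Y i ω * ∑ j ∈ near Γ R i, Y j ω : ℝ) : ℂ) * expi (t * ∑ j ∈ Γ, Y j ω)) -
      (Y i ω : ℂ) * expi (t * ∑ j ∈ far, Y j ω)) ∂P‖ ≤
      3 * B * t ^ 2 * ((2 * R + 1) ^ d * B) ^ 2 := by
    refine (norm_integral_le_of_norm_le_const (ae_of_all _ fun ω => ?_)).trans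
      (by rw [probReal_univ, mul_one])
    set N := ∑ j ∈ near Γ R i, Y j ω with hN
    have hNb : |N| ≤ (2 * R + 1) ^ d * B := abs_sum_near_le hB (fun h => hY.bound h ω) Γ R i
    have e : expi (t * ∑ j ∈ far, Y j ω) = expi (-(t * N)) * expi (t * ∑ j ∈ Γ, Y j ω) := by
      rw [← expi_add, hsplit]
      congr 1
      ring
    have e2 : (Y i ω : ℂ) * expi (t * ∑ j ∈ Γ, Y j ω) - Complex.I * t *
        (((Y i ω * N : ℝ) : ℂ) * expi (t * ∑ j ∈ Γ, Y j ω)) -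
        (Y i ω : ℂ) * expi (t * ∑ j ∈ far, Y j ω) =
        -((Y i ω : ℂ) * expi (t * ∑ j ∈ Γ, Y j ω) *
          (expi (-(t * N)) - 1 - Complex.I * ((-(t * N) : ℝ) : ℂ))) := by
      rw [e]
      push_cast
      ring
    rw [e2, norm_neg, norm_mul, norm_mul, norm_expi, mul_one, Complex.norm_real, Real.norm_eq_abs]
    have h1 : N ^ 2 ≤ ((2 * R + 1) ^ d * B) ^ 2 := sq_le_sq' (abs_le.1 hNb).1 (abs_le.1 hNb).2
    calc |Y i ω| * _ ≤ B * (3 * (-(t * N)) ^ 2) :=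
          mul_le_mul (hY.bound i ω) (norm_expi_sub_one_sub_le _) (norm_nonneg _) hB
      _ = 3 * B * t ^ 2 * N ^ 2 := by ring
      _ ≤ _ := mul_le_mul_of_nonneg_left h1 (by positivity)
  have i4 : Integrable (fun ω => (Y i ω : ℂ) * expi (t * ∑ j ∈ Γ, Y j ω) - Complex.I * t *
      (((Y i ω * ∑ j ∈ near Γ R i, Y j ω : ℝ) : ℂ) * expi (t * ∑ j ∈ Γ, Y j ω))) P :=
    i1.sub (i2.const_mul _)
  rw [integral_sub i4 i3, integral_sub i1 (i2.const_mul _),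
    integral_const_mul] at hdiff
  calc _ ≤ _ + ‖∫ ω, (Y i ω : ℂ) * expi (t * ∑ j ∈ far, Y j ω) ∂P‖ :=
        norm_le_norm_sub_add _ _
    _ ≤ _ := add_le_add hdiff hfar

lemma abs_mul_near_le (hB : 0 ≤ B) {u : (Fin d → ℤ) → ℝ} (hu : ∀ h, |u h| ≤ B)
    (Γ : Finset (Fin d → ℤ)) (R : ℕ) (i : Fin d → ℤ) :
    |u i * ∑ j ∈ near Γ R i, u j| ≤ B * ((2 * R + 1) ^ d * B) := by
  rw [abs_mul]
  exact mul_le_mul (hu i) (abs_sum_near_le hB hu Γ R i) (abs_nonneg _) hB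

lemma integrable_mul_near (hY : IsMixingField P Y ρ C B) (Γ : Finset (Fin d → ℤ)) (R : ℕ)
    (i : Fin d → ℤ) : Integrable (fun ω => Y i ω * ∑ j ∈ near Γ R i, Y j ω) P :=
  hY.integrable_real (f := fun u => u i * ∑ j ∈ near Γ R i, u j) (by fun_prop)
    fun _ hu => abs_mul_near_le hY.bound_nonneg hu Γ R i

lemma integrable_mul_near_mul (hY : IsMixingField P Y ρ C B) (Γ : Finset (Fin d → ℤ)) (R : ℕ)
    (i j : Fin d → ℤ) : Integrable (fun ω => (Y i ω * ∑ k ∈ near Γ R i, Y k ω) *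
      (Y j ω * ∑ k ∈ near Γ R j, Y k ω)) P :=
  hY.integrable_real
    (f := fun u => (u i * ∑ k ∈ near Γ R i, u k) * (u j * ∑ k ∈ near Γ R j, u k)) (by fun_prop)
    (c := B * ((2 * R + 1) ^ d * B) * (B * ((2 * R + 1) ^ d * B)))
    fun _ hu => by
      have hB := hY.bound_nonneg
      rw [abs_mul]
      exact mul_le_mul (abs_mul_near_le hB hu Γ R i) (abs_mul_near_le hB hu Γ R j) (abs_nonneg _)
        (by positivity)

lemma integrable_localSq (hY : IsMixingField P Y ρ C B) (Γ : Finset (Fin d → ℤ)) (R : ℕ) :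
    Integrable (localSq Y Γ R) P :=
  integrable_finsetSum _ fun i _ => hY.integrable_mul_near Γ R i

lemma integrable_localSq_sq (hY : IsMixingField P Y ρ C B) (Γ : Finset (Fin d → ℤ)) (R : ℕ) :
    Integrable (fun ω => localSq Y Γ R ω ^ 2) P := by
  simp_rw [localSq_sq]
  exact integrable_finsetSum _ fun i _ => integrable_finsetSum _ fun j _ =>
    hY.integrable_mul_near_mul Γ R i j

lemma integral_localSq_sub_sq_le (hY : IsMixingField P Y ρ C B) (hs : Summable ρ)
    (Γ : Finset (Fin d → ℤ)) (R : ℕ) :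
    ∫ ω, (localSq Y Γ R ω - ∫ ω', localSq Y Γ R ω' ∂P) ^ 2 ∂P ≤
      C * (B * ((2 * R + 1) ^ d * B)) ^ 2 * ((2 * R + 1) ^ d) ^ 2 * (∑' k, ρ k) * Γ.card := by
  have hB := hY.bound_nonneg
  have hC := hY.const_nonneg
  have h0 := hY.rate_nonneg
  set m : ℝ := (2 * R + 1) ^ d with hm
  have hm0 : 0 ≤ m := by positivity
  set q := ∫ ω', localSq Y Γ R ω' ∂P with hq
  have e1 : ∫ ω, (localSq Y Γ R ω - q) ^ 2 ∂P = ∫ ω, localSq Y Γ R ω ^ 2 ∂P - q ^ 2 := by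
    have : ∀ ω, (localSq Y Γ R ω - q) ^ 2 =
        localSq Y Γ R ω ^ 2 - 2 * q * localSq Y Γ R ω + q ^ 2 := fun ω => by ring
    simp_rw [this]
    have h3 : Integrable (fun ω => localSq Y Γ R ω ^ 2 - 2 * q * localSq Y Γ R ω) P :=
      (hY.integrable_localSq_sq Γ R).sub ((hY.integrable_localSq Γ R).const_mul _)
    rw [integral_add h3 (integrable_const _),
      integral_sub (hY.integrable_localSq_sq Γ R) ((hY.integrable_localSq Γ R).const_mul _),
      integral_const_mul, ← hq]
    simp only [integral_const, probReal_univ, smul_eq_mul, one_mul]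
    ring
  have e2 : q ^ 2 = ∑ i ∈ Γ, ∑ j ∈ Γ, (∫ ω, Y i ω * ∑ k ∈ near Γ R i, Y k ω ∂P) *
      ∫ ω, Y j ω * ∑ k ∈ near Γ R j, Y k ω ∂P := by
    rw [hq]
    simp only [localSq]
    rw [integral_finsetSum _ fun i _ => hY.integrable_mul_near Γ R i, sq, Finset.sum_mul_sum]
  rw [e1, e2]
  simp_rw [localSq_sq]
  rw [integral_finsetSum _ fun i _ => integrable_finsetSum _ fun j _ =>
    hY.integrable_mul_near_mul Γ R i j, ← Finset.sum_sub_distrib]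
  calc _ ≤ ∑ i ∈ Γ, ∑ j ∈ Γ, C * (B * (m * B)) * (B * (m * B)) *
        ∑ k ∈ near Γ R i, ∑ l ∈ near Γ R j, ρ (l - k) := by
        refine Finset.sum_le_sum fun i hi => ?_
        rw [integral_finsetSum _ fun j _ => hY.integrable_mul_near_mul Γ R i j,
          ← Finset.sum_sub_distrib]
        refine Finset.sum_le_sum fun j hj => le_trans (le_abs_self _) ?_
        have dep : ∀ i ∈ Γ, DependsOn (fun u : (Fin d → ℤ) → ℝ => u i * ∑ j ∈ near Γ R i, u j)
            (near Γ R i : Set (Fin d → ℤ)) := fun i hi u v huv => by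
          have e : ∑ k ∈ near Γ R i, u k = ∑ k ∈ near Γ R i, v k :=
            Finset.sum_congr rfl fun k hk => huv k hk
          simp only [e, huv i (self_mem_near R hi)]
        exact hY.mix_real (near Γ R i) (near Γ R j)
          (f := fun u => u i * ∑ k ∈ near Γ R i, u k)
          (g := fun u => u j * ∑ k ∈ near Γ R j, u k) (by fun_prop) (by fun_prop)
          (fun _ hu => abs_mul_near_le hB hu Γ R i) (fun _ hu => abs_mul_near_le hB hu Γ R j)
          (dep i hi) (dep j hj)
    _ = C * (B * (m * B)) ^ 2 *
        ∑ i ∈ Γ, ∑ k ∈ near Γ R i, ∑ j ∈ Γ, ∑ l ∈ near Γ R j, ρ (l - k) := by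
        rw [mul_assoc C, ← sq, Finset.mul_sum]
        refine Finset.sum_congr rfl fun i _ => ?_
        rw [← Finset.mul_sum, Finset.sum_comm]
    _ ≤ C * (B * (m * B)) ^ 2 * (m * ∑ k ∈ Γ, (m * ∑ l ∈ Γ, ρ (l - k))) := by
        refine mul_le_mul_of_nonneg_left ?_ (by positivity)
        refine (sum_sum_near_le Γ R fun k => Finset.sum_nonneg fun j _ =>
          Finset.sum_nonneg fun l _ => h0 _).trans (mul_le_mul_of_nonneg_left ?_ hm0)
        exact Finset.sum_le_sum fun k _ => sum_sum_near_le Γ R fun l => h0 _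
    _ = C * (B * (m * B)) ^ 2 * m ^ 2 * ∑ k ∈ Γ, ∑ l ∈ Γ, ρ (l - k) := by
        rw [← Finset.mul_sum]
        ring
    _ ≤ C * (B * (m * B)) ^ 2 * m ^ 2 * (Γ.card * ∑' k, ρ k) :=
        mul_le_mul_of_nonneg_left (sum_sum_rate_le h0 hs Γ) (by positivity)
    _ = _ := by ring

lemma abs_integral_sq_sub_localSq_le (hY : IsMixingField P Y ρ C B)
    (hs : Summable fun k => ρ k * (2 * ‖k‖ + 1) ^ d) (Γ : Finset (Fin d → ℤ)) (R : ℕ) :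
    |∫ ω, (∑ j ∈ Γ, Y j ω) ^ 2 ∂P - ∫ ω, localSq Y Γ R ω ∂P| ≤
      Γ.card * (C * B * B * rateTail ρ R) := by
  have hB := hY.bound_nonneg
  have hC := hY.const_nonneg
  have h0 := hY.rate_nonneg
  let far := fun i => Γ.filter fun j => ¬ ‖j - i‖ ≤ R
  have int2 : ∀ i j, Integrable (fun ω => Y i ω * Y j ω) P := fun i j =>
    hY.integrable_real (f := fun u => u i * u j) (by fun_prop) (c := B * B) fun u hu => by
      rw [abs_mul]
      exact mul_le_mul (hu i) (hu j) (abs_nonneg _) hB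
  have e : ∀ ω, (∑ j ∈ Γ, Y j ω) ^ 2 =
      localSq Y Γ R ω + ∑ i ∈ Γ, ∑ j ∈ far i, Y i ω * Y j ω := fun ω => by
    rw [localSq, ← Finset.sum_add_distrib, sq, Finset.sum_mul]
    refine Finset.sum_congr rfl fun i _ => ?_
    rw [← Finset.mul_sum, ← mul_add]
    congr 1
    exact (Finset.sum_filter_add_sum_filter_not _ _ _).symm
  simp_rw [e]
  rw [integral_add (hY.integrable_localSq Γ R) (integrable_finsetSum _ fun i _ =>
    integrable_finsetSum _ fun j _ => int2 i j), add_sub_cancel_left,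
    integral_finsetSum _ fun i _ => integrable_finsetSum _ fun j _ => int2 i j,
    ← nsmul_eq_mul, ← Finset.sum_const]
  refine (Finset.abs_sum_le_sum_abs _ _).trans (Finset.sum_le_sum fun i _ => ?_)
  rw [integral_finsetSum _ fun j _ => int2 i j]
  refine (Finset.abs_sum_le_sum_abs _ _).trans ?_
  calc _ ≤ ∑ j ∈ far i, C * B * B * (ρ (j - i) * (2 * ‖j - i‖ + 1) ^ d) := by
        refine Finset.sum_le_sum fun j _ => ?_
        have := hY.mix_real {i} {j} (f := fun u => u i) (g := fun u => u j) (by fun_prop)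
          (by fun_prop) (fun u hu => hu i) (fun u hu => hu j) (fun u v huv => huv i (by simp))
          (fun u v huv => huv j (by simp))
        rw [hY.mean i, zero_mul, sub_zero, Finset.sum_singleton, Finset.sum_singleton] at this
        refine this.trans (mul_le_mul_of_nonneg_left ?_ (by positivity))
        refine le_mul_of_one_le_right (h0 _) (one_le_pow₀ ?_)
        linarith [norm_nonneg (j - i)]
    _ ≤ _ := by
        rw [← Finset.mul_sum]
        exact mul_le_mul_of_nonneg_left (sum_le_rateTail h0 hs _ i fun j hj =>
          not_le.1 (Finset.mem_filter.1 hj).2) (by positivity)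

/-- The characteristic function of a sum of the field nearly solves the Gaussian equation. -/
lemma norm_integral_sum_mul_expi_sub_le (hY : IsMixingField P Y ρ C B)
    (hs : Summable fun k => ρ k * (2 * ‖k‖ + 1) ^ d) (hs' : Summable ρ)
    (Γ : Finset (Fin d → ℤ)) (R : ℕ) (t : ℝ) :
    ‖∫ ω, ((∑ j ∈ Γ, Y j ω : ℝ) : ℂ) * expi (t * ∑ j ∈ Γ, Y j ω) ∂P - Complex.I * t *
      ((∫ ω, (∑ j ∈ Γ, Y j ω) ^ 2 ∂P : ℝ) : ℂ) * ∫ ω, expi (t * ∑ j ∈ Γ, Y j ω) ∂P‖ ≤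
    Γ.card * (3 * B * t ^ 2 * ((2 * R + 1) ^ d * B) ^ 2 + C * B * (|t| * B) * rateTail ρ R) +
      |t| * √(C * (B * ((2 * R + 1) ^ d * B)) ^ 2 * ((2 * R + 1) ^ d) ^ 2 * (∑' k, ρ k) * Γ.card) +
      |t| * (Γ.card * (C * B * B * rateTail ρ R)) := by
  have hB := hY.bound_nonneg
  set e := fun ω => expi (t * ∑ j ∈ Γ, Y j ω) with he
  set q := ∫ ω, localSq Y Γ R ω ∂P with hq
  have ie : Integrable e P := by
    simpa using hY.integrable_mul_expi (f := fun _ => 1) (by fun_prop) (c := 1) (by simp) t Γ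
  have iY : ∀ i, Integrable (fun ω => (Y i ω : ℂ) * e ω) P := fun i =>
    hY.integrable_mul_expi (f := fun u => u i) (by fun_prop) (fun u hu => hu i) t Γ
  have iN : ∀ i, Integrable (fun ω => ((Y i ω * ∑ j ∈ near Γ R i, Y j ω : ℝ) : ℂ) * e ω) P :=
    fun i => hY.integrable_mul_expi (f := fun u => u i * ∑ j ∈ near Γ R i, u j) (by fun_prop)
      (fun _ hu => abs_mul_near_le hB hu Γ R i) t Γ
  have eS : ∫ ω, ((∑ j ∈ Γ, Y j ω : ℝ) : ℂ) * e ω ∂P = ∑ i ∈ Γ, ∫ ω, (Y i ω : ℂ) * e ω ∂P := by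
    rw [← integral_finsetSum _ fun i _ => iY i]
    refine integral_congr_ae (ae_of_all _ fun ω => ?_)
    dsimp only
    rw [Complex.ofReal_sum, Finset.sum_mul]
  have eQ' : ∀ ω, (localSq Y Γ R ω : ℂ) * e ω =
      ∑ i ∈ Γ, ((Y i ω * ∑ j ∈ near Γ R i, Y j ω : ℝ) : ℂ) * e ω := fun ω => by
    rw [localSq, Complex.ofReal_sum, Finset.sum_mul]
  have iQ : Integrable (fun ω => (localSq Y Γ R ω : ℂ) * e ω) P := by
    simp_rw [eQ']
    exact integrable_finsetSum _ fun i _ => iN i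
  have eQ : ∫ ω, (localSq Y Γ R ω : ℂ) * e ω ∂P =
      ∑ i ∈ Γ, ∫ ω, ((Y i ω * ∑ j ∈ near Γ R i, Y j ω : ℝ) : ℂ) * e ω ∂P := by
    rw [← integral_finsetSum _ fun i _ => iN i]
    exact integral_congr_ae (ae_of_all _ eQ')
  have b1 : ‖∫ ω, ((∑ j ∈ Γ, Y j ω : ℝ) : ℂ) * e ω ∂P -
      Complex.I * t * ∫ ω, (localSq Y Γ R ω : ℂ) * e ω ∂P‖ ≤ Γ.card *
      (3 * B * t ^ 2 * ((2 * R + 1) ^ d * B) ^ 2 + C * B * (|t| * B) * rateTail ρ R) := by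
    rw [eS, eQ, Finset.mul_sum, ← Finset.sum_sub_distrib, ← nsmul_eq_mul, ← Finset.sum_const]
    exact (norm_sum_le _ _).trans (Finset.sum_le_sum fun i _ =>
      hY.norm_integral_mul_expi_sub_le hs Γ R i t)
  have hQi := (hY.integrable_localSq Γ R).sub (integrable_const q)
  have hQ2 : Integrable (fun ω => (localSq Y Γ R ω - q) ^ 2) P := by
    have : ∀ ω, (localSq Y Γ R ω - q) ^ 2 =
        localSq Y Γ R ω ^ 2 - 2 * q * localSq Y Γ R ω + q ^ 2 := fun ω => by ring
    simp_rw [this]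
    exact ((hY.integrable_localSq_sq Γ R).sub ((hY.integrable_localSq Γ R).const_mul _)).add
      (integrable_const _)
  have b2 : ‖Complex.I * t * ∫ ω, (localSq Y Γ R ω : ℂ) * e ω ∂P -
      Complex.I * t * (q : ℂ) * ∫ ω, e ω ∂P‖ ≤ |t| * √(C * (B * ((2 * R + 1) ^ d * B)) ^ 2 *
        ((2 * R + 1) ^ d) ^ 2 * (∑' k, ρ k) * Γ.card) := by
    rw [mul_assoc (Complex.I * t), ← mul_sub, norm_mul, ← integral_const_mul,
      ← integral_sub iQ (ie.const_mul _)]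
    simp only [norm_mul, Complex.norm_I, one_mul, Complex.norm_real, Real.norm_eq_abs]
    refine mul_le_mul_of_nonneg_left ?_ (abs_nonneg _)
    calc _ ≤ ∫ ω, ‖(localSq Y Γ R ω : ℂ) * e ω - (q : ℂ) * e ω‖ ∂P :=
          norm_integral_le_integral_norm _
      _ = ∫ ω, |localSq Y Γ R ω - q| ∂P := by
          refine integral_congr_ae (ae_of_all _ fun ω => ?_)
          dsimp only
          rw [← sub_mul, norm_mul, norm_expi, mul_one, ← Complex.ofReal_sub, Complex.norm_real,
            Real.norm_eq_abs]
      _ ≤ √(∫ ω, (localSq Y Γ R ω - q) ^ 2 ∂P) := integral_abs_le_sqrt hQi hQ2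
      _ ≤ _ := Real.sqrt_le_sqrt (hY.integral_localSq_sub_sq_le hs' Γ R)
  have b3 : ‖Complex.I * t * (q : ℂ) * ∫ ω, e ω ∂P - Complex.I * t *
      ((∫ ω, (∑ j ∈ Γ, Y j ω) ^ 2 ∂P : ℝ) : ℂ) * ∫ ω, e ω ∂P‖ ≤
      |t| * (Γ.card * (C * B * B * rateTail ρ R)) := by
    rw [← sub_mul, ← mul_sub, ← Complex.ofReal_sub]
    simp only [norm_mul, Complex.norm_I, one_mul, Complex.norm_real, Real.norm_eq_abs]
    have hn : ‖∫ ω, e ω ∂P‖ ≤ 1 := by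
      refine (norm_integral_le_of_norm_le_const (C := 1) (ae_of_all _ fun ω => ?_)).trans (by simp)
      exact (norm_expi _).le
    rw [mul_assoc]
    refine mul_le_mul_of_nonneg_left ?_ (abs_nonneg _)
    have := hY.abs_integral_sq_sub_localSq_le hs Γ R
    rw [abs_sub_comm] at this
    exact (mul_le_of_le_one_right (abs_nonneg _) hn).trans this
  exact (norm_sub_le_norm_sub_add_norm_sub _ _ _).trans (add_le_add
    ((norm_sub_le_norm_sub_add_norm_sub _ _ _).trans (add_le_add b1 b2)) b3)

end IsMixingField

/-- A characteristic function nearly solving the Gaussian equation is nearly Gaussian. -/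
lemma norm_integral_expi_sub_exp_le {Ω : Type*} [MeasurableSpace Ω] {P : Measure Ω}
    [IsProbabilityMeasure P] {S : Ω → ℝ} (hS : AEStronglyMeasurable S P) {M : ℝ}
    (hM : ∀ ω, |S ω| ≤ M) {s : ℝ} (hs : 0 ≤ s) {T ε : ℝ}
    (h : ∀ t, |t| ≤ |T| → ‖∫ ω, (S ω : ℂ) * expi (t * S ω) ∂P -
      Complex.I * t * (s : ℂ) * ∫ ω, expi (t * S ω) ∂P‖ ≤ ε) :
    ‖∫ ω, expi (T * S ω) ∂P - Complex.exp ((-(T ^ 2 * s / 2) : ℝ) : ℂ)‖ ≤ |T| * ε := by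
  set φ := fun t : ℝ => ∫ ω, expi (t * S ω) ∂P with hφ
  have hmeas : ∀ t : ℝ, AEStronglyMeasurable (fun ω => expi (t * S ω)) P := fun t =>
    continuous_expi.comp_aestronglyMeasurable (hS.const_mul t)
  have hd : ∀ t, HasDerivAt φ (Complex.I * ∫ ω, (S ω : ℂ) * expi (t * S ω) ∂P) t := fun t => by
    rw [← integral_const_mul]
    refine (hasDerivAt_integral_of_dominated_loc_of_deriv_le (bound := fun _ => M)
      (F := fun t ω => expi (t * S ω))
      (F' := fun t ω => Complex.I * ((S ω : ℂ) * expi (t * S ω))) Filter.univ_mem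
      (Eventually.of_forall hmeas) ?_ ?_ ?_ (integrable_const _) ?_).2
    · exact Integrable.of_bound (hmeas t) 1 (ae_of_all _ fun ω => (norm_expi _).le)
    · exact ((Complex.continuous_ofReal.comp_aestronglyMeasurable hS).mul (hmeas t)).const_mul _
    · refine ae_of_all _ fun ω x _ => ?_
      simpa [norm_expi] using hM ω
    · refine ae_of_all _ fun ω x _ => ?_
      have h1 : HasDerivAt (fun x : ℝ => Complex.I * ((x * S ω : ℝ) : ℂ))
          (Complex.I * (S ω : ℂ)) x := by
        have := ((hasDerivAt_id x).mul_const (S ω)).ofReal_comp.const_mul Complex.I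
        simpa using this
      refine h1.cexp.congr_deriv ?_
      simp only [expi]
      ring
  set ψ := fun t : ℝ => φ t * Complex.exp ((t ^ 2 * s / 2 : ℝ) : ℂ) with hψ
  have hdψ : ∀ t, HasDerivAt ψ ((Complex.I * ∫ ω, (S ω : ℂ) * expi (t * S ω) ∂P + t * s * φ t) *
      Complex.exp ((t ^ 2 * s / 2 : ℝ) : ℂ)) t := fun t => by
    have h1 : HasDerivAt (fun t : ℝ => ((t ^ 2 * s / 2 : ℝ) : ℂ)) ((t * s : ℝ) : ℂ) t := by
      have := ((((hasDerivAt_id t).pow 2).mul_const s).div_const 2).ofReal_comp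
      refine this.congr_deriv ?_
      congr 1
      simp
      ring
    refine ((hd t).mul h1.cexp).congr_deriv ?_
    push_cast
    ring
  have hε : 0 ≤ ε := (norm_nonneg _).trans (h T le_rfl)
  have key := (convex_Icc (-|T|) |T|).norm_image_sub_le_of_norm_hasDerivWithin_le
    (f := ψ) (C := ε * Real.exp (T ^ 2 * s / 2)) (x := 0) (y := T)
    (fun t _ => (hdψ t).hasDerivWithinAt) (fun t ht => by
      have ht' : |t| ≤ |T| := abs_le.2 ht
      rw [norm_mul, ← Complex.ofReal_exp, Complex.norm_real, Real.norm_eq_abs, Real.abs_exp]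
      refine mul_le_mul ?_ ?_ (Real.exp_nonneg _) hε
      · refine le_trans (le_of_eq ?_) (h t ht')
        rw [← one_mul ‖_ - _‖, ← Complex.norm_I, ← norm_mul, mul_sub]
        congr 1
        have := Complex.I_mul_I
        linear_combination (t * s * φ t) * this
      · have := sq_le_sq.2 ht'
        gcongr) ⟨by simp, by simp⟩ ⟨neg_abs_le T, le_abs_self T⟩
  have h0 : ψ 0 = 1 := by simp [hψ, hφ, expi_zero]
  rw [h0, sub_zero, Real.norm_eq_abs] at key
  have e : ∫ ω, expi (T * S ω) ∂P - Complex.exp ((-(T ^ 2 * s / 2) : ℝ) : ℂ) =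
      (ψ T - 1) * Complex.exp ((-(T ^ 2 * s / 2) : ℝ) : ℂ) := by
    simp only [hψ]
    rw [sub_mul, mul_assoc, ← Complex.exp_add, ← Complex.ofReal_add, add_neg_cancel]
    simp [hφ]
  rw [e, norm_mul, ← Complex.ofReal_exp, Complex.norm_real, Real.norm_eq_abs, Real.abs_exp]
  calc _ ≤ ε * Real.exp (T ^ 2 * s / 2) * |T| * Real.exp (-(T ^ 2 * s / 2)) :=
        mul_le_mul_of_nonneg_right key (Real.exp_nonneg _)
    _ = |T| * ε * (Real.exp (T ^ 2 * s / 2) * Real.exp (-(T ^ 2 * s / 2))) := by ring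
    _ = _ := by rw [← Real.exp_add, add_neg_cancel, Real.exp_zero, mul_one]

/-- Normalized sums of a mixing field over finite sets of sites are asymptotically Gaussian. -/
theorem IsMixingField.tendsto_charFun_sub {d : ℕ} {Ω : Type*} [MeasurableSpace Ω] {P : Measure Ω}
    [IsProbabilityMeasure P] {Y : (Fin d → ℤ) → Ω → ℝ} {ρ : (Fin d → ℤ) → ℝ} {C B : ℝ}
    (hY : IsMixingField P Y ρ C B) (hs : Summable fun k => ρ k * (2 * ‖k‖ + 1) ^ d)
    (hs' : Summable ρ) {Γ : ℕ → Finset (Fin d → ℤ)} {v : ℕ → ℝ} (hv : Tendsto v atTop atTop)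
    (hΓ : ∀ n, ((Γ n).card : ℝ) ≤ v n) (t : ℝ) :
    Tendsto (fun n => ∫ ω, expi (t / √(v n) * ∑ j ∈ Γ n, Y j ω) ∂P -
      Complex.exp ((-((t / √(v n)) ^ 2 * (∫ ω, (∑ j ∈ Γ n, Y j ω) ^ 2 ∂P) / 2) : ℝ) : ℂ))
      atTop (𝓝 0) := by
  have hB := hY.bound_nonneg
  have hC := hY.const_nonneg
  have htail := fun R : ℕ => rateTail_nonneg hY.rate_nonneg R
  set Q : ℕ → ℝ := fun R =>
    C * (B * ((2 * R + 1) ^ d * B)) ^ 2 * ((2 * R + 1) ^ d) ^ 2 * (∑' k, ρ k) with hQ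
  set a : ℕ → ℝ := fun R => |t| ^ 3 * (3 * B * ((2 * R + 1) ^ d * B) ^ 2) + t ^ 2 * √(Q R) with ha
  have hQ0 : ∀ R, 0 ≤ Q R := fun R => mul_nonneg (by positivity) (tsum_nonneg hY.rate_nonneg)
  have bound : ∀ R n, 0 < v n → ‖∫ ω, expi (t / √(v n) * ∑ j ∈ Γ n, Y j ω) ∂P -
      Complex.exp ((-((t / √(v n)) ^ 2 * (∫ ω, (∑ j ∈ Γ n, Y j ω) ^ 2 ∂P) / 2) : ℝ) : ℂ)‖ ≤
      a R / √(v n) + 2 * t ^ 2 * C * B ^ 2 * rateTail ρ R := fun R n hvn => by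
    set w := √(v n)
    have hw0 : 0 < w := Real.sqrt_pos.2 hvn
    have hw2 : v n = w ^ 2 := (Real.sq_sqrt hvn.le).symm
    set m : ℝ := (2 * R + 1) ^ d
    have hm0 : 0 ≤ m := by positivity
    have hab : |t / w| = |t| / w := by rw [abs_div, abs_of_pos hw0]
    have hTR := htail R
    have hc := hΓ n
    rw [hw2] at hc
    clear hw2
    have hsq : √(Q R * (Γ n).card) ≤ √(Q R) * w := by
      rw [Real.sqrt_mul (hQ0 R)]
      exact mul_le_mul_of_nonneg_left (Real.sqrt_le_iff.2 ⟨hw0.le, hc⟩) (Real.sqrt_nonneg _)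
    have := norm_integral_expi_sub_exp_le (P := P) (S := fun ω => ∑ j ∈ Γ n, Y j ω) (T := t / w)
      (M := (Γ n).card * B) (s := ∫ ω, (∑ j ∈ Γ n, Y j ω) ^ 2 ∂P)
      (ε := w ^ 2 * (3 * B * (|t| / w) ^ 2 * (m * B) ^ 2 + C * B * (|t| / w * B) * rateTail ρ R) +
        |t| / w * (√(Q R) * w) + |t| / w * (w ^ 2 * (C * B * B * rateTail ρ R)))
      (Finset.measurable_sum _ fun j _ => hY.meas j).aestronglyMeasurable
      (fun ω => IsMixingField.abs_sum_le (fun h => hY.bound h ω) _)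
      (integral_nonneg fun ω => sq_nonneg _) fun u hu => by
        rw [hab] at hu
        refine (hY.norm_integral_sum_mul_expi_sub_le hs hs' (Γ n) R u).trans ?_
        have hu2 : u ^ 2 ≤ (|t| / w) ^ 2 := by
          rw [← sq_abs u]
          gcongr
        have hw' : 0 ≤ |t| / w := by positivity
        refine add_le_add (add_le_add (mul_le_mul hc (add_le_add ?_ ?_) ?_ (sq_nonneg w))
          (mul_le_mul hu hsq (Real.sqrt_nonneg _) hw')) (mul_le_mul hu ?_ ?_ hw')
        · exact mul_le_mul_of_nonneg_right (mul_le_mul_of_nonneg_left hu2 (by positivity))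
            (by positivity)
        · exact mul_le_mul_of_nonneg_right (mul_le_mul_of_nonneg_left
            (mul_le_mul_of_nonneg_right hu hB) (by positivity)) hTR
        · positivity
        · exact mul_le_mul_of_nonneg_right hc (by positivity)
        · positivity
    refine this.trans (le_of_eq ?_)
    rw [hab]
    rw [show a R = |t| ^ 3 * (3 * B * (m * B) ^ 2) + t ^ 2 * √(Q R) from rfl]
    rw [← sq_abs t]
    generalize √(Q R) = q
    generalize rateTail ρ R = r
    generalize |t| = u
    clear_value m w
    field_simp
    ring
  rw [Metric.tendsto_nhds]
  intro ε hε
  have hR : Tendsto (fun R : ℕ => 2 * t ^ 2 * C * B ^ 2 * rateTail ρ R) atTop (𝓝 0) := by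
    simpa using (tendsto_rateTail hY.rate_nonneg hs).const_mul (2 * t ^ 2 * C * B ^ 2)
  obtain ⟨R, hR⟩ := (hR.eventually_lt_const (half_pos hε)).exists
  have hn : Tendsto (fun n => a R / √(v n)) atTop (𝓝 0) :=
    tendsto_const_nhds.div_atTop (Real.tendsto_sqrt_atTop.comp hv)
  filter_upwards [hn.eventually_lt_const (half_pos hε), hv.eventually_gt_atTop 0] with n h1 h2
  rw [dist_zero_right]
  exact (bound R n h2).trans_lt (by linarith)

lemma summable_rate {d : ℕ} {b : ℝ} (hb : d < b) : Summable (rate (d := d) b) := by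
  let L := Submodule.span ℤ (Set.range (Pi.basisFun ℝ (Fin d)))
  have hL : Summable fun z : L => ‖z‖ ^ (-b) := by
    refine ZLattice.summable_norm_rpow L (-b) ?_
    rw [ZLattice.rank ℝ L, Module.finrank_fin_fun]
    linarith
  have hmem : ∀ h : Fin d → ℤ, (fun i => (h i : ℝ)) ∈ L := fun h => by
    rw [(Pi.basisFun ℝ (Fin d)).mem_span_iff_repr_mem ℤ]
    exact fun i => ⟨h i, by simp⟩
  have hinj : Function.Injective fun h : Fin d → ℤ => (⟨_, hmem h⟩ : L) := fun h h' e => by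
    funext i
    have := congrFun (congrArg Subtype.val e) i
    dsimp only at this
    exact_mod_cast this
  have hnorm : ∀ h : Fin d → ℤ, ‖fun i => (h i : ℝ)‖ = ‖h‖ := fun h => by
    simp [Pi.norm_def, nnnorm, Int.norm_eq_abs]
  refine (hL.comp_injective hinj).congr_cofinite ?_
  refine (Set.finite_singleton (0 : Fin d → ℤ)).subset fun h hh => ?_
  by_contra h0
  refine hh ?_
  simp [rate, max_eq_right (one_le_norm_of_ne_zero h0), hnorm]

lemma summable_rate_mul_pow {d : ℕ} {b : ℝ} (hb : 2 * d < b) :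
    Summable fun k : Fin d → ℤ => rate b k * (2 * ‖k‖ + 1) ^ d := by
  refine Summable.of_nonneg_of_le (fun k => mul_nonneg (rate_pos b k).le (by positivity))
    (fun k => ?_) ((summable_rate (d := d) (b := b - d) (by linarith)).mul_left (3 ^ d))
  have h1 : (0 : ℝ) < max 1 ‖k‖ := lt_max_of_lt_left one_pos
  have e : rate (b - d) k = rate b k * (max 1 ‖k‖) ^ d := by
    rw [rate, rate, ← Real.rpow_natCast, ← Real.rpow_add h1]
    congr 1
    ring
  rw [e, mul_left_comm, ← mul_pow]
  refine mul_le_mul_of_nonneg_left (pow_le_pow_left₀ (by positivity) ?_ d) (rate_pos b k).le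
  linarith [le_max_left 1 ‖k‖, le_max_right 1 ‖k‖]

/-- Truncation of a real number at level `a`. -/
def trunc (a x : ℝ) : ℝ := if |x| ≤ a then x else 0

lemma measurable_trunc (a : ℝ) : Measurable (trunc a) :=
  Measurable.ite (measurableSet_le (by fun_prop) measurable_const) measurable_id measurable_const

lemma abs_trunc_le {a : ℝ} (ha : 0 ≤ a) (x : ℝ) : |trunc a x| ≤ a := by
  unfold trunc
  split_ifs with h
  · exact h
  · simpa using ha

lemma abs_mul_sub_trunc_mul_le {a δ : ℝ} (ha : 0 < a) (hδ : 0 < δ) (x y : ℝ) :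
    |x * y - trunc a x * trunc a y| ≤ a ^ (-δ) * (|x| ^ (2 + δ) + |y| ^ (2 + δ)) := by
  have hx0 : 0 ≤ |x| ^ (2 + δ) := by positivity
  have hy0 : 0 ≤ |y| ^ (2 + δ) := by positivity
  have ha0 : 0 < a ^ (-δ) := by positivity
  by_cases hxy : |x| ≤ a ∧ |y| ≤ a
  · rw [trunc, trunc, if_pos hxy.1, if_pos hxy.2, sub_self, abs_zero]
    positivity
  · have h0 : trunc a x * trunc a y = 0 := by
      by_cases hx : |x| ≤ a
      · have hy : ¬ |y| ≤ a := fun hy => hxy ⟨hx, hy⟩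
        simp [trunc, hy]
      · simp [trunc, hx]
    rw [h0, sub_zero, abs_mul]
    set m := max |x| |y| with hm
    have hma : a < m := by
      by_contra hcon
      push Not at hcon
      exact hxy ⟨(le_max_left _ _).trans hcon, (le_max_right _ _).trans hcon⟩
    have hm0 : 0 < m := ha.trans hma
    have h1 : m ^ (2 + δ) ≤ |x| ^ (2 + δ) + |y| ^ (2 + δ) := by
      rcases max_cases |x| |y| with h | h <;> rw [hm, h.1] <;> linarith
    calc |x| * |y| ≤ m * m := mul_le_mul (le_max_left _ _) (le_max_right _ _) (abs_nonneg _) hm0.le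
      _ = m ^ (-δ) * m ^ (2 + δ) := by
          rw [← Real.rpow_add hm0, ← sq, ← Real.rpow_natCast]
          congr 1
          push_cast
          ring
      _ ≤ a ^ (-δ) * m ^ (2 + δ) := mul_le_mul_of_nonneg_right
          (Real.rpow_le_rpow_of_nonpos ha hma.le (by linarith)) (by positivity)
      _ ≤ _ := mul_le_mul_of_nonneg_left h1 ha0.le

lemma abs_le_one_add_rpow {p : ℝ} (hp : 1 ≤ p) (x : ℝ) : |x| ≤ 1 + |x| ^ p := by
  rcases le_or_gt |x| 1 with h | h
  · exact h.trans (le_add_of_nonneg_right (by positivity))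
  · have := Real.rpow_le_rpow_of_exponent_le h.le hp
    rw [Real.rpow_one] at this
    linarith

lemma sq_le_one_add_rpow {p : ℝ} (hp : 2 ≤ p) (x : ℝ) : x ^ 2 ≤ 1 + |x| ^ p := by
  rw [← sq_abs]
  rcases le_or_gt |x| 1 with h | h
  · exact (pow_le_one₀ (abs_nonneg x) h).trans (le_add_of_nonneg_right (by positivity))
  · have := Real.rpow_le_rpow_of_exponent_le h.le hp
    rw [Real.rpow_two] at this
    linarith

section

variable {Ω : Type*} [MeasurableSpace Ω] {P : Measure Ω}

lemma integrable_mul_of_sq {X Y : Ω → ℝ} (hX : AEStronglyMeasurable X P)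
    (hY : AEStronglyMeasurable Y P) (hX2 : Integrable (fun ω => X ω ^ 2) P)
    (hY2 : Integrable (fun ω => Y ω ^ 2) P) : Integrable (fun ω => X ω * Y ω) P :=
  (hX2.add hY2).mono' (hX.mul hY) (ae_of_all _ fun ω => by
    rw [Real.norm_eq_abs, abs_mul, Pi.add_apply, ← sq_abs (X ω), ← sq_abs (Y ω)]
    nlinarith [sq_nonneg (|X ω| - |Y ω|), sq_nonneg |X ω|, sq_nonneg |Y ω|])

variable [IsProbabilityMeasure P]

lemma integrable_of_rpow {p : ℝ} (hp : 1 ≤ p) {X : Ω → ℝ} (hX : AEStronglyMeasurable X P)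
    (h : Integrable (fun ω => |X ω| ^ p) P) : Integrable X P :=
  ((integrable_const 1).add h).mono' hX (ae_of_all _ fun _ => abs_le_one_add_rpow hp _)

lemma integrable_sq_of_rpow {p : ℝ} (hp : 2 ≤ p) {X : Ω → ℝ} (hX : AEStronglyMeasurable X P)
    (h : Integrable (fun ω => |X ω| ^ p) P) : Integrable (fun ω => X ω ^ 2) P :=
  ((integrable_const 1).add h).mono' (hX.pow 2) (ae_of_all _ fun ω => by
    rw [Real.norm_of_nonneg (sq_nonneg _)]
    exact sq_le_one_add_rpow hp _)

/-- Covariance inequality by truncation. -/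
lemma abs_cov_le_of_trunc {X Y : Ω → ℝ} (hX : Measurable X) (hY : Measurable Y) {δ : ℝ}
    (hδ : 0 < δ) (hXp : Integrable (fun ω => |X ω| ^ (2 + δ)) P)
    (hYp : Integrable (fun ω => |Y ω| ^ (2 + δ)) P)
    (hXY : ∫ ω, |Y ω| ^ (2 + δ) ∂P = ∫ ω, |X ω| ^ (2 + δ) ∂P) {a α : ℝ} (ha : 0 < a)
    (hα : |cov P (fun ω => trunc a (X ω)) (fun ω => trunc a (Y ω))| ≤ α * a ^ 2) :
    |cov P X Y| ≤ α * a ^ 2 + 4 * a ^ (-δ) * ∫ ω, |X ω| ^ (2 + δ) ∂P := by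
  set M := ∫ ω, |X ω| ^ (2 + δ) ∂P with hM
  have hX1 := integrable_of_rpow (by linarith) hX.aestronglyMeasurable hXp
  have hY1 := integrable_of_rpow (by linarith) hY.aestronglyMeasurable hYp
  have hXY1 := integrable_mul_of_sq hX.aestronglyMeasurable hY.aestronglyMeasurable
    (integrable_sq_of_rpow (by linarith) hX.aestronglyMeasurable hXp)
    (integrable_sq_of_rpow (by linarith) hY.aestronglyMeasurable hYp)
  have hTX : Integrable (fun ω => trunc a (X ω)) P :=
    Integrable.of_bound ((measurable_trunc a).comp hX).aestronglyMeasurable a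
      (ae_of_all _ fun ω => abs_trunc_le ha.le _)
  have hTY : Integrable (fun ω => trunc a (Y ω)) P :=
    Integrable.of_bound ((measurable_trunc a).comp hY).aestronglyMeasurable a
      (ae_of_all _ fun ω => abs_trunc_le ha.le _)
  have hTXY : Integrable (fun ω => trunc a (X ω) * trunc a (Y ω)) P :=
    hTY.bdd_mul hTX.1 (c := a) (ae_of_all _ fun ω => abs_trunc_le ha.le _)
  have b1 : |∫ ω, (X ω * Y ω - trunc a (X ω) * trunc a (Y ω)) ∂P| ≤ 2 * a ^ (-δ) * M := by
    rw [← Real.norm_eq_abs]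
    refine (norm_integral_le_of_norm_le ((hXp.add hYp).const_mul (a ^ (-δ)))
      (ae_of_all _ fun ω => abs_mul_sub_trunc_mul_le ha hδ (X ω) (Y ω))).trans (le_of_eq ?_)
    rw [integral_const_mul, integral_add' hXp hYp, hXY]
    ring
  have b2 : |∫ z, (X z.1 * Y z.2 - trunc a (X z.1) * trunc a (Y z.2)) ∂(P.prod P)| ≤
      2 * a ^ (-δ) * M := by
    have i1 : Integrable (fun z : Ω × Ω => |X z.1| ^ (2 + δ)) (P.prod P) := hXp.comp_fst P
    have i2 : Integrable (fun z : Ω × Ω => |Y z.2| ^ (2 + δ)) (P.prod P) := hYp.comp_snd P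
    rw [← Real.norm_eq_abs]
    refine (norm_integral_le_of_norm_le ((i1.add i2).const_mul (a ^ (-δ)))
      (ae_of_all _ fun z => abs_mul_sub_trunc_mul_le ha hδ (X z.1) (Y z.2))).trans (le_of_eq ?_)
    rw [integral_const_mul, integral_add' i1 i2, integral_fun_fst (fun ω => |X ω| ^ (2 + δ)),
      integral_fun_snd (fun ω => |Y ω| ^ (2 + δ)), hXY]
    simp only [probReal_univ, one_smul]
    ring
  rw [integral_sub hXY1 hTXY] at b1
  rw [integral_sub (hX1.mul_prod hY1) (hTX.mul_prod hTY), integral_prod_mul, integral_prod_mul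
    (fun ω => trunc a (X ω)) (fun ω => trunc a (Y ω))] at b2
  simp only [cov] at hα ⊢
  rw [abs_le] at hα b1 b2 ⊢
  constructor <;> linarith [hα.1, hα.2, b1.1, b1.2, b2.1, b2.2]

lemma abs_cov_le_of_forall_trunc {X Y : Ω → ℝ} (hX : Measurable X) (hY : Measurable Y) {δ : ℝ}
    (hδ : 0 < δ) (hXp : Integrable (fun ω => |X ω| ^ (2 + δ)) P)
    (hYp : Integrable (fun ω => |Y ω| ^ (2 + δ)) P)
    (hXY : ∫ ω, |Y ω| ^ (2 + δ) ∂P = ∫ ω, |X ω| ^ (2 + δ) ∂P) {α : ℝ} (hα0 : 0 < α)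
    (hα : ∀ a, 0 < a →
      |cov P (fun ω => trunc a (X ω)) (fun ω => trunc a (Y ω))| ≤ α * a ^ 2) :
    |cov P X Y| ≤ 5 * (∫ ω, |X ω| ^ (2 + δ) ∂P) ^ (2 / (2 + δ)) * α ^ (δ / (2 + δ)) := by
  set M := ∫ ω, |X ω| ^ (2 + δ) ∂P with hM
  have hM0 : 0 ≤ M := integral_nonneg fun ω => by positivity
  have key := fun a ha => abs_cov_le_of_trunc hX hY hδ hXp hYp hXY ha (hα a ha)
  have hp : 0 < 2 + δ := by linarith
  rcases hM0.eq_or_lt with h0 | h0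
  · rw [← h0, Real.zero_rpow (by positivity), mul_zero, zero_mul]
    refine ge_of_tendsto (f := fun a : ℝ => α * a ^ 2) (x := 𝓝[>] 0) ?_ ?_
    · refine Tendsto.mono_left ?_ nhdsWithin_le_nhds
      have : Continuous fun a : ℝ => α * a ^ 2 := by fun_prop
      simpa using this.tendsto 0
    · filter_upwards [self_mem_nhdsWithin] with a ha
      have := key a ha
      rw [← hM, ← h0] at this
      simpa using this
  · have := key ((M / α) ^ (1 / (2 + δ))) (by positivity)
    refine this.trans (le_of_eq ?_)
    have hq : 0 < M / α := div_pos h0 hα0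
    rw [← Real.rpow_natCast, ← Real.rpow_mul hq.le, ← Real.rpow_mul hq.le,
      Real.div_rpow h0.le hα0.le, Real.div_rpow h0.le hα0.le, ← hM]
    have e1 : α / α ^ (1 / (2 + δ) * ((2 : ℕ) : ℝ)) = α ^ (δ / (2 + δ)) := by
      nth_rw 1 [← Real.rpow_one α]
      rw [← Real.rpow_sub hα0]
      congr 1
      push_cast
      field_simp
      ring
    have e2 : M ^ (1 / (2 + δ) * -δ) * M = M ^ (2 / (2 + δ)) := by
      nth_rw 2 [← Real.rpow_one M]
      rw [← Real.rpow_add h0]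
      congr 1
      field_simp
      ring
    have e3 : (α ^ (1 / (2 + δ) * -δ))⁻¹ = α ^ (δ / (2 + δ)) := by
      rw [← Real.rpow_neg hα0.le]
      congr 1
      ring
    have e4 : (1 / (2 + δ) * ((2 : ℕ) : ℝ)) = 2 / (2 + δ) := by push_cast; ring
    calc _ = M ^ (1 / (2 + δ) * ((2 : ℕ) : ℝ)) * (α / α ^ (1 / (2 + δ) * ((2 : ℕ) : ℝ))) +
        4 * (M ^ (1 / (2 + δ) * -δ) * M) * (α ^ (1 / (2 + δ) * -δ))⁻¹ := by ring
      _ = _ := by rw [e1, e2, e3, e4]; ring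

end

/-- The lattice point whose half-open unit cube contains `x`. -/
def floorE {d : ℕ} (x : EuclideanSpace ℝ (Fin d)) : Fin d → ℤ := fun i => ⌊x i⌋

lemma mem_cube_floorE {d : ℕ} (x : EuclideanSpace ℝ (Fin d)) : x ∈ cube (floorE x) :=
  fun _ => ⟨Int.floor_le _, (Int.lt_floor_add_one _).le⟩

lemma norm_le_mul_of_forall_abs_le {d : ℕ} {x : EuclideanSpace ℝ (Fin d)} {c : ℝ} (hc : 0 ≤ c)
    (hx : ∀ i, |x i| ≤ c) : ‖x‖ ≤ d * c := by
  rw [EuclideanSpace.norm_eq, Real.sqrt_le_iff]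
  refine ⟨by positivity, ?_⟩
  calc ∑ i, ‖x i‖ ^ 2 ≤ ∑ _i : Fin d, c ^ 2 :=
        Finset.sum_le_sum fun _ _ => pow_le_pow_left₀ (norm_nonneg _) (hx _) 2
    _ = d * c ^ 2 := by simp
    _ ≤ (d * d : ℕ) * c ^ 2 :=
        mul_le_mul_of_nonneg_right (Nat.cast_le.2 (Nat.le_mul_self d)) (sq_nonneg c)
    _ = (d * c) ^ 2 := by push_cast; ring

lemma one_add_norm_le_floorE {d : ℕ} (x : EuclideanSpace ℝ (Fin d)) :
    1 + ‖x‖ ≤ (1 + 2 * d) * max 1 ‖floorE x‖ := by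
  have h1 : ∀ i, |x i| ≤ 2 * max 1 ‖floorE x‖ := fun i => by
    have h2 : |(⌊x i⌋ : ℝ)| ≤ ‖floorE x‖ := by
      have := norm_le_pi_norm (floorE x) i
      rwa [Int.norm_eq_abs, floorE] at this
    have h3 := Int.floor_le (x i)
    have h4 := Int.lt_floor_add_one (x i)
    have h5 := le_max_left 1 ‖floorE x‖
    have h6 := le_max_right 1 ‖floorE x‖
    rw [abs_le] at h2 ⊢
    constructor <;> linarith [h2.1, h2.2]
  have := norm_le_mul_of_forall_abs_le (by positivity) h1
  linarith [le_max_left 1 ‖floorE x‖]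

lemma rate_floorE_le {d : ℕ} {b : ℝ} (hb : 0 ≤ b) (x : EuclideanSpace ℝ (Fin d)) :
    rate b (floorE x) ≤ (1 + 2 * d) ^ b * (1 + ‖x‖) ^ (-b) := by
  have h0 : (0 : ℝ) < 1 + 2 * d := by positivity
  have h1 : 0 < 1 + ‖x‖ := by positivity
  have := Real.rpow_le_rpow_of_nonpos (z := -b) (div_pos h1 h0)
    ((div_le_iff₀' h0).2 (one_add_norm_le_floorE x)) (by linarith)
  refine this.trans (le_of_eq ?_)
  rw [Real.div_rpow h1.le h0.le, Real.rpow_neg h0.le, div_inv_eq_mul, mul_comm]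

/-- The covariance function of the field `H ∘ Z`. -/
def covFn {d : ℕ} {Ω : Type*} [MeasurableSpace Ω] (P : Measure Ω)
    (Z : EuclideanSpace ℝ (Fin d) → Ω → ℝ) (H : ℝ → ℝ) (x : EuclideanSpace ℝ (Fin d)) : ℝ :=
  cov P (fun ω => H (Z 0 ω)) (fun ω => H (Z x ω))

namespace IsStationaryMaxStable

variable {d : ℕ} {Ω : Type*} [MeasurableSpace Ω] {P : Measure Ω}
  {Z : EuclideanSpace ℝ (Fin d) → Ω → ℝ}

lemma integrable_comp_iff (h : IsStationaryMaxStable P Z) {G : ℝ → ℝ} (hG : Measurable G)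
    (x : EuclideanSpace ℝ (Fin d)) :
    Integrable (fun ω => G (Z x ω)) P ↔ Integrable (fun ω => G (Z 0 ω)) P := by
  have e := fun y => integrable_map_measure (μ := P) (f := Z y) (g := G)
    hG.aestronglyMeasurable (h.measurable_apply y).aemeasurable
  exact (e x).symm.trans ((by rw [h.map_apply_eq]) : _ ↔ _) |>.trans (e 0)

variable [IsProbabilityMeasure P]

/-- The covariance function of `H ∘ Z` has an integrable majorant, uniformly in `H`. -/
theorem exists_covFn_bound (h : IsStationaryMaxStable P Z) {b C δ : ℝ}
    (hC : 0 < C) (hδ : 0 < δ) (hb0 : 0 ≤ b) (hb : d < b * (δ / (2 + δ)))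
    (hmix : ∀ {ι : Type} [Fintype ι] (c : ι → Fin d → ℤ)
      (x : ι → EuclideanSpace ℝ (Fin d)), (∀ i, x i ∈ cube (c i)) →
      ∀ A B : Finset (Fin d → ℤ), ∀ f g : (ι → ℝ) → ℂ, Measurable f → Measurable g →
      ∀ cf cg : ℝ, (∀ u, ‖f u‖ ≤ cf) → (∀ u, ‖g u‖ ≤ cg) →
      DependsOn f {i | c i ∈ A} → DependsOn g {i | c i ∈ B} →
      ‖∫ ω, f (fun i => Z (x i) ω) * g (fun i => Z (x i) ω) ∂P -
        (∫ ω, f (fun i => Z (x i) ω) ∂P) * ∫ ω, g (fun i => Z (x i) ω) ∂P‖ ≤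
      C * cf * cg * ∑ k ∈ A, ∑ l ∈ B, rate b (l - k)) :
    ∃ ψ : EuclideanSpace ℝ (Fin d) → ℝ, Integrable ψ ∧ ∀ H : ℝ → ℝ, Measurable H →
      Integrable (fun ω => |H (Z 0 ω)| ^ (2 + δ)) P → ∀ x,
      |covFn P Z H x| ≤ (∫ ω, |H (Z 0 ω)| ^ (2 + δ) ∂P) ^ (2 / (2 + δ)) * ψ x := by
  have hp : 0 < 2 + δ := by linarith
  set C' := C * (1 + 2 * d) ^ b with hC'
  have hC'0 : 0 < C' := by positivity
  refine ⟨fun x => 5 * C' ^ (δ / (2 + δ)) * (1 + ‖x‖) ^ (-(b * (δ / (2 + δ)))),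
    (integrable_one_add_norm (by simpa using hb)).const_mul _, fun H hH hHp x => ?_⟩
  have hHm : Measurable fun z => |H z| ^ (2 + δ) := (measurable_norm.comp hH).pow_const _
  have key := abs_cov_le_of_forall_trunc (P := P) (X := fun ω => H (Z 0 ω))
    (Y := fun ω => H (Z x ω)) (hH.comp (h.measurable_apply 0)) (hH.comp (h.measurable_apply x)) hδ
    hHp ((h.integrable_comp_iff hHm x).2 hHp) (h.integral_comp_eq hHm x)
    (α := C' * (1 + ‖x‖) ^ (-b)) (by positivity) fun a ha => by
      have hT : Measurable fun z => trunc a (H z) := (measurable_trunc a).comp hH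
      have := hmix (ι := Bool) (fun i => if i then floorE x else 0) (fun i => if i then x else 0)
        (fun i => by
          cases i
          · simp [cube]
          · exact mem_cube_floorE x) {0} {floorE x}
        (fun u => (trunc a (H (u false)) : ℂ)) (fun u => (trunc a (H (u true)) : ℂ))
        (Complex.measurable_ofReal.comp (hT.comp (measurable_pi_apply _)))
        (Complex.measurable_ofReal.comp (hT.comp (measurable_pi_apply _))) a a
        (fun u => by simpa using abs_trunc_le ha.le _)
        (fun u => by simpa using abs_trunc_le ha.le _)
        (fun u v huv => congrArg (fun z => ((trunc a (H z) : ℝ) : ℂ)) (huv false (by simp)))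
        (fun u v huv => congrArg (fun z => ((trunc a (H z) : ℝ) : ℂ)) (huv true (by simp)))
      simp only [if_true, Bool.false_eq_true, if_false, ← Complex.ofReal_mul,
        integral_complex_ofReal, ← Complex.ofReal_sub, Complex.norm_real, Real.norm_eq_abs,
        Finset.sum_singleton, sub_zero] at this
      refine this.trans ?_
      have hr := rate_floorE_le hb0 x
      calc _ ≤ C * a * a * ((1 + 2 * d) ^ b * (1 + ‖x‖) ^ (-b)) :=
            mul_le_mul_of_nonneg_left hr (by positivity)
        _ = _ := by rw [hC']; ring
  refine key.trans (le_of_eq ?_)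
  have hx : 0 ≤ 1 + ‖x‖ := by positivity
  rw [Real.mul_rpow hC'0.le (by positivity), ← Real.rpow_mul hx]
  ring_nf

end IsStationaryMaxStable

/-- The integral of `H ∘ Z` over a region. -/
def fieldIntegral {d : ℕ} {Ω : Type*} (Z : EuclideanSpace ℝ (Fin d) → Ω → ℝ) (H : ℝ → ℝ)
    (W : Set (EuclideanSpace ℝ (Fin d))) (ω : Ω) : ℝ :=
  ∫ x in W, H (Z x ω)

lemma fieldIntegral_sq {d : ℕ} {Ω : Type*} (Z : EuclideanSpace ℝ (Fin d) → Ω → ℝ) (H : ℝ → ℝ)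
    (W : Set (EuclideanSpace ℝ (Fin d))) (ω : Ω) : fieldIntegral Z H W ω ^ 2 = ∫ p,
    H (Z p.1 ω) * H (Z p.2 ω) ∂((volume.restrict W).prod (volume.restrict W)) := by
  rw [integral_prod_mul (fun x => H (Z x ω)) (fun x => H (Z x ω)), sq, fieldIntegral]

namespace IsStationaryMaxStable

variable {d : ℕ} {Ω : Type*} [MeasurableSpace Ω] {P : Measure Ω}
  {Z : EuclideanSpace ℝ (Fin d) → Ω → ℝ} {H : ℝ → ℝ} {W : Set (EuclideanSpace ℝ (Fin d))}

lemma integral_mul_eq_covFn (h : IsStationaryMaxStable P Z) (hH : Measurable H)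
    (h0 : ∫ ω, H (Z 0 ω) ∂P = 0) (x y : EuclideanSpace ℝ (Fin d)) :
    ∫ ω, H (Z x ω) * H (Z y ω) ∂P = covFn P Z H (y - x) := by
  rw [covFn, cov, h0, zero_mul, sub_zero]
  have hm : Measurable fun u : Bool → ℝ => H (u false) * H (u true) :=
    (hH.comp (measurable_pi_apply _)).mul (hH.comp (measurable_pi_apply _))
  have e := congrArg (fun μ => ∫ u, H (u false) * H (u true) ∂μ)
    (h.map_shift x fun i : Bool => if i then y - x else 0)
  rw [integral_map (h.measurable_family _).aemeasurable hm.aestronglyMeasurable,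
    integral_map (h.measurable_family _).aemeasurable hm.aestronglyMeasurable] at e
  simpa using e

lemma measurable_fieldIntegral [SFinite P] (h : IsStationaryMaxStable P Z) (hH : Measurable H) :
    Measurable (fieldIntegral Z H W) := by
  have hm : Measurable fun p : Ω × EuclideanSpace ℝ (Fin d) => H (Z p.2 p.1) :=
    hH.comp (h.meas.comp measurable_swap)
  exact (hm.stronglyMeasurable.integral_prod_right (ν := volume.restrict W)).measurable

lemma integral_abs_mul_le (h : IsStationaryMaxStable P Z) (hH : Measurable H)
    (h2 : Integrable (fun ω => H (Z 0 ω) ^ 2) P) (x y : EuclideanSpace ℝ (Fin d)) :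
    ∫ ω, |H (Z x ω) * H (Z y ω)| ∂P ≤ ∫ ω, H (Z 0 ω) ^ 2 ∂P := by
  have hH2 : Measurable fun z => H z ^ 2 := hH.pow_const 2
  have i := fun x => (h.integrable_comp_iff hH2 x).2 h2
  have ix := i x
  have iy := i y
  calc _ ≤ ∫ ω, (H (Z x ω) ^ 2 / 2 + H (Z y ω) ^ 2 / 2) ∂P := by
        refine integral_mono_of_nonneg (ae_of_all _ fun ω => abs_nonneg _)
          ((ix.div_const 2).add (iy.div_const 2)) (ae_of_all _ fun ω => ?_)
        dsimp only
        rw [abs_mul, ← sq_abs (H (Z x ω)), ← sq_abs (H (Z y ω))]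
        nlinarith [sq_nonneg (|H (Z x ω)| - |H (Z y ω)|)]
    _ = _ := by
        rw [integral_add (ix.div_const 2) (iy.div_const 2), integral_div, integral_div,
          h.integral_comp_eq hH2 x, h.integral_comp_eq hH2 y]
        ring

variable [IsProbabilityMeasure P]

lemma ae_integrableOn (h : IsStationaryMaxStable P Z) (hH : Measurable H)
    (h1 : Integrable (fun ω => H (Z 0 ω)) P) (hW : volume W ≠ ∞) :
    ∀ᵐ ω ∂P, IntegrableOn (fun x => H (Z x ω)) W := by
  have : IsFiniteMeasure (volume.restrict W) := ⟨by simpa using hW.lt_top⟩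
  have hm : Measurable fun p : Ω × EuclideanSpace ℝ (Fin d) => H (Z p.2 p.1) :=
    hH.comp (h.meas.comp measurable_swap)
  have hi : Integrable (fun p : Ω × EuclideanSpace ℝ (Fin d) => H (Z p.2 p.1))
      (P.prod (volume.restrict W)) := by
    rw [integrable_prod_iff' hm.aestronglyMeasurable]
    refine ⟨ae_of_all _ fun x => (h.integrable_comp_iff hH x).2 h1, ?_⟩
    have e : ∀ x, ∫ ω, ‖H (Z x ω)‖ ∂P = ∫ ω, ‖H (Z 0 ω)‖ ∂P := fun x =>
      h.integral_comp_eq (G := fun z => ‖H z‖) hH.norm x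
    simp_rw [e]
    exact integrable_const _
  exact hi.prod_right_ae

lemma integrable_mul_prod (h : IsStationaryMaxStable P Z) (hH : Measurable H)
    (h2 : Integrable (fun ω => H (Z 0 ω) ^ 2) P) (hW : volume W ≠ ∞) :
    Integrable (fun p : Ω × EuclideanSpace ℝ (Fin d) × EuclideanSpace ℝ (Fin d) =>
      H (Z p.2.1 p.1) * H (Z p.2.2 p.1))
      (P.prod ((volume.restrict W).prod (volume.restrict W))) := by
  have : IsFiniteMeasure (volume.restrict W) := ⟨by simpa using hW.lt_top⟩
  have hm : Measurable fun p : Ω × EuclideanSpace ℝ (Fin d) × EuclideanSpace ℝ (Fin d) =>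
      H (Z p.2.1 p.1) * H (Z p.2.2 p.1) :=
    (hH.comp (h.meas.comp (show Measurable fun p : Ω × EuclideanSpace ℝ (Fin d) ×
      EuclideanSpace ℝ (Fin d) => (p.2.1, p.1) by fun_prop))).mul
    (hH.comp (h.meas.comp (show Measurable fun p : Ω × EuclideanSpace ℝ (Fin d) ×
      EuclideanSpace ℝ (Fin d) => (p.2.2, p.1) by fun_prop)))
  have hH2 : Measurable fun z => H z ^ 2 := hH.pow_const 2
  have i := fun x => (h.integrable_comp_iff hH2 x).2 h2
  rw [integrable_prod_iff' hm.aestronglyMeasurable]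
  refine ⟨ae_of_all _ fun p => integrable_mul_of_sq
    (hH.comp (h.measurable_apply p.1)).aestronglyMeasurable
    (hH.comp (h.measurable_apply p.2)).aestronglyMeasurable (i p.1) (i p.2), ?_⟩
  refine Integrable.of_bound hm.norm.stronglyMeasurable.integral_prod_left.aestronglyMeasurable
    (∫ ω, H (Z 0 ω) ^ 2 ∂P) (ae_of_all _ fun p => ?_)
  rw [Real.norm_of_nonneg (integral_nonneg fun ω => norm_nonneg _)]
  exact h.integral_abs_mul_le hH h2 p.1 p.2

lemma integrable_fieldIntegral_sq (h : IsStationaryMaxStable P Z) (hH : Measurable H)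
    (h2 : Integrable (fun ω => H (Z 0 ω) ^ 2) P) (hW : volume W ≠ ∞) :
    Integrable (fun ω => fieldIntegral Z H W ω ^ 2) P := by
  simp_rw [fieldIntegral_sq]
  exact (h.integrable_mul_prod hH h2 hW).integral_prod_left

lemma integrable_covFn_prod (h : IsStationaryMaxStable P Z) (hH : Measurable H)
    (h0 : ∫ ω, H (Z 0 ω) ∂P = 0) (h2 : Integrable (fun ω => H (Z 0 ω) ^ 2) P)
    (hW : volume W ≠ ∞) :
    Integrable (fun p : EuclideanSpace ℝ (Fin d) × EuclideanSpace ℝ (Fin d) =>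
      covFn P Z H (p.2 - p.1)) ((volume.restrict W).prod (volume.restrict W)) := by
  simp_rw [← h.integral_mul_eq_covFn hH h0]
  exact (h.integrable_mul_prod hH h2 hW).integral_prod_right

/-- The variance of an integral of the field as a double integral of the covariance function. -/
theorem integral_fieldIntegral_sq (h : IsStationaryMaxStable P Z) (hH : Measurable H)
    (h0 : ∫ ω, H (Z 0 ω) ∂P = 0) (h2 : Integrable (fun ω => H (Z 0 ω) ^ 2) P)
    (hW : volume W ≠ ∞) :
    ∫ ω, fieldIntegral Z H W ω ^ 2 ∂P = ∫ x in W, ∫ y in W, covFn P Z H (y - x) := by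
  simp_rw [fieldIntegral_sq]
  rw [integral_integral_swap (h.integrable_mul_prod hH h2 hW),
    ← integral_prod _ (h.integrable_covFn_prod hH h0 h2 hW)]
  simp_rw [h.integral_mul_eq_covFn hH h0]

lemma measurable_covFn (h : IsStationaryMaxStable P Z) (hH : Measurable H) :
    Measurable (covFn P Z H) := by
  have hm : Measurable fun p : EuclideanSpace ℝ (Fin d) × Ω => H (Z 0 p.2) * H (Z p.1 p.2) :=
    (hH.comp ((h.measurable_apply 0).comp measurable_snd)).mul (hH.comp h.meas)
  have hm' : Measurable fun p : EuclideanSpace ℝ (Fin d) × Ω => H (Z p.1 p.2) := hH.comp h.meas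
  exact hm.stronglyMeasurable.integral_prod_right.measurable.sub
    (hm'.stronglyMeasurable.integral_prod_right.measurable.const_mul _)

lemma integral_fieldIntegral_sq_le (h : IsStationaryMaxStable P Z) (hH : Measurable H)
    (h0 : ∫ ω, H (Z 0 ω) ∂P = 0) (h2 : Integrable (fun ω => H (Z 0 ω) ^ 2) P)
    (hc : Integrable (covFn P Z H)) (hW : volume W ≠ ∞) :
    ∫ ω, fieldIntegral Z H W ω ^ 2 ∂P ≤ (volume W).toReal * ∫ x, |covFn P Z H x| := by
  rw [h.integral_fieldIntegral_sq hH h0 h2 hW, mul_comm]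
  refine (le_abs_self _).trans ?_
  rw [← Real.norm_eq_abs]
  refine norm_setIntegral_le_of_norm_le_const (C := ∫ x, |covFn P Z H x|) hW.lt_top fun x _ => ?_
  refine (norm_integral_le_integral_norm _).trans ?_
  refine (setIntegral_le_integral (hc.comp_sub_right x).norm
    (ae_of_all _ fun _ => norm_nonneg _)).trans (le_of_eq ?_)
  exact integral_sub_right_eq_self (fun y => ‖covFn P Z H y‖) x

end IsStationaryMaxStable

lemma infDist_frontier_le_dist {d : ℕ} {V : Set (EuclideanSpace ℝ (Fin d))}
    {x y : EuclideanSpace ℝ (Fin d)} (hx : x ∈ V) (hy : y ∉ V) :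
    Metric.infDist x (frontier V) ≤ dist x y := by
  have hne : (segment ℝ x y ∩ frontier V).Nonempty := by
    by_contra hcon
    rw [Set.not_nonempty_iff_eq_empty] at hcon
    have hdisj : ∀ z ∈ segment ℝ x y, z ∉ frontier V := fun z hz hzf =>
      (Set.eq_empty_iff_forall_notMem.1 hcon z) ⟨hz, hzf⟩
    have hcov : segment ℝ x y ⊆ interior V ∪ (closure V)ᶜ := fun z hz => by
      by_cases hzc : z ∈ closure V
      · exact Or.inl (by_contra fun hzi => hdisj z hz ⟨hzc, hzi⟩)
      · exact Or.inr hzc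
    have hpre : IsPreconnected (segment ℝ x y) := (convex_segment x y).isPreconnected
    obtain ⟨z, -, hz1, hz2⟩ := hpre (interior V) (closure V)ᶜ isOpen_interior
      isClosed_closure.isOpen_compl hcov
      ⟨x, left_mem_segment ℝ x y, (hcov (left_mem_segment ℝ x y)).resolve_right
        fun hn => hn (subset_closure hx)⟩
      ⟨y, right_mem_segment ℝ x y, (hcov (right_mem_segment ℝ x y)).resolve_left
        fun hn => hy (interior_subset hn)⟩
    exact hz2 (subset_closure (interior_subset hz1))
  obtain ⟨z, hz, hzf⟩ := hne
  refine (Metric.infDist_le_dist_of_mem hzf).trans ?_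
  linarith [dist_add_dist_of_mem_segment hz, dist_nonneg (x := z) (y := y)]

/-- Points at distance at most `r` from the boundary of `V`. -/
def boundaryLayer {d : ℕ} (V : Set (EuclideanSpace ℝ (Fin d))) (r : ℝ) :
    Set (EuclideanSpace ℝ (Fin d)) :=
  {x | Metric.infDist x (frontier V) ≤ r}

lemma measurableSet_boundaryLayer {d : ℕ} (V : Set (EuclideanSpace ℝ (Fin d))) (r : ℝ) :
    MeasurableSet (boundaryLayer V r) :=
  measurableSet_le (Metric.continuous_infDist_pt _).measurable measurable_const

lemma volume_boundaryLayer_ne_top {d : ℕ} (hd : 0 < d) {V : Set (EuclideanSpace ℝ (Fin d))}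
    (hb : Bornology.IsBounded V) (hne : V.Nonempty) (r : ℝ) :
    volume (boundaryLayer V r) ≠ ∞ := by
  have : Nonempty (Fin d) := ⟨⟨0, hd⟩⟩
  have hfr : (frontier V).Nonempty := nonempty_frontier_iff.2 ⟨hne, fun e =>
    NormedSpace.unbounded_univ ℝ (EuclideanSpace ℝ (Fin d)) (e ▸ hb)⟩
  obtain ⟨z, hz⟩ := hfr
  obtain ⟨R, hR⟩ := hb.closure.subset_closedBall z
  refine ((measure_mono ?_).trans_lt
    (measure_closedBall_lt_top (x := z) (r := R + (r + 1)))).ne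
  intro x hx
  obtain ⟨y, hy, hxy⟩ := (Metric.infDist_lt_iff ⟨z, hz⟩).1
    (lt_of_le_of_lt (show Metric.infDist x (frontier V) ≤ r from hx) (lt_add_one r))
  have := hR (frontier_subset_closure hy)
  rw [Metric.mem_closedBall] at this ⊢
  linarith [dist_triangle x y z]

lemma abs_setIntegral_sub_integral_le {d : ℕ} {V : Set (EuclideanSpace ℝ (Fin d))}
    (hV : MeasurableSet V) {c : EuclideanSpace ℝ (Fin d) → ℝ} (hc : Integrable c) (r : ℝ)
    {x : EuclideanSpace ℝ (Fin d)} (hx : x ∈ V) :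
    |(∫ y in V, c (y - x)) - ∫ y, c y| ≤ (∫ y in {y | r < ‖y‖}, |c y|) +
      (boundaryLayer V r).indicator (fun _ => ∫ y, |c y|) x := by
  have hcx : Integrable fun y => c (y - x) := hc.comp_sub_right x
  have e : (∫ y in V, c (y - x)) - ∫ y, c y = - ∫ y in Vᶜ, c (y - x) := by
    rw [← integral_sub_right_eq_self c x, ← integral_add_compl hV hcx]
    ring
  have h1 : |∫ y in Vᶜ, c (y - x)| ≤ ∫ y in Vᶜ, |c (y - x)| := abs_integral_le_integral_abs
  have h0 : 0 ≤ ∫ y in {y | r < ‖y‖}, |c y| := integral_nonneg fun _ => abs_nonneg _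
  rw [e, abs_neg]
  by_cases hb : x ∈ boundaryLayer V r
  · rw [Set.indicator_of_mem hb]
    have h2 : ∫ y in Vᶜ, |c (y - x)| ≤ ∫ y, |c (y - x)| :=
      setIntegral_le_integral hcx.abs (ae_of_all _ fun _ => abs_nonneg _)
    have h3 := integral_sub_right_eq_self (μ := volume) (fun y => |c y|) x
    linarith
  · rw [Set.indicator_of_notMem hb, add_zero]
    refine h1.trans ?_
    have hs : Vᶜ ⊆ (fun y => y - x) ⁻¹' {y | r < ‖y‖} := fun y hy => by
      have := (not_le.1 hb).trans_le (infDist_frontier_le_dist hx hy)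
      rwa [dist_comm, dist_eq_norm] at this
    refine (setIntegral_mono_set hcx.abs.integrableOn (ae_of_all _ fun _ => abs_nonneg _)
      hs.eventuallyLE).trans (le_of_eq ?_)
    exact (measurePreserving_sub_right volume x).setIntegral_preimage_emb
      (MeasurableEquiv.subRight x).measurableEmbedding (fun y => |c y|) _

lemma abs_integral_integral_sub_le {d : ℕ} (hd : 0 < d) {V : Set (EuclideanSpace ℝ (Fin d))}
    (hV : MeasurableSet V) (hb : Bornology.IsBounded V) (hne : V.Nonempty)
    {c : EuclideanSpace ℝ (Fin d) → ℝ} (hm : Measurable c) (hc : Integrable c) (r : ℝ) :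
    |(∫ x in V, ∫ y in V, c (y - x)) - (volume V).toReal * ∫ y, c y| ≤
      (∫ y in {y | r < ‖y‖}, |c y|) * (volume V).toReal +
        (∫ y, |c y|) * (volume (boundaryLayer V r)).toReal := by
  have hVt : volume V ≠ ∞ := hb.measure_lt_top.ne
  have hLt := volume_boundaryLayer_ne_top hd hb hne r
  have hfin : IsFiniteMeasure (volume.restrict V) := ⟨by simpa using hVt.lt_top⟩
  have hmg : Measurable fun x => ∫ y in V, c (y - x) := by
    have : Measurable fun p : EuclideanSpace ℝ (Fin d) × EuclideanSpace ℝ (Fin d) =>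
      c (p.2 - p.1) := hm.comp (by fun_prop)
    exact (this.stronglyMeasurable.integral_prod_right (ν := volume.restrict V)).measurable
  have hig : Integrable (fun x => ∫ y in V, c (y - x)) (volume.restrict V) := by
    refine Integrable.of_bound hmg.aestronglyMeasurable (∫ y, |c y|) (ae_of_all _ fun x => ?_)
    refine (norm_integral_le_integral_norm _).trans ?_
    refine (setIntegral_le_integral (hc.comp_sub_right x).norm
      (ae_of_all _ fun _ => norm_nonneg _)).trans (le_of_eq ?_)
    exact integral_sub_right_eq_self (fun y => ‖c y‖) x
  have e : (∫ x in V, ∫ y in V, c (y - x)) - (volume V).toReal * ∫ y, c y =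
      ∫ x in V, ((∫ y in V, c (y - x)) - ∫ y, c y) := by
    rw [integral_sub hig (integrable_const _), setIntegral_const, smul_eq_mul, Measure.real]
  have hI : 0 ≤ ∫ y, |c y| := integral_nonneg fun _ => abs_nonneg _
  have hind : Integrable ((boundaryLayer V r).indicator fun _ => ∫ y, |c y|)
      (volume.restrict V) :=
    (integrable_const _).indicator (measurableSet_boundaryLayer V r)
  rw [e]
  refine abs_integral_le_integral_abs.trans ?_
  have hd1 : Integrable (fun x => (∫ y in V, c (y - x)) - ∫ y, c y) (volume.restrict V) :=
    hig.sub (integrable_const _)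
  have hd2 : Integrable (fun x => (∫ y in {y | r < ‖y‖}, |c y|) +
      (boundaryLayer V r).indicator (fun _ => ∫ y, |c y|) x) (volume.restrict V) :=
    (integrable_const _).add hind
  refine (setIntegral_mono_on hd1.abs hd2 hV
    fun x hx => abs_setIntegral_sub_integral_le hV hc r hx).trans ?_
  rw [integral_add (integrable_const _) hind, setIntegral_const, smul_eq_mul, Measure.real,
    mul_comm]
  gcongr
  rw [integral_indicator (measurableSet_boundaryLayer V r), setIntegral_const, smul_eq_mul,
    mul_comm, Measure.real]
  refine mul_le_mul_of_nonneg_left (ENNReal.toReal_mono hLt ?_) hI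
  exact Measure.restrict_apply_le _ _

lemma tendsto_setIntegral_norm_gt {d : ℕ} {c : EuclideanSpace ℝ (Fin d) → ℝ}
    (hc : Integrable c) :
    Tendsto (fun n : ℕ => ∫ y in {y : EuclideanSpace ℝ (Fin d) | (n : ℝ) < ‖y‖}, |c y|) atTop
      (𝓝 0) := by
  have h := tendsto_setIntegral_of_antitone (μ := volume) (f := fun y => |c y|)
    (s := fun n : ℕ => {y : EuclideanSpace ℝ (Fin d) | (n : ℝ) < ‖y‖})
    (fun n => measurableSet_lt measurable_const measurable_norm)
    (fun m n hmn y (hy : (n : ℝ) < ‖y‖) => show (m : ℝ) < ‖y‖ from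
      lt_of_le_of_lt (Nat.cast_le.2 hmn) hy) ⟨0, hc.abs.integrableOn⟩
  have e : (⋂ n : ℕ, {y : EuclideanSpace ℝ (Fin d) | (n : ℝ) < ‖y‖}) = ∅ := by
    refine Set.eq_empty_iff_forall_notMem.2 fun y hy => ?_
    obtain ⟨n, hn⟩ := exists_nat_ge ‖y‖
    exact absurd (Set.mem_iInter.1 hy n) (not_lt.2 hn)
  simpa [e] using h

namespace IsVanHove

variable {d : ℕ} {V : ℕ → Set (EuclideanSpace ℝ (Fin d))}

lemma bounded (hV : IsVanHove V) (n : ℕ) : Bornology.IsBounded (V n) := hV.1 n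

lemma measurableSet (hV : IsVanHove V) (n : ℕ) : MeasurableSet (V n) := hV.2.1 n

lemma volume_ne_top (hV : IsVanHove V) (n : ℕ) : volume (V n) ≠ ∞ :=
  (hV.bounded n).measure_lt_top.ne

lemma tendsto_volume (hV : IsVanHove V) :
    Tendsto (fun n => (volume (V n)).toReal) atTop atTop := hV.2.2.2.2.1

lemma tendsto_boundaryLayer (hV : IsVanHove V) {r : ℝ} (hr : 0 < r) :
    Tendsto (fun n => (volume (boundaryLayer (V n) r)).toReal / (volume (V n)).toReal) atTop
      (𝓝 0) := hV.2.2.2.2.2 r hr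

lemma nonempty_of_pos {n : ℕ} (hn : 0 < (volume (V n)).toReal) : (V n).Nonempty := by
  by_contra h
  rw [Set.not_nonempty_iff_eq_empty] at h
  simp [h] at hn

/-- Averages of an integrable kernel over a Van Hove sequence converge to its integral. -/
theorem tendsto_integral_integral_div (hd : 0 < d) (hV : IsVanHove V)
    {c : EuclideanSpace ℝ (Fin d) → ℝ} (hm : Measurable c) (hc : Integrable c) :
    Tendsto (fun n => (∫ x in V n, ∫ y in V n, c (y - x)) / (volume (V n)).toReal) atTop
      (𝓝 (∫ y, c y)) := by
  rw [Metric.tendsto_nhds]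
  intro ε hε
  obtain ⟨m, hm1, hm2⟩ := ((tendsto_setIntegral_norm_gt hc).eventually
    (gt_mem_nhds (half_pos hε)) |>.and (eventually_gt_atTop 0)).exists
  have hr := (hV.tendsto_boundaryLayer (Nat.cast_pos.2 hm2)).const_mul (∫ y, |c y|)
  rw [mul_zero] at hr
  filter_upwards [hr.eventually (gt_mem_nhds (half_pos hε)),
    hV.tendsto_volume.eventually_gt_atTop 0] with n hn hpos
  have := abs_integral_integral_sub_le hd (hV.measurableSet n) (hV.bounded n)
    (nonempty_of_pos hpos) hm hc (m : ℝ)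
  rw [Real.dist_eq]
  have e : (∫ x in V n, ∫ y in V n, c (y - x)) / (volume (V n)).toReal - ∫ y, c y =
      ((∫ x in V n, ∫ y in V n, c (y - x)) - (volume (V n)).toReal * ∫ y, c y) /
        (volume (V n)).toReal := by
    field_simp
  rw [e, abs_div, abs_of_pos hpos, div_lt_iff₀ hpos]
  rw [← mul_div_assoc, div_lt_iff₀ hpos] at hn
  nlinarith

end IsVanHove

lemma measurable_floorE {d : ℕ} : Measurable (floorE : EuclideanSpace ℝ (Fin d) → _) :=
  measurable_pi_lambda _ fun i => Int.measurable_floor.comp (by fun_prop)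

lemma floorE_eq_iff {d : ℕ} {x : EuclideanSpace ℝ (Fin d)} {h : Fin d → ℤ} :
    floorE x = h ↔ x - toE h ∈ unitCube d := by
  simp only [floorE, funext_iff, Int.floor_eq_iff, unitCube, Set.mem_ofPred_eq, PiLp.sub_apply,
    toE_apply]
  exact forall_congr' fun i => by constructor <;> rintro ⟨h1, h2⟩ <;> constructor <;> linarith

/-- The lattice points whose half-open unit cube lies in `V`. -/
def latticePart {d : ℕ} (V : Set (EuclideanSpace ℝ (Fin d))) : Set (Fin d → ℤ) :=
  {h | ∀ x, floorE x = h → x ∈ V}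

/-- The union of the lattice unit cubes contained in `V`. -/
def cubePart {d : ℕ} (V : Set (EuclideanSpace ℝ (Fin d))) : Set (EuclideanSpace ℝ (Fin d)) :=
  floorE ⁻¹' latticePart V

lemma cubePart_subset {d : ℕ} (V : Set (EuclideanSpace ℝ (Fin d))) : cubePart V ⊆ V :=
  fun x hx => hx x rfl

lemma measurableSet_cubePart {d : ℕ} (V : Set (EuclideanSpace ℝ (Fin d))) :
    MeasurableSet (cubePart V) :=
  measurable_floorE (Set.to_countable _).measurableSet

lemma floorE_toE {d : ℕ} (h : Fin d → ℤ) : floorE (toE h) = h := by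
  rw [floorE_eq_iff, sub_self]
  intro i
  simp

lemma finite_latticePart {d : ℕ} {V : Set (EuclideanSpace ℝ (Fin d))}
    (hV : Bornology.IsBounded V) : (latticePart V).Finite := by
  obtain ⟨R, hR⟩ := hV.exists_norm_le
  refine Set.Finite.subset (Metric.finite_isBounded_inter_isClosed
    DiscreteTopology.isDiscrete (Metric.isBounded_closedBall (x := (0 : Fin d → ℤ)) (r := R))
    isClosed_univ) fun h hh => ?_
  exact ⟨mem_closedBall_zero_iff.2 ((norm_le_norm_toE h).trans (hR _ (hh _ (floorE_toE h)))),
    trivial⟩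

lemma sdiff_cubePart_subset {d : ℕ} (V : Set (EuclideanSpace ℝ (Fin d))) :
    V \ cubePart V ⊆ boundaryLayer V d := by
  rintro x ⟨hx, hxc⟩
  have : ∃ y, floorE y = floorE x ∧ y ∉ V := by
    by_contra hcon
    push Not at hcon
    exact hxc hcon
  obtain ⟨y, hy, hyV⟩ := this
  refine (infDist_frontier_le_dist hx hyV).trans ?_
  rw [dist_eq_norm]
  have := norm_le_mul_of_forall_abs_le (x := x - y) zero_le_one fun i => ?_
  · simpa using this
  · have e := congrFun hy i
    simp only [floorE] at e
    rw [PiLp.sub_apply]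
    exact (Int.abs_sub_lt_one_of_floor_eq_floor e.symm).le

lemma preimage_floorE_eq {d : ℕ} (h : Fin d → ℤ) :
    floorE ⁻¹' {h} = (fun x => x - toE h) ⁻¹' unitCube d := by
  ext x
  exact floorE_eq_iff

lemma volume_preimage_floorE {d : ℕ} (h : Fin d → ℤ) :
    volume (floorE ⁻¹' {h} : Set (EuclideanSpace ℝ (Fin d))) = 1 := by
  rw [preimage_floorE_eq, (measurePreserving_sub_right volume (toE h)).measure_preimage
    (measurableSet_unitCube d).nullMeasurableSet, volume_unitCube]

lemma cubePart_eq_biUnion {d : ℕ} {V : Set (EuclideanSpace ℝ (Fin d))}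
    (hV : Bornology.IsBounded V) :
    cubePart V = ⋃ h ∈ (finite_latticePart hV).toFinset, floorE ⁻¹' {h} := by
  ext x
  simp [cubePart]

lemma pairwiseDisjoint_preimage_floorE {d : ℕ} (s : Set (Fin d → ℤ)) :
    s.PairwiseDisjoint fun h => (floorE ⁻¹' {h} : Set (EuclideanSpace ℝ (Fin d))) :=
  fun _ _ _ _ hne => Disjoint.preimage _ (Set.disjoint_singleton.2 hne)

lemma measurableSet_preimage_floorE {d : ℕ} (h : Fin d → ℤ) :
    MeasurableSet (floorE ⁻¹' {h} : Set (EuclideanSpace ℝ (Fin d))) :=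
  measurable_floorE (measurableSet_singleton h)

lemma card_latticePart_le {d : ℕ} {V : Set (EuclideanSpace ℝ (Fin d))}
    (hV : Bornology.IsBounded V) :
    ((finite_latticePart hV).toFinset.card : ℝ) ≤ (volume V).toReal := by
  have h1 : volume (cubePart V) = ((finite_latticePart hV).toFinset.card : ℝ≥0∞) := by
    rw [cubePart_eq_biUnion hV, measure_biUnion_finset (pairwiseDisjoint_preimage_floorE _)
      fun h _ => measurableSet_preimage_floorE h]
    simp [volume_preimage_floorE]
  have h2 := ENNReal.toReal_mono hV.measure_lt_top.ne (measure_mono (μ := volume)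
    (cubePart_subset V))
  rwa [h1, ENNReal.toReal_natCast] at h2

lemma sum_cubeIntegral {d : ℕ} {Ω : Type*} {Z : EuclideanSpace ℝ (Fin d) → Ω → ℝ} {G : ℝ → ℝ}
    {V : Set (EuclideanSpace ℝ (Fin d))} (hV : Bornology.IsBounded V) {ω : Ω}
    (hi : IntegrableOn (fun x => G (Z x ω)) V) :
    ∑ h ∈ (finite_latticePart hV).toFinset, cubeIntegral Z G h ω =
      fieldIntegral Z G (cubePart V) ω := by
  have hU := cubePart_eq_biUnion hV
  rw [fieldIntegral, hU, integral_biUnion_finset _ (fun h _ => measurableSet_preimage_floorE h)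
    (pairwiseDisjoint_preimage_floorE _) fun h hh => hi.mono_set ?_]
  · refine Finset.sum_congr rfl fun h _ => ?_
    rw [cubeIntegral, preimage_floorE_eq]
    have := (measurePreserving_sub_right volume (toE h)).setIntegral_preimage_emb
      (MeasurableEquiv.subRight (toE h)).measurableEmbedding
      (fun x => G (Z (toE h + x) ω)) (unitCube d)
    simpa using this.symm
  · refine Set.Subset.trans ?_ (cubePart_subset V)
    rw [hU]
    exact Set.subset_biUnion_of_mem (u := fun h => floorE ⁻¹' {h}) hh

lemma exists_boundedContinuous_rpow_sub_le {Ω : Type*} [MeasurableSpace Ω] {P : Measure Ω}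
    [IsFiniteMeasure P] {X : Ω → ℝ} (hX : Measurable X) {H : ℝ → ℝ} (hH : Measurable H) {p : ℝ}
    (hp : 0 < p) (hHp : Integrable (fun ω => |H (X ω)| ^ p) P) {η : ℝ} (hη : 0 < η) :
    ∃ g : BoundedContinuousFunction ℝ ℝ, Integrable (fun ω => |H (X ω) - g (X ω)| ^ p) P ∧
      ∫ ω, |H (X ω) - g (X ω)| ^ p ∂P ≤ η := by
  have hpe : ENNReal.ofReal p ≠ 0 := by simpa using hp
  have hm : MemLp H (ENNReal.ofReal p) (P.map X) := by
    rw [← integrable_norm_rpow_iff hH.aestronglyMeasurable hpe ENNReal.ofReal_ne_top,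
      ENNReal.toReal_ofReal hp.le,
      integrable_map_measure ((hH.norm.pow_const p).aestronglyMeasurable) hX.aemeasurable]
    exact hHp
  obtain ⟨g, hg, hgm⟩ := hm.exists_boundedContinuous_integral_rpow_sub_le hp hη
  have hmeas : Measurable fun z => ‖H z - g z‖ ^ p :=
    (hH.sub g.continuous.measurable).norm.pow_const p
  refine ⟨g, ?_, ?_⟩
  · have := (hm.sub hgm).integrable_norm_rpow hpe ENNReal.ofReal_ne_top
    rw [ENNReal.toReal_ofReal hp.le] at this
    exact (integrable_map_measure hmeas.aestronglyMeasurable hX.aemeasurable).1 this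
  · rwa [integral_map hX.aemeasurable hmeas.aestronglyMeasurable] at hg

namespace IsStationaryMaxStable

variable {d : ℕ} {Ω : Type*} [MeasurableSpace Ω] {P : Measure Ω}
  {Z : EuclideanSpace ℝ (Fin d) → Ω → ℝ} [IsProbabilityMeasure P]

lemma covFn_sub_const (h : IsStationaryMaxStable P Z) {H : ℝ → ℝ} (hH : Measurable H)
    (h1 : Integrable (fun ω => H (Z 0 ω)) P) (h2 : Integrable (fun ω => H (Z 0 ω) ^ 2) P)
    (a : ℝ) (x : EuclideanSpace ℝ (Fin d)) :
    covFn P Z (fun z => H z - a) x = covFn P Z H x := by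
  have hx := (h.integrable_comp_iff hH x).2 h1
  have hx2 := (h.integrable_comp_iff (hH.pow_const 2) x).2 h2
  have hm : Integrable (fun ω => H (Z 0 ω) * H (Z x ω)) P := integrable_mul_of_sq
    (hH.comp (h.measurable_apply 0)).aestronglyMeasurable
    (hH.comp (h.measurable_apply x)).aestronglyMeasurable h2 hx2
  have e : ∫ ω, (H (Z 0 ω) - a) * (H (Z x ω) - a) ∂P = ∫ ω, H (Z 0 ω) * H (Z x ω) ∂P -
      a * ∫ ω, H (Z 0 ω) ∂P - a * ∫ ω, H (Z x ω) ∂P + a ^ 2 := by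
    have i1 : Integrable (fun ω => H (Z 0 ω) * H (Z x ω) - a * H (Z 0 ω)) P :=
      hm.sub (h1.const_mul a)
    have i2 : Integrable (fun ω => H (Z 0 ω) * H (Z x ω) - a * H (Z 0 ω) - a * H (Z x ω)) P :=
      i1.sub (hx.const_mul a)
    have e1 : ∀ ω, (H (Z 0 ω) - a) * (H (Z x ω) - a) =
        H (Z 0 ω) * H (Z x ω) - a * H (Z 0 ω) - a * H (Z x ω) + a ^ 2 := fun ω => by ring
    simp_rw [e1]
    rw [integral_add i2 (integrable_const _), integral_sub i1 (hx.const_mul a),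
      integral_sub hm (h1.const_mul a), integral_const_mul, integral_const_mul]
    simp
  simp only [covFn, cov]
  rw [e, integral_sub h1 (integrable_const _), integral_sub hx (integrable_const _)]
  simp only [integral_const, probReal_univ, one_smul]
  ring

/-- A function of the field with a moment of order `2 + δ` is approximated by centred bounded
continuous ones in the sense of the integrated covariance function. -/
theorem exists_continuous_approx (h : IsStationaryMaxStable P Z) {δ : ℝ} (hδ : 0 < δ)
    {ψ : EuclideanSpace ℝ (Fin d) → ℝ} (hψ : Integrable ψ)
    (hcov : ∀ H : ℝ → ℝ, Measurable H → Integrable (fun ω => |H (Z 0 ω)| ^ (2 + δ)) P → ∀ x,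
      |covFn P Z H x| ≤ (∫ ω, |H (Z 0 ω)| ^ (2 + δ) ∂P) ^ (2 / (2 + δ)) * ψ x)
    {H : ℝ → ℝ} (hH : Measurable H) (hHp : Integrable (fun ω => |H (Z 0 ω)| ^ (2 + δ)) P)
    {ε : ℝ} (hε : 0 < ε) :
    ∃ (G : ℝ → ℝ) (M : ℝ), Continuous G ∧ (∀ z, |G z| ≤ M) ∧ ∫ ω, G (Z 0 ω) ∂P = 0 ∧
      Integrable (covFn P Z G) ∧ Integrable (fun ω => (H (Z 0 ω) - G (Z 0 ω)) ^ 2) P ∧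
      Integrable (covFn P Z fun z => H z - G z) ∧
      ∫ x, |covFn P Z (fun z => H z - G z) x| < ε := by
  have hp : 0 < 2 + δ := by linarith
  have hZ := h.measurable_apply 0
  set I := ∫ x, |ψ x| with hI
  have hI0 : 0 ≤ I := integral_nonneg fun _ => abs_nonneg _
  have hq : 0 < ε / (I + 1) := by positivity
  obtain ⟨g, hgi, hg⟩ := exists_boundedContinuous_rpow_sub_le hZ hH hp hHp
    (η := (ε / (I + 1)) ^ ((2 + δ) / 2)) (by positivity)
  have hgm : Measurable g := g.continuous.measurable
  have hRm : Measurable fun z => H z - g z := hH.sub hgm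
  have hRa : AEStronglyMeasurable (fun ω => H (Z 0 ω) - g (Z 0 ω)) P :=
    (hRm.comp hZ).aestronglyMeasurable
  have hHa : AEStronglyMeasurable (fun ω => H (Z 0 ω)) P := (hH.comp hZ).aestronglyMeasurable
  have hR1 : Integrable (fun ω => H (Z 0 ω) - g (Z 0 ω)) P :=
    integrable_of_rpow (by linarith) hRa hgi
  have hR2 : Integrable (fun ω => (H (Z 0 ω) - g (Z 0 ω)) ^ 2) P :=
    integrable_sq_of_rpow (by linarith) hRa hgi
  have hH1 : Integrable (fun ω => H (Z 0 ω)) P := integrable_of_rpow (by linarith) hHa hHp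
  have hg1 : Integrable (fun ω => g (Z 0 ω)) P :=
    Integrable.of_bound (hgm.comp hZ).aestronglyMeasurable ‖g‖
      (ae_of_all _ fun ω => g.norm_coe_le_norm _)
  set a := ∫ ω, g (Z 0 ω) ∂P with ha
  have haM : |a| ≤ ‖g‖ := by
    simpa using norm_integral_le_of_norm_le_const (μ := P) (f := fun ω => g (Z 0 ω)) (C := ‖g‖)
      (ae_of_all _ fun ω => g.norm_coe_le_norm _)
  have hGM : ∀ z, |g z - a| ≤ 2 * ‖g‖ := fun z => by
    have h1 := g.norm_coe_le_norm z
    rw [Real.norm_eq_abs] at h1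
    linarith [abs_sub (g z) a]
  have hGp : Integrable (fun ω => |g (Z 0 ω) - a| ^ (2 + δ)) P := by
    refine Integrable.of_bound ((((hgm.comp hZ).sub_const a).norm.pow_const
      (2 + δ)).aestronglyMeasurable) ((2 * ‖g‖) ^ (2 + δ)) (ae_of_all _ fun ω => ?_)
    rw [Real.norm_of_nonneg (by positivity)]
    exact Real.rpow_le_rpow (abs_nonneg _) (hGM _) hp.le
  have hGint : Integrable (covFn P Z fun z => g z - a) :=
    (hψ.const_mul _).mono' (h.measurable_covFn (hgm.sub_const a)).aestronglyMeasurable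
      (ae_of_all _ fun x => hcov _ (hgm.sub_const a) hGp x)
  have hRint : Integrable (covFn P Z fun z => H z - g z) :=
    (hψ.const_mul _).mono' (h.measurable_covFn hRm).aestronglyMeasurable
      (ae_of_all _ fun x => hcov _ hRm hgi x)
  have hce : (covFn P Z fun z => H z - (g z - a)) = covFn P Z fun z => H z - g z := by
    funext x
    rw [← h.covFn_sub_const hRm hR1 hR2 (-a) x]
    congr 1
    funext z
    ring
  have hsq : Integrable (fun ω => (H (Z 0 ω) - (g (Z 0 ω) - a)) ^ 2) P := by
    have : Integrable (fun ω => (H (Z 0 ω) - g (Z 0 ω)) ^ 2 +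
        (2 * a) * (H (Z 0 ω) - g (Z 0 ω)) + a ^ 2) P :=
      (hR2.add (hR1.const_mul (2 * a))).add (integrable_const _)
    refine this.congr (ae_of_all _ fun ω => ?_)
    dsimp only
    ring
  refine ⟨fun z => g z - a, 2 * ‖g‖, g.continuous.sub continuous_const, hGM, ?_, hGint, hsq,
    by rwa [hce], ?_⟩
  · rw [integral_sub hg1 (integrable_const _)]
    simp [ha]
  · rw [hce]
    have hA : (∫ ω, |H (Z 0 ω) - g (Z 0 ω)| ^ (2 + δ) ∂P) ^ (2 / (2 + δ)) ≤ ε / (I + 1) := by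
      have h1 := Real.rpow_le_rpow (integral_nonneg fun ω => by positivity) hg
        (by positivity : 0 ≤ 2 / (2 + δ))
      rwa [← Real.rpow_mul hq.le, div_mul_div_cancel₀ two_ne_zero, div_self hp.ne',
        Real.rpow_one] at h1
    calc _ ≤ ∫ x, ε / (I + 1) * |ψ x| := by
          refine integral_mono hRint.abs (hψ.abs.const_mul _) fun x => ?_
          refine (hcov _ hRm hgi x).trans ?_
          refine (mul_le_mul_of_nonneg_left (le_abs_self _)
            (Real.rpow_nonneg (integral_nonneg fun ω => by positivity) _)).trans ?_
          exact mul_le_mul_of_nonneg_right hA (abs_nonneg _)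
      _ = ε * (I / (I + 1)) := by rw [integral_const_mul]; ring
      _ < ε := by
          have : I / (I + 1) < 1 := by rw [div_lt_one (by positivity)]; linarith
          nlinarith

end IsStationaryMaxStable

lemma abs_integral_sq_sub_le {Ω : Type*} [MeasurableSpace Ω] {P : Measure Ω} {A B : Ω → ℝ}
    (hA2 : Integrable (fun ω => A ω ^ 2) P) (hB2 : Integrable (fun ω => B ω ^ 2) P)
    (hD2 : Integrable (fun ω => (A ω - B ω) ^ 2) P) {e : ℝ} (he : 0 < e)
    (hDe : ∫ ω, (A ω - B ω) ^ 2 ∂P ≤ e ^ 2) :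
    |∫ ω, B ω ^ 2 ∂P - ∫ ω, A ω ^ 2 ∂P| ≤ e ^ 2 + e * (∫ ω, A ω ^ 2 ∂P + 1) := by
  rw [← integral_sub hB2 hA2, ← Real.norm_eq_abs]
  have hi : Integrable (fun ω => (A ω - B ω) ^ 2 + e * A ω ^ 2) P := hD2.add (hA2.const_mul e)
  calc _ ≤ ∫ ω, ((A ω - B ω) ^ 2 + e * A ω ^ 2 + (A ω - B ω) ^ 2 / e) ∂P := by
        refine norm_integral_le_of_norm_le (hi.add (hD2.div_const e)) (ae_of_all _ fun ω => ?_)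
        have h1 : (A ω - B ω) ^ 2 / e * e = (A ω - B ω) ^ 2 := div_mul_cancel₀ _ he.ne'
        have h2 : 0 ≤ (A ω - B ω) ^ 2 / e := by positivity
        have h3 : |2 * A ω * (A ω - B ω)| ≤ e * A ω ^ 2 + (A ω - B ω) ^ 2 / e := by
          rw [← mul_le_mul_iff_left₀ he, add_mul, h1, ← abs_of_pos he, ← abs_mul, abs_of_pos he,
            abs_le]
          constructor <;>
            nlinarith [sq_nonneg (e * A ω + (A ω - B ω)), sq_nonneg (e * A ω - (A ω - B ω))]
        rw [abs_le] at h3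
        rw [Real.norm_eq_abs, abs_le]
        constructor <;> nlinarith [sq_nonneg (A ω - B ω)]
    _ ≤ _ := by
        rw [integral_add hi (hD2.div_const e), integral_add hD2 (hA2.const_mul e),
          integral_const_mul, integral_div]
        have : (∫ ω, (A ω - B ω) ^ 2 ∂P) / e ≤ e := by
          rw [div_le_iff₀ he]
          linarith [sq e]
        linarith

section

variable {Ω : Type*} [MeasurableSpace Ω] {P : Measure Ω} [IsProbabilityMeasure P]

lemma abs_exp_neg_sub_exp_neg_le {x y : ℝ} (hx : 0 ≤ x) (hy : 0 ≤ y) :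
    |Real.exp (-x) - Real.exp (-y)| ≤ |x - y| := by
  wlog hxy : x ≤ y generalizing x y
  · rw [abs_sub_comm, abs_sub_comm x]
    exact this hy hx (le_of_not_ge hxy)
  have h1 : Real.exp (-y) ≤ Real.exp (-x) := Real.exp_le_exp.2 (by linarith)
  have h2 : Real.exp (-x) ≤ 1 := Real.exp_le_one_iff.2 (by linarith)
  have h3 := Real.add_one_le_exp (x - y)
  have h4 : Real.exp (-y) = Real.exp (-x) * Real.exp (x - y) := by
    rw [← Real.exp_add]
    ring_nf
  rw [abs_of_nonneg (sub_nonneg.2 h1), abs_of_nonpos (sub_nonpos.2 hxy), h4]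
  nlinarith [Real.exp_pos (-x)]

lemma norm_integral_expi_sub_le {A B : Ω → ℝ} (hA : Measurable A) (hB : Measurable B)
    (hD2 : Integrable (fun ω => (A ω - B ω) ^ 2) P) {e : ℝ} (he : 0 ≤ e)
    (hDe : ∫ ω, (A ω - B ω) ^ 2 ∂P ≤ e ^ 2) (t : ℝ) :
    ‖∫ ω, expi (t * A ω) ∂P - ∫ ω, expi (t * B ω) ∂P‖ ≤ |t| * e := by
  have hint : ∀ {X : Ω → ℝ}, Measurable X → Integrable (fun ω => expi (t * X ω)) P := fun hX =>
    Integrable.of_bound (measurable_expi.comp (hX.const_mul t)).aestronglyMeasurable 1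
      (ae_of_all _ fun ω => (norm_expi _).le)
  have hD1 : Integrable (fun ω => A ω - B ω) P := by
    refine ((integrable_const (1 : ℝ)).add hD2).mono' (hA.sub hB).aestronglyMeasurable
      (ae_of_all _ fun ω => ?_)
    rw [Real.norm_eq_abs, Pi.add_apply, ← sq_abs]
    nlinarith [sq_nonneg (|A ω - B ω| - 1), abs_nonneg (A ω - B ω)]
  rw [← integral_sub (hint hA) (hint hB)]
  calc _ ≤ ∫ ω, |t| * |A ω - B ω| ∂P := by
        refine norm_integral_le_of_norm_le (hD1.abs.const_mul _) (ae_of_all _ fun ω => ?_)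
        have e1 : expi (t * A ω) - expi (t * B ω) =
            expi (t * B ω) * (expi (t * (A ω - B ω)) - 1) := by
          rw [mul_sub, ← expi_add, mul_one]
          ring_nf
        rw [e1, norm_mul, norm_expi, one_mul, ← abs_mul]
        exact norm_expi_sub_one_le _
    _ ≤ |t| * e := by
        rw [integral_const_mul]
        refine mul_le_mul_of_nonneg_left ?_ (abs_nonneg t)
        refine (integral_abs_le_sqrt hD1 hD2).trans ?_
        exact Real.sqrt_le_iff.2 ⟨he, hDe⟩

lemma norm_charFun_sub_exp_le {A B : Ω → ℝ} (hA : Measurable A) (hB : Measurable B)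
    (hA2 : Integrable (fun ω => A ω ^ 2) P) (hB2 : Integrable (fun ω => B ω ^ 2) P)
    (hD2 : Integrable (fun ω => (A ω - B ω) ^ 2) P) {e σ : ℝ} (he : 0 < e) (hσ : 0 ≤ σ)
    (hDe : ∫ ω, (A ω - B ω) ^ 2 ∂P ≤ e ^ 2) (t : ℝ) :
    ‖∫ ω, expi (t * A ω) ∂P - Complex.exp ((-(t ^ 2 * σ / 2) : ℝ) : ℂ)‖ ≤
      |t| * e + ‖∫ ω, expi (t * B ω) ∂P -
        Complex.exp ((-(t ^ 2 * (∫ ω, B ω ^ 2 ∂P) / 2) : ℝ) : ℂ)‖ +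
      t ^ 2 / 2 * (e ^ 2 + e * (∫ ω, A ω ^ 2 ∂P + 1) + |∫ ω, A ω ^ 2 ∂P - σ|) := by
  have h1 := norm_integral_expi_sub_le hA hB hD2 he.le hDe t
  have h2 := abs_integral_sq_sub_le hA2 hB2 hD2 he hDe
  set b := ∫ ω, B ω ^ 2 ∂P
  set a := ∫ ω, A ω ^ 2 ∂P
  have hb : 0 ≤ b := integral_nonneg fun ω => sq_nonneg _
  have h3 : ‖Complex.exp ((-(t ^ 2 * b / 2) : ℝ) : ℂ) -
      Complex.exp ((-(t ^ 2 * σ / 2) : ℝ) : ℂ)‖ ≤ t ^ 2 / 2 * |b - σ| := by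
    rw [← Complex.ofReal_exp, ← Complex.ofReal_exp, ← Complex.ofReal_sub, Complex.norm_real,
      Real.norm_eq_abs]
    refine (abs_exp_neg_sub_exp_neg_le (by positivity) (by positivity)).trans (le_of_eq ?_)
    have e1 : t ^ 2 * b / 2 - t ^ 2 * σ / 2 = t ^ 2 / 2 * (b - σ) := by ring
    rw [e1, abs_mul, abs_of_nonneg (by positivity : 0 ≤ t ^ 2 / 2)]
  have h4 : |b - σ| ≤ |b - a| + |a - σ| := abs_sub_le _ _ _
  have h5 : t ^ 2 / 2 * |b - σ| ≤
      t ^ 2 / 2 * (e ^ 2 + e * (a + 1) + |a - σ|) := by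
    refine mul_le_mul_of_nonneg_left ?_ (by positivity)
    linarith
  have h6 := norm_sub_le_norm_sub_add_norm_sub (∫ ω, expi (t * A ω) ∂P)
    (∫ ω, expi (t * B ω) ∂P) (Complex.exp ((-(t ^ 2 * σ / 2) : ℝ) : ℂ))
  have h7 := norm_sub_le_norm_sub_add_norm_sub (∫ ω, expi (t * B ω) ∂P)
    (Complex.exp ((-(t ^ 2 * b / 2) : ℝ) : ℂ)) (Complex.exp ((-(t ^ 2 * σ / 2) : ℝ) : ℂ))
  linarith

/-- Random variables that are approximable in mean square, to any accuracy, by asymptotically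
Gaussian ones are asymptotically Gaussian. -/
theorem tendsto_charFun_of_approx {A : ℕ → Ω → ℝ} (hA : ∀ n, Measurable (A n))
    (hA2 : ∀ n, Integrable (fun ω => A n ω ^ 2) P) {σ : ℝ} (hσ : 0 ≤ σ)
    (hlim : Tendsto (fun n => ∫ ω, A n ω ^ 2 ∂P) atTop (𝓝 σ)) (t : ℝ)
    (happ : ∀ e, 0 < e → ∃ B : ℕ → Ω → ℝ, (∀ n, Measurable (B n)) ∧
      (∀ n, Integrable (fun ω => B n ω ^ 2) P) ∧
      (∀ᶠ n in atTop, ∫ ω, (A n ω - B n ω) ^ 2 ∂P ≤ e ^ 2) ∧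
      Tendsto (fun n => ∫ ω, expi (t * B n ω) ∂P -
        Complex.exp ((-(t ^ 2 * (∫ ω, B n ω ^ 2 ∂P) / 2) : ℝ) : ℂ)) atTop (𝓝 0)) :
    Tendsto (fun n => ∫ ω, expi (t * A n ω) ∂P) atTop
      (𝓝 (Complex.exp ((-(t ^ 2 * σ / 2) : ℝ) : ℂ))) := by
  rw [Metric.tendsto_nhds]
  intro ε hε
  have hφ : Tendsto (fun e : ℝ => |t| * e + t ^ 2 / 2 * (e ^ 2 + e * (σ + 1))) (𝓝[>] 0) (𝓝 0) := by
    have : Continuous fun e : ℝ => |t| * e + t ^ 2 / 2 * (e ^ 2 + e * (σ + 1)) := by fun_prop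
    simpa using this.continuousWithinAt (s := Set.Ioi 0) (x := 0) |>.tendsto
  obtain ⟨e, he1, he⟩ := ((hφ.eventually (gt_mem_nhds (half_pos hε))).and
    self_mem_nhdsWithin).exists
  obtain ⟨B, hB, hB2, hDe, hlimB⟩ := happ e he
  have hsmall : Tendsto (fun n => |t| * e + ‖∫ ω, expi (t * B n ω) ∂P -
      Complex.exp ((-(t ^ 2 * (∫ ω, B n ω ^ 2 ∂P) / 2) : ℝ) : ℂ)‖ + t ^ 2 / 2 *
        (e ^ 2 + e * (∫ ω, A n ω ^ 2 ∂P + 1) + |∫ ω, A n ω ^ 2 ∂P - σ|)) atTop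
      (𝓝 (|t| * e + ‖(0 : ℂ)‖ + t ^ 2 / 2 * (e ^ 2 + e * (σ + 1) + |σ - σ|))) :=
    (tendsto_const_nhds.add hlimB.norm).add (((tendsto_const_nhds.add
      ((hlim.add_const 1).const_mul e)).add (hlim.sub_const σ).abs).const_mul _)
  rw [norm_zero, sub_self, abs_zero, add_zero, add_zero] at hsmall
  filter_upwards [hDe, hsmall.eventually (gt_mem_nhds (he1.trans (half_lt_self hε)))] with n h1 h2
  have hD2 : Integrable (fun ω => (A n ω - B n ω) ^ 2) P := by
    refine (((hA2 n).const_mul 2).add ((hB2 n).const_mul 2)).mono'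
      (((hA n).sub (hB n)).pow_const 2).aestronglyMeasurable (ae_of_all _ fun ω => ?_)
    rw [Real.norm_of_nonneg (sq_nonneg _), Pi.add_apply]
    nlinarith [sq_nonneg (A n ω + B n ω)]
  rw [dist_eq_norm]
  exact (norm_charFun_sub_exp_le (hA n) (hB n) (hA2 n) (hB2 n) hD2 he hσ h1 t).trans_lt h2

end

namespace IsStationaryMaxStable

variable {d : ℕ} {Ω : Type*} [MeasurableSpace Ω] {P : Measure Ω}
  {Z : EuclideanSpace ℝ (Fin d) → Ω → ℝ} [IsProbabilityMeasure P]

lemma ae_fieldIntegral_sub (h : IsStationaryMaxStable P Z) {H G : ℝ → ℝ} (hH : Measurable H)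
    (hG : Measurable G) (hH1 : Integrable (fun ω => H (Z 0 ω)) P)
    (hG1 : Integrable (fun ω => G (Z 0 ω)) P) {V U : Set (EuclideanSpace ℝ (Fin d))}
    (hV : volume V ≠ ∞) (hU : MeasurableSet U) (hUV : U ⊆ V) :
    ∀ᵐ ω ∂P, fieldIntegral Z H V ω - fieldIntegral Z G U ω =
      fieldIntegral Z (fun z => H z - G z) V ω + fieldIntegral Z G (V \ U) ω := by
  filter_upwards [h.ae_integrableOn hH hH1 hV, h.ae_integrableOn hG hG1 hV] with ω h1 h2
  simp only [fieldIntegral]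
  rw [integral_sub h1 h2, setIntegral_sdiff hU h2 hUV]
  ring

lemma integral_sq_fieldIntegral_sub_le (h : IsStationaryMaxStable P Z) {H G : ℝ → ℝ}
    (hH : Measurable H) (hG : Measurable G) (hH1 : Integrable (fun ω => H (Z 0 ω)) P)
    (hG1 : Integrable (fun ω => G (Z 0 ω)) P) (hH0 : ∫ ω, H (Z 0 ω) ∂P = 0)
    (hG0 : ∫ ω, G (Z 0 ω) ∂P = 0) (hG2 : Integrable (fun ω => G (Z 0 ω) ^ 2) P)
    (hR2 : Integrable (fun ω => (H (Z 0 ω) - G (Z 0 ω)) ^ 2) P)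
    (hGc : Integrable (covFn P Z G)) (hRc : Integrable (covFn P Z fun z => H z - G z))
    {V U : Set (EuclideanSpace ℝ (Fin d))} (hV : volume V ≠ ∞) (hU : MeasurableSet U)
    (hUV : U ⊆ V) :
    ∫ ω, (fieldIntegral Z H V ω - fieldIntegral Z G U ω) ^ 2 ∂P ≤
      2 * ((volume V).toReal * ∫ x, |covFn P Z (fun z => H z - G z) x|) +
      2 * ((volume (V \ U)).toReal * ∫ x, |covFn P Z G x|) := by
  have hR : Measurable fun z => H z - G z := hH.sub hG
  have hR0 : ∫ ω, (H (Z 0 ω) - G (Z 0 ω)) ∂P = 0 := by rw [integral_sub hH1 hG1, hH0, hG0, sub_zero]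
  have hD : volume (V \ U) ≠ ∞ := measure_ne_top_of_subset Set.sdiff_subset hV
  have i1 := (h.integrable_fieldIntegral_sq hR hR2 hV).const_mul 2
  have i2 := (h.integrable_fieldIntegral_sq hG hG2 hD).const_mul 2
  have b1 := h.integral_fieldIntegral_sq_le hR hR0 hR2 hRc hV
  have b2 := h.integral_fieldIntegral_sq_le hG hG0 hG2 hGc hD
  calc _ ≤ ∫ ω, (2 * fieldIntegral Z (fun z => H z - G z) V ω ^ 2 +
        2 * fieldIntegral Z G (V \ U) ω ^ 2) ∂P := by
        refine integral_mono_of_nonneg (ae_of_all _ fun ω => sq_nonneg _) (i1.add i2) ?_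
        filter_upwards [h.ae_fieldIntegral_sub hH hG hH1 hG1 hV hU hUV] with ω hω
        rw [hω]
        nlinarith [sq_nonneg (fieldIntegral Z (fun z => H z - G z) V ω -
          fieldIntegral Z G (V \ U) ω)]
    _ ≤ _ := by
        rw [integral_add i1 i2, integral_const_mul, integral_const_mul]
        linarith

/-- The characteristic functions of the normalized integrals of a centred function of the field
converge to a Gaussian characteristic function. -/
theorem tendsto_charFun_fieldIntegral (h : IsStationaryMaxStable P Z) (hd : 0 < d) {δ : ℝ}
    (hδ : 0 < δ) {ψ : EuclideanSpace ℝ (Fin d) → ℝ} (hψ : Integrable ψ)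
    (hcov : ∀ H : ℝ → ℝ, Measurable H → Integrable (fun ω => |H (Z 0 ω)| ^ (2 + δ)) P → ∀ x,
      |covFn P Z H x| ≤ (∫ ω, |H (Z 0 ω)| ^ (2 + δ) ∂P) ^ (2 / (2 + δ)) * ψ x)
    {ρ : (Fin d → ℤ) → ℝ} {C : ℝ} (hρ : Summable ρ)
    (hρ' : Summable fun k => ρ k * (2 * ‖k‖ + 1) ^ d)
    (hmix : ∀ (G : ℝ → ℝ) (M : ℝ), Continuous G → (∀ z, |G z| ≤ M) → ∫ ω, G (Z 0 ω) ∂P = 0 →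
      IsMixingField P (cubeIntegral Z G) ρ C M)
    {H : ℝ → ℝ} (hH : Measurable H) (hHp : Integrable (fun ω => |H (Z 0 ω)| ^ (2 + δ)) P)
    (hH0 : ∫ ω, H (Z 0 ω) ∂P = 0) {V : ℕ → Set (EuclideanSpace ℝ (Fin d))} (hV : IsVanHove V)
    (hσ : 0 ≤ ∫ x, covFn P Z H x) (t : ℝ) :
    Tendsto (fun n => ∫ ω, expi (t * (fieldIntegral Z H (V n) ω / √(volume (V n)).toReal)) ∂P)
      atTop (𝓝 (Complex.exp ((-(t ^ 2 * (∫ x, covFn P Z H x) / 2) : ℝ) : ℂ))) := by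
  have hHa : AEStronglyMeasurable (fun ω => H (Z 0 ω)) P :=
    (hH.comp (h.measurable_apply 0)).aestronglyMeasurable
  have hH1 : Integrable (fun ω => H (Z 0 ω)) P := integrable_of_rpow (by linarith) hHa hHp
  have hH2 : Integrable (fun ω => H (Z 0 ω) ^ 2) P := integrable_sq_of_rpow (by linarith) hHa hHp
  have hHc : Integrable (covFn P Z H) :=
    (hψ.const_mul _).mono' (h.measurable_covFn hH).aestronglyMeasurable
      (ae_of_all _ fun x => hcov _ hH hHp x)
  have hsq : ∀ (X : Ω → ℝ) n, (fun ω => (X ω / √(volume (V n)).toReal) ^ 2) =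
      fun ω => X ω ^ 2 / (volume (V n)).toReal := fun X n => by
    funext ω
    rw [div_pow, Real.sq_sqrt ENNReal.toReal_nonneg]
  refine tendsto_charFun_of_approx (fun n => (h.measurable_fieldIntegral hH).div_const _)
    (fun n => ?_) hσ ?_ t fun e he => ?_
  · rw [hsq]
    exact (h.integrable_fieldIntegral_sq hH hH2 (hV.volume_ne_top n)).div_const _
  · refine (hV.tendsto_integral_integral_div hd (h.measurable_covFn hH) hHc).congr fun n => ?_
    rw [hsq, integral_div, h.integral_fieldIntegral_sq hH hH0 hH2 (hV.volume_ne_top n)]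
  obtain ⟨G, M, hG, hGM, hG0, hGc, hR2, hRc, hRe⟩ := h.exists_continuous_approx hδ hψ hcov hH hHp
    (ε := e ^ 2 / 4) (by positivity)
  have hGa : AEStronglyMeasurable (fun ω => G (Z 0 ω)) P :=
    (hG.measurable.comp (h.measurable_apply 0)).aestronglyMeasurable
  have hG1 : Integrable (fun ω => G (Z 0 ω)) P :=
    Integrable.of_bound hGa M (ae_of_all _ fun ω => hGM _)
  have hG2 : Integrable (fun ω => G (Z 0 ω) ^ 2) P := by
    refine Integrable.of_bound (hGa.pow 2) (M ^ 2) (ae_of_all _ fun ω => ?_)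
    rw [norm_pow]
    exact pow_le_pow_left₀ (norm_nonneg _) (hGM _) 2
  have hUV := fun n => cubePart_subset (V n)
  refine ⟨fun n ω => fieldIntegral Z G (cubePart (V n)) ω / √(volume (V n)).toReal,
    fun n => (h.measurable_fieldIntegral hG.measurable).div_const _, fun n => ?_, ?_, ?_⟩
  · rw [hsq]
    exact (h.integrable_fieldIntegral_sq hG.measurable hG2
      (measure_ne_top_of_subset (hUV n) (hV.volume_ne_top n))).div_const _
  · have hlim := (hV.tendsto_boundaryLayer (r := d) (Nat.cast_pos.2 hd)).const_mul
      (∫ x, |covFn P Z G x|)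
    rw [mul_zero] at hlim
    filter_upwards [hlim.eventually (gt_mem_nhds (by positivity : 0 < e ^ 2 / 4)),
      hV.tendsto_volume.eventually_gt_atTop 0] with n hn hpos
    simp_rw [← sub_div]
    rw [hsq, integral_div, div_le_iff₀ hpos]
    have hb := h.integral_sq_fieldIntegral_sub_le hH hG.measurable hH1 hG1 hH0 hG0 hG2 hR2 hGc hRc
      (hV.volume_ne_top n) (measurableSet_cubePart (V n)) (hUV n)
    have hcG : 0 ≤ ∫ x, |covFn P Z G x| := integral_nonneg fun _ => abs_nonneg _
    have hm : (volume (V n \ cubePart (V n))).toReal ≤ (volume (boundaryLayer (V n) d)).toReal :=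
      ENNReal.toReal_mono (volume_boundaryLayer_ne_top hd (hV.bounded n)
        (IsVanHove.nonempty_of_pos hpos) d) (measure_mono (sdiff_cubePart_subset _))
    have h1 := mul_le_mul_of_nonneg_right hm hcG
    rw [← mul_div_assoc, div_lt_iff₀ hpos] at hn
    have h2 := mul_lt_mul_of_pos_left hRe hpos
    linarith
  · have key := (hmix G M hG hGM hG0).tendsto_charFun_sub hρ' hρ
      (Γ := fun n => (finite_latticePart (hV.bounded n)).toFinset) hV.tendsto_volume
      (fun n => card_latticePart_le (hV.bounded n)) t
    refine key.congr fun n => ?_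
    have hae : ∀ᵐ ω ∂P, ∑ j ∈ (finite_latticePart (hV.bounded n)).toFinset, cubeIntegral Z G j ω =
        fieldIntegral Z G (cubePart (V n)) ω := by
      filter_upwards [h.ae_integrableOn hG.measurable hG1 (hV.volume_ne_top n)] with ω hω
      exact sum_cubeIntegral (hV.bounded n) hω
    have e1 : ∫ ω, expi (t / √(volume (V n)).toReal *
        ∑ j ∈ (finite_latticePart (hV.bounded n)).toFinset, cubeIntegral Z G j ω) ∂P =
        ∫ ω, expi (t * (fieldIntegral Z G (cubePart (V n)) ω / √(volume (V n)).toReal)) ∂P := by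
      refine integral_congr_ae ?_
      filter_upwards [hae] with ω hω
      rw [hω]
      ring_nf
    have e2 : ∫ ω, (∑ j ∈ (finite_latticePart (hV.bounded n)).toFinset,
        cubeIntegral Z G j ω) ^ 2 ∂P = ∫ ω, fieldIntegral Z G (cubePart (V n)) ω ^ 2 ∂P := by
      refine integral_congr_ae ?_
      filter_upwards [hae] with ω hω
      rw [hω]
    rw [e1, e2, hsq, integral_div, div_pow, Real.sq_sqrt ENNReal.toReal_nonneg, div_mul_eq_mul_div,
      mul_div_assoc (t ^ 2)]

end IsStationaryMaxStable

/-- Convergence of characteristic functions implies convergence in distribution. -/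
lemma tendstoInDistribution_of_tendsto_expi {Ω : Type*} [MeasurableSpace Ω] {P : Measure Ω}
    [IsProbabilityMeasure P] {S : ℕ → Ω → ℝ} (hS : ∀ n, Measurable (S n)) (μ : Measure ℝ)
    [IsProbabilityMeasure μ]
    (h : ∀ t, Tendsto (fun n => ∫ ω, expi (t * S n ω) ∂P) atTop (𝓝 (charFun μ t))) :
    TendstoInDistribution P S μ := by
  have hp : ∀ n, IsProbabilityMeasure (P.map (S n)) := fun n =>
    Measure.isProbabilityMeasure_map (hS n).aemeasurable
  let ν : ℕ → ProbabilityMeasure ℝ := fun n => ⟨P.map (S n), hp n⟩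
  let ν' : ProbabilityMeasure ℝ := ⟨μ, inferInstance⟩
  have key : Tendsto ν atTop (𝓝 ν') := by
    refine ProbabilityMeasure.tendsto_iff_tendsto_charFun.2 fun t => ?_
    refine (h t).congr fun n => ?_
    change _ = charFun (P.map (S n)) t
    rw [charFun_apply_real, integral_map (hS n).aemeasurable
      (by fun_prop)]
    refine integral_congr_ae (ae_of_all _ fun ω => ?_)
    simp only [expi]
    push_cast
    ring_nf
  intro f
  refine (ProbabilityMeasure.tendsto_iff_forall_integral_tendsto.1 key f).congr fun n => ?_
  exact integral_map (hS n).aemeasurable f.continuous.aestronglyMeasurable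

/-- **CLT for functions of stationary max-stable random fields on ℝ^d.**
If `Z` is a simple, strictly stationary, sample-continuous, jointly measurable max-stable
random field, `F` is Borel measurable with a `(2+δ)`-moment, `σ² = ∫ Cov(F(Z(0)), F(Z(x))) dx > 0`,
and the extremal coefficients of pairs of unit cubes satisfy the polynomial decay condition
`θ([0,1]^d) + θ([h,h+1]) − θ([0,1]^d ∪ [h,h+1]) ≤ K‖h‖^{−b}` with `b > d·max{2, (2+δ)/δ}`,
then `X = F(Z(·))` satisfies the CLT: its covariance function is absolutely integrable and the
normalized integrals over any Van Hove sequence converge in distribution to `N(0, σ²)`. -/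
theorem clt_of_maxStable
    {d : ℕ} (hd : 0 < d) {Ω : Type*} [MeasurableSpace Ω]
    (P : Measure Ω) [IsProbabilityMeasure P]
    (Z : EuclideanSpace ℝ (Fin d) → Ω → ℝ)
    -- joint measurability
    (hjm : Measurable fun p : EuclideanSpace ℝ (Fin d) × Ω => Z p.1 p.2)
    -- sample continuity
    (hcont : ∀ᵐ ω ∂P, Continuous fun x => Z x ω)
    -- simple: standard Fréchet margins
    (hfrechet : ∀ x, ∀ z : ℝ, 0 < z →
      P {ω | Z x ω ≤ z} = ENNReal.ofReal (Real.exp (-1 / z)))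
    -- max-stability of the finite-dimensional distributions
    (hmaxstable : ∀ T : ℕ, 1 ≤ T → ∀ (n : ℕ) (x : Fin n → EuclideanSpace ℝ (Fin d))
      (z : Fin n → ℝ), (∀ i, 0 < z i) →
      (P {ω | ∀ i, Z (x i) ω ≤ (T : ℝ) * z i}) ^ T = P {ω | ∀ i, Z (x i) ω ≤ z i})
    -- strict stationarity
    (hstat : ∀ (x₀ : EuclideanSpace ℝ (Fin d)) (n : ℕ)
      (x : Fin n → EuclideanSpace ℝ (Fin d)),
      Measure.map (fun ω i => Z (x i + x₀) ω) P = Measure.map (fun ω i => Z (x i) ω) P)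
    (δ : ℝ) (hδ : 0 < δ)
    (F : ℝ → ℝ) (hF : Measurable F)
    -- moment condition
    (hmom : Integrable (fun ω => |F (Z 0 ω)| ^ ((2 : ℝ) + δ)) P)
    -- positive asymptotic variance
    (σ2 : ℝ)
    (hσ2def : σ2 = ∫ x, cov P (fun ω => F (Z 0 ω)) (fun ω => F (Z x ω)) ∂volume)
    (hσ2pos : 0 < σ2)
    -- decay of extremal coefficients of pairs of cubes
    (K b : ℝ) (hK : 0 < K) (hb : (d : ℝ) * max 2 ((2 + δ) / δ) < b)
    (hθ : ∀ h : Fin d → ℤ, h ≠ 0 →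
      extremalCoeff P Z (cube (0 : Fin d → ℤ)) + extremalCoeff P Z (cube h)
        - extremalCoeff P Z (cube (0 : Fin d → ℤ) ∪ cube h) ≤ K * ‖toE h‖ ^ (-b)) :
    Integrable
      (fun x => |cov P (fun ω => F (Z 0 ω)) (fun ω => F (Z x ω))|) volume ∧
    ∀ V : ℕ → Set (EuclideanSpace ℝ (Fin d)), IsVanHove V →
      TendstoInDistribution P
        (fun n ω =>
          (∫ x in V n, (F (Z x ω) - ∫ ω', F (Z x ω') ∂P) ∂volume)
            / Real.sqrt (volume (V n)).toReal)
        (gaussianReal 0 (Real.toNNReal σ2)) := by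
  have h : IsStationaryMaxStable P Z := ⟨hjm, hcont, hfrechet, hmaxstable, hstat⟩
  have hd' : (0 : ℝ) < d := Nat.cast_pos.2 hd
  have hp : 0 < 2 + δ := by linarith
  have hb2 : 2 * d < b := by
    have := mul_le_mul_of_nonneg_left (le_max_left 2 ((2 + δ) / δ)) hd'.le
    linarith
  have hbδ : d < b * (δ / (2 + δ)) := by
    have h1 := (mul_le_mul_of_nonneg_left (le_max_right 2 ((2 + δ) / δ)) hd'.le).trans_lt hb
    rwa [← mul_div_assoc, lt_div_iff₀ hp, ← div_lt_iff₀ hδ, mul_div_assoc]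
  have hb0 : 0 ≤ b := by linarith
  obtain ⟨C, hC, hmix⟩ := h.exists_mixing_points hK hb0 hθ
  obtain ⟨ψ, hψ, hcov⟩ := h.exists_covFn_bound hC hδ hb0 hbδ hmix
  have hFa : AEStronglyMeasurable (fun ω => F (Z 0 ω)) P :=
    (hF.comp (h.measurable_apply 0)).aestronglyMeasurable
  have hF1 : Integrable (fun ω => F (Z 0 ω)) P := integrable_of_rpow (by linarith) hFa hmom
  have hF2 : Integrable (fun ω => F (Z 0 ω) ^ 2) P := integrable_sq_of_rpow (by linarith) hFa hmom
  have hFc : Integrable (covFn P Z F) :=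
    (hψ.const_mul _).mono' (h.measurable_covFn hF).aestronglyMeasurable
      (ae_of_all _ fun x => hcov _ hF hmom x)
  refine ⟨hFc.abs, fun V hV => ?_⟩
  set a := ∫ ω, F (Z 0 ω) ∂P with ha
  have hH : Measurable fun z => F z - a := hF.sub_const a
  have hHp : Integrable (fun ω => |F (Z 0 ω) - a| ^ (2 + δ)) P := by
    have hpe : ENNReal.ofReal (2 + δ) ≠ 0 := by simpa using hp
    have hL : MemLp (fun ω => F (Z 0 ω)) (ENNReal.ofReal (2 + δ)) P := by
      rw [← integrable_norm_rpow_iff hFa hpe ENNReal.ofReal_ne_top, ENNReal.toReal_ofReal hp.le]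
      exact hmom
    have := (hL.sub (memLp_const a)).integrable_norm_rpow hpe ENNReal.ofReal_ne_top
    rwa [ENNReal.toReal_ofReal hp.le] at this
  have hH0 : ∫ ω, (F (Z 0 ω) - a) ∂P = 0 := by
    rw [integral_sub hF1 (integrable_const _)]
    simp [ha]
  have hc : (covFn P Z fun z => F z - a) = covFn P Z F :=
    funext fun x => h.covFn_sub_const hF hF1 hF2 a x
  have hσ : ∫ x, covFn P Z (fun z => F z - a) x = σ2 := by
    rw [hc, hσ2def]
    rfl
  have hmean : ∀ x, ∫ ω, F (Z x ω) ∂P = a := fun x => h.integral_comp_eq hF x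
  simp_rw [hmean]
  refine tendstoInDistribution_of_tendsto_expi
    (fun n => (h.measurable_fieldIntegral hH (W := V n)).div_const _) _ fun t => ?_
  have := h.tendsto_charFun_fieldIntegral hd hδ hψ hcov (summable_rate (by linarith))
    (summable_rate_mul_pow hb2)
    (fun G M hG hGM hG0 => h.isMixingField_cubeIntegral hC.le hmix hG hGM hG0) hH hHp hH0 hV
    (hσ ▸ hσ2pos.le) t
  rw [hσ] at this
  refine this.trans (le_of_eq ?_)
  rw [charFun_gaussianReal, Real.coe_toNNReal _ hσ2pos.le]
  congr 2
  push_cast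
  ring

end
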